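/- arXiv:1212.4187 — 3 statements merged into one kernel-verified Lean document; each statement's English description precedes it below -/
import Mathlib

section
/- Let (X, ℬ, μ) be a measure space with μ(X) = 1, let k ∈ ℕ, and for each 1 ≤ j ≤ k let (T_{n,j})_{n∈ℤ\{0}} be measure-preserving transformations of X such that the whole family {T_{n,j} : n ∈ ℤ\{0}, 1 ≤ j ≤ k} is commuting. Then for every A ∈ ℬ with μ(A) > 0 there exist a nonempty finite set F = {t_1 < … < t_l} of POSITIVE integers and natural numbers (q_t)_{t∈F} with 1 ≤ q_t ≤ t for each t ∈ F, such that, setting 𝒯_j = T_{t_1,j}^{q_{t_1}}∘…∘T_{t_l,j}^{q_{t_l}} for each j, one has μ(A ∩ 𝒯_1^{-1}(A) ∩ … ∩ 𝒯_k^{-1}(A)) > 0. In particular the recurrence is achieved at a rational q = Σ_{t∈F} q_t·(-1)^{t+1}·t! which is a nonzero integer. -/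
open MeasureTheory

/-- The rational-system transformation `𝒯^q = T_{t_1}^{q_{t_1}} ∘ … ∘ T_{t_l}^{q_{t_l}}`
attached to a finite set `F = {t_1 < … < t_l}` of integer indices and exponents `q`. -/
def ratTrans {X : Type*} (T : ℤ → X → X) (q : ℤ → ℕ) (F : Finset ℤ) : X → X :=
  (F.sort (· ≤ ·)).foldr (fun t f => (T t)^[q t] ∘ f) id

/-! Density Hales-Jewett theorem and its application to multiple recurrence. -/


namespace DHJProof

open Classical in
/-- indicator of a proposition -/
noncomputable def ind (p : Prop) : ℝ := if p then 1 else 0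

lemma ind_true {p : Prop} (h : p) : ind p = 1 := by simp [ind, h]
lemma ind_false {p : Prop} (h : ¬ p) : ind p = 0 := by simp [ind, h]
lemma ind_nonneg (p : Prop) : 0 ≤ ind p := by unfold ind; split_ifs <;> norm_num
lemma ind_le_one (p : Prop) : ind p ≤ 1 := by unfold ind; split_ifs <;> norm_num
lemma ind_and (p q : Prop) : ind (p ∧ q) = ind p * ind q := by
  by_cases hp : p <;> by_cases hq : q <;> simp [ind, hp, hq]
lemma ind_not (p : Prop) : ind (¬ p) = 1 - ind p := by
  by_cases hp : p <;> simp [ind, hp]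
lemma ind_mono {p q : Prop} (h : p → q) : ind p ≤ ind q := by
  by_cases hp : p
  · rw [ind_true hp, ind_true (h hp)]
  · rw [ind_false hp]; exact ind_nonneg q

/-- average over a finite type -/
noncomputable def av {ι : Type*} [Finite ι] (f : ι → ℝ) : ℝ :=
  letI := Fintype.ofFinite ι
  (∑ x, f x) / (Nat.card ι : ℝ)

lemma av_eq {ι : Type*} [Fintype ι] (f : ι → ℝ) : av f = (∑ x, f x) / (Nat.card ι : ℝ) := by
  unfold av
  congr!

lemma av_add {ι : Type*} [Finite ι] (f g : ι → ℝ) : av (fun x => f x + g x) = av f + av g := by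
  have := Fintype.ofFinite ι
  simp only [av_eq, Finset.sum_add_distrib, add_div]

lemma av_sub {ι : Type*} [Finite ι] (f g : ι → ℝ) : av (fun x => f x - g x) = av f - av g := by
  have := Fintype.ofFinite ι
  simp only [av_eq, Finset.sum_sub_distrib, sub_div]

lemma av_mul {ι : Type*} [Finite ι] (c : ℝ) (f : ι → ℝ) : av (fun x => c * f x) = c * av f := by
  have := Fintype.ofFinite ι
  simp only [av_eq, ← Finset.mul_sum, mul_div_assoc]

lemma av_sum {ι κ : Type*} [Finite ι] (s : Finset κ) (f : κ → ι → ℝ) :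
    av (fun x => ∑ k ∈ s, f k x) = ∑ k ∈ s, av (f k) := by
  have := Fintype.ofFinite ι
  simp only [av_eq]
  rw [Finset.sum_comm, Finset.sum_div]

lemma av_mono {ι : Type*} [Finite ι] {f g : ι → ℝ} (h : ∀ x, f x ≤ g x) : av f ≤ av g := by
  have := Fintype.ofFinite ι
  simp only [av_eq]
  gcongr
  exact h _

lemma av_const {ι : Type*} [Finite ι] [Nonempty ι] (c : ℝ) : av (fun _ : ι => c) = c := by
  have := Fintype.ofFinite ι
  have : (Nat.card ι : ℝ) ≠ 0 := by exact_mod_cast Nat.card_pos.ne'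
  simp [av_eq]

lemma av_nonneg {ι : Type*} [Finite ι] {f : ι → ℝ} (h : ∀ x, 0 ≤ f x) : 0 ≤ av f := by
  have := Fintype.ofFinite ι
  rw [av_eq]
  exact div_nonneg (Finset.sum_nonneg fun x _ => h x) (by positivity)

lemma av_nonpos {ι : Type*} [Finite ι] {f : ι → ℝ} (h : ∀ x, f x ≤ 0) : av f ≤ 0 := by
  have := Fintype.ofFinite ι
  rw [av_eq]
  exact div_nonpos_of_nonpos_of_nonneg (Finset.sum_nonpos fun x _ => h x) (by positivity)

lemma av_equiv {ι κ : Type*} [Finite ι] [Finite κ] (e : ι ≃ κ) (f : κ → ℝ) :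
    av (fun x => f (e x)) = av f := by
  have := Fintype.ofFinite ι
  have := Fintype.ofFinite κ
  rw [av_eq, av_eq, Nat.card_congr e, Equiv.sum_comp e]

lemma av_prod {ι κ : Type*} [Finite ι] [Finite κ] (f : ι × κ → ℝ) :
    av f = av (fun x => av (fun y => f (x, y))) := by
  have := Fintype.ofFinite ι
  have := Fintype.ofFinite κ
  simp only [av_eq, Fintype.sum_prod_type, Nat.card_prod, Nat.cast_mul, ← Finset.sum_div]
  rw [div_div, mul_comm (Nat.card κ : ℝ)]

lemma av_comm {ι κ : Type*} [Finite ι] [Finite κ] (f : ι → κ → ℝ) :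
    av (fun x => av (fun y => f x y)) = av (fun y => av (fun x => f x y)) := by
  rw [← av_prod (fun p : ι × κ => f p.1 p.2), ← av_prod (fun p : κ × ι => f p.2 p.1)]
  exact av_equiv (Equiv.prodComm κ ι) (fun p : ι × κ => f p.1 p.2) |>.symm

lemma exists_le_of_av {ι : Type*} [Finite ι] [Nonempty ι] {f : ι → ℝ} {a : ℝ} (h : a ≤ av f) :
    ∃ x, a ≤ f x := by
  by_contra! hc
  have := Fintype.ofFinite ι
  have h1 : av f < a := by
    have : (0 : ℝ) < Nat.card ι := by exact_mod_cast Nat.card_pos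
    rw [av_eq, div_lt_iff₀ this]
    calc ∑ x, f x < ∑ _x : ι, a := Finset.sum_lt_sum_of_nonempty Finset.univ_nonempty fun x _ => hc x
      _ = a * Nat.card ι := by simp [mul_comm]
  linarith

lemma exists_mem_of_av_pos {ι : Type*} [Finite ι] {f : ι → ℝ} (h : 0 < av f) :
    ∃ x, 0 < f x := by
  by_contra! hc
  linarith [av_nonpos hc]

lemma av_single {ι : Type*} [Finite ι] {f : ι → ℝ} (hf : ∀ x, 0 ≤ f x) (x : ι) :
    f x / Nat.card ι ≤ av f := by
  have := Fintype.ofFinite ι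
  rw [av_eq]
  gcongr
  exact Finset.single_le_sum (f := f) (fun i _ => hf i) (Finset.mem_univ x)

lemma av_markov {ι : Type*} [Finite ι] [Nonempty ι] {f : ι → ℝ} {a : ℝ} (hf : ∀ x, f x ≤ 1)
    (ha : 0 ≤ a) : av f - a ≤ av (fun x => ind (a ≤ f x)) := by
  have h : av f ≤ av (fun x => ind (a ≤ f x) + a) := by
    apply av_mono
    intro x
    by_cases hx : a ≤ f x
    · rw [ind_true hx]; linarith [hf x]
    · rw [ind_false hx]; linarith
  rw [av_add, av_const] at h
  linarith

lemma av_pigeon {ι L : Type*} [Finite ι] [Finite L] [Nonempty L] {P : L → ι → Prop} {s : ℝ}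
    (h : s ≤ av (fun x => ind (∃ l, P l x))) :
    ∃ l, s / Nat.card L ≤ av (fun x => ind (P l x)) := by
  have := Fintype.ofFinite L
  have hL : (0 : ℝ) < Nat.card L := by exact_mod_cast Nat.card_pos
  apply exists_le_of_av
  rw [av_eq]
  gcongr
  rw [← av_sum]
  refine h.trans (av_mono fun x => ?_)
  by_cases hx : ∃ l, P l x
  · obtain ⟨l, hl⟩ := hx
    rw [ind_true ⟨l, hl⟩, ← ind_true hl]
    exact Finset.single_le_sum (f := fun l => ind (P l x)) (fun i _ => ind_nonneg _)
      (Finset.mem_univ l)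
  · rw [ind_false hx]
    exact Finset.sum_nonneg fun i _ => ind_nonneg _

/-- density of a set of words -/
noncomputable def dens {ι : Type*} [Finite ι] (A : Set ι) : ℝ := av (fun x => ind (x ∈ A))

lemma dens_le_one {ι : Type*} [Finite ι] (A : Set ι) : dens A ≤ 1 := by
  rcases isEmpty_or_nonempty ι with h | h
  · exact (av_nonpos fun x => (h.false x).elim).trans zero_le_one
  · calc dens A ≤ av (fun _ : ι => 1) := av_mono fun x => ind_le_one _
      _ = 1 := av_const 1

lemma dens_nonneg {ι : Type*} [Finite ι] (A : Set ι) : 0 ≤ dens A := av_nonneg fun _ => ind_nonneg _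

lemma nonempty_of_dens {ι : Type*} [Finite ι] {A : Set ι} (h : 0 < dens A) : ∃ x, x ∈ A := by
  obtain ⟨x, hx⟩ := exists_mem_of_av_pos h
  refine ⟨x, ?_⟩
  by_contra hc
  simp [ind_false hc] at hx

section words
variable {α ι κ τ η : Type}

/-- substitute `a` for the wildcard -/
def sub (w : ι → Option α) (a : α) : ι → α := fun c => (w c).getD a

/-- `A` contains a combinatorial line -/
def HasLine (A : Set (ι → α)) : Prop :=
  ∃ w : ι → Option α, (∃ p, w p = none) ∧ ∀ a, sub w a ∈ A

/-- subspace map -/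
def sp (g : ι → α ⊕ η) (x : η → α) : ι → α := fun i => Sum.elim id x (g i)

/-- every wildcard occurs -/
def Proper (g : ι → α ⊕ η) : Prop := ∀ e, ∃ i, g i = Sum.inr e

lemma hasLine_of_sp {g : ι → α ⊕ η} (hg : Proper g) {A : Set (ι → α)}
    (h : HasLine {x | sp g x ∈ A}) : HasLine A := by
  obtain ⟨w, ⟨p, hp⟩, hw⟩ := h
  refine ⟨fun i => Sum.elim some w (g i), ?_, fun a => ?_⟩
  · obtain ⟨i, hi⟩ := hg p
    exact ⟨i, by simp [hi, hp]⟩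
  · have := hw a
    simp only [Set.mem_ofPred_eq] at this
    convert this using 1
    funext i
    simp only [sub, sp]
    rcases g i with c | c <;> simp [sub]

lemma sp_injective {g : ι → α ⊕ η} (hg : Proper g) : Function.Injective (sp g : (η → α) → ι → α) := by
  intro x y h
  funext e
  obtain ⟨i, hi⟩ := hg e
  have := congrFun h i
  simpa [sp, hi] using this

/-- combine words -/
def join (e : ι ≃ κ ⊕ τ) (x : κ → α) (y : τ → α) : ι → α := fun i => Sum.elim x y (e i)

/-- join as an equivalence -/
def joinEquiv (e : ι ≃ κ ⊕ τ) : ((τ → α) × (κ → α)) ≃ (ι → α) where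
  toFun p := join e p.2 p.1
  invFun f := (fun c => f (e.symm (Sum.inr c)), fun c => f (e.symm (Sum.inl c)))
  left_inv p := by
    ext c <;> simp [join]
  right_inv f := by
    funext i
    simp only [join]
    rcases h : e i with c | c
    · simp only [Sum.elim_inl]; rw [← h, e.symm_apply_apply]
    · simp only [Sum.elim_inr]; rw [← h, e.symm_apply_apply]

lemma av_join [Finite ι] [Finite κ] [Finite τ] [Finite α] (e : ι ≃ κ ⊕ τ) (f : (ι → α) → ℝ) :
    av f = av (fun y => av (fun x => f (join e x y))) := by
  rw [← av_equiv (joinEquiv e), av_prod]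
  rfl

lemma exists_split [Finite ι] {N : ℕ} (h : N ≤ Nat.card ι) :
    Nonempty (ι ≃ Fin N ⊕ Fin (Nat.card ι - N)) := by
  have := Fintype.ofFinite ι
  refine ⟨(Finite.equivFin ι).trans ((finCongr ?_).trans finSumFinEquiv.symm)⟩
  omega

lemma hasLine_of_slice (e : ι ≃ κ ⊕ τ) (y : τ → α) {A : Set (ι → α)}
    (h : HasLine {x | join e x y ∈ A}) : HasLine A := by
  obtain ⟨w, ⟨p, hp⟩, hw⟩ := h
  refine ⟨fun i => Sum.elim w (fun c => some (y c)) (e i), ⟨e.symm (Sum.inl p), by simp [hp]⟩,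
    fun a => ?_⟩
  have := hw a
  simp only [Set.mem_ofPred_eq] at this
  convert this using 1
  funext i
  simp only [sub, join]
  rcases e i with c | c <;> simp [sub]

lemma dens_join [Finite ι] [Finite κ] [Finite τ] [Finite α] (e : ι ≃ κ ⊕ τ) (A : Set (ι → α)) :
    dens A = av (fun y => dens {x | join e x y ∈ A}) := av_join e _

/-- every set of density at least `δ` has a line -/
def Good (α ι : Type) [Finite α] [Finite ι] (δ : ℝ) : Prop :=
  ∀ A : Set (ι → α), δ ≤ dens A → HasLine A

/-- density Hales-Jewett -/
def DHJ (α : Type) [Finite α] : Prop := ∀ δ : ℝ, 0 < δ → ∃ n : ℕ, Good α (Fin n) δ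

lemma good_mono [Finite α] [Nonempty α] {N : ℕ} {δ : ℝ} (h : Good α (Fin N) δ) [Finite ι]
    (hc : N ≤ Nat.card ι) : Good α ι δ := by
  intro A hA
  obtain ⟨e⟩ := exists_split hc
  rw [dens_join e] at hA
  obtain ⟨y, hy⟩ := exists_le_of_av hA
  exact hasLine_of_slice e y (h _ hy)

/-- `A` contains an `r`-dimensional subspace -/
def HasSub (r : ℕ) (A : Set (ι → α)) : Prop :=
  ∃ g : ι → α ⊕ Fin r, Proper g ∧ ∀ x, sp g x ∈ A

theorem mdhj [Finite α] [Nonempty α] (h : DHJ α) (r : ℕ) : ∀ δ : ℝ, 0 < δ → ∃ N : ℕ,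
    ∀ (ι : Type) [Finite ι], N ≤ Nat.card ι → ∀ A : Set (ι → α), δ ≤ dens A → HasSub r A := by
  induction r with
  | zero =>
    intro δ hδ
    refine ⟨0, fun ι _ _ A hA => ?_⟩
    obtain ⟨x, hx⟩ := nonempty_of_dens (hδ.trans_le hA)
    exact ⟨fun i => Sum.inl (x i), fun e => e.elim0, fun y => hx⟩
  | succ r ih =>
    intro δ hδ
    obtain ⟨m, hm⟩ := h (δ / 2) (by positivity)
    have hL : (0 : ℝ) < Nat.card (Fin m → Option α) := by exact_mod_cast Nat.card_pos
    obtain ⟨N, hN⟩ := ih (δ / 2 / Nat.card (Fin m → Option α)) (by positivity)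
    refine ⟨m + N, fun ι _ hc A hA => ?_⟩
    obtain ⟨e⟩ := exists_split (show m ≤ Nat.card ι by omega)
    rw [dens_join e] at hA
    have h1 := av_markov (a := δ / 2) (fun y : Fin (Nat.card ι - m) → α =>
      dens_le_one {x | join e x y ∈ A}) (by positivity)
    have h2 : δ / 2 ≤ av (fun y : Fin (Nat.card ι - m) → α => ind (∃ w : Fin m → Option α,
        (∃ p, w p = none) ∧ ∀ a, sub w a ∈ {x | join e x y ∈ A})) := by
      refine le_trans (by linarith) (h1.trans (av_mono fun y => ind_mono fun hy => ?_))
      exact hm _ hy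
    obtain ⟨w, hw⟩ := av_pigeon h2
    obtain ⟨g, hg, hgA⟩ := hN (Fin (Nat.card ι - m)) (by simp; omega)
      {y | (∃ p, w p = none) ∧ ∀ a, sub w a ∈ {x | join e x y ∈ A}} hw
    obtain ⟨⟨p, hp⟩, -⟩ := hgA (fun _ => Classical.arbitrary α)
    refine ⟨fun i => Sum.elim (fun c => (w c).elim (Sum.inr 0) Sum.inl)
      (fun c => Sum.map id Fin.succ (g c)) (e i), fun k => ?_, fun x => ?_⟩
    · refine Fin.cases ?_ (fun k => ?_) k
      · exact ⟨e.symm (Sum.inl p), by simp [hp]⟩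
      · obtain ⟨i, hi⟩ := hg k
        exact ⟨e.symm (Sum.inr i), by simp [hi]⟩
    · have := (hgA (fun k => x k.succ)).2 (x 0)
      simp only [Set.mem_ofPred_eq] at this
      convert this using 1
      funext i
      simp only [sp, join]
      rcases e i with c | c
      · rcases hwc : w c with _ | a <;> simp [sub, hwc]
      · rcases hgc : g c with _ | a <;> simp [sp, hgc]

end words
end DHJProof


namespace DHJProof
section words
variable {α ι κ τ η : Type}

/-- membership is unaffected by exchanging `none` and `some b` -/
def Insens (b : α) (D : Set (ι → Option α)) : Prop :=
  ∀ x x' : ι → Option α, sub x b = sub x' b → x ∈ D → x' ∈ D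

/-- rerandomise the non-`none` letters -/
def mix (x : ι → Option α) (v : ι → α) : ι → Option α := fun c => (x c).map fun _ => v c

/-- the mixing involution -/
def mixEquiv : ((ι → Option α) × (ι → α)) ≃ ((ι → Option α) × (ι → α)) where
  toFun p := (mix p.1 p.2, fun c => (p.1 c).getD (p.2 c))
  invFun p := (mix p.1 p.2, fun c => (p.1 c).getD (p.2 c))
  left_inv p := by
    obtain ⟨x, v⟩ := p
    simp only [Prod.mk.injEq]
    constructor <;> funext c <;> rcases h : x c with _ | a <;> simp [mix, h]
  right_inv p := by
    obtain ⟨x, v⟩ := p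
    simp only [Prod.mk.injEq]
    constructor <;> funext c <;> rcases h : x c with _ | a <;> simp [mix, h]

lemma av_mix [Finite ι] [Finite α] [Nonempty α] (f : (ι → Option α) → ℝ) :
    av (fun x => av (fun v => f (mix x v))) = av f := by
  have h := av_equiv (mixEquiv (ι := ι) (α := α)) (fun p => f p.1)
  rw [av_prod, av_prod] at h
  simp only [mixEquiv, Equiv.coe_fn_mk, av_const] at h
  exact h

lemma small_support [Finite ι] [Finite α] [Nonempty α] (N : ℕ) :
    av (fun x : ι → Option α => ind (Nat.card {c // x c ≠ none} < N)) ≤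
      2 ^ N * (3 / 4 : ℝ) ^ Nat.card ι := by
  classical
  have := Fintype.ofFinite ι
  have := Fintype.ofFinite α
  let φ : Option α → ℝ := fun o => if o = none then 1 else 1 / 2
  have h1 : ∀ x : ι → Option α, ind (Nat.card {c // x c ≠ none} < N) ≤ 2 ^ N * ∏ c, φ (x c) := by
    intro x
    have h2 : ∏ c, φ (x c) = (1 / 2 : ℝ) ^ Nat.card {c // x c ≠ none} := by
      rw [Finset.prod_ite]
      simp [Nat.card_eq_fintype_card, Fintype.card_subtype]
    rw [h2]
    by_cases h : Nat.card {c // x c ≠ none} < N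
    · rw [ind_true h]
      calc (1 : ℝ) = 2 ^ N * (1 / 2) ^ N := by rw [← mul_pow]; norm_num
        _ ≤ _ := by
          gcongr ?_ * ?_
          exact pow_le_pow_of_le_one (by norm_num) (by norm_num) h.le
    · rw [ind_false h]; positivity
  refine (av_mono h1).trans ?_
  rw [av_mul]
  gcongr
  have h3 : ∑ x : ι → Option α, ∏ c, φ (x c) = (∑ o, φ o) ^ Nat.card ι := by
    have := Finset.prod_univ_sum (fun _ : ι => (Finset.univ : Finset (Option α))) (fun _ o => φ o)
    rw [Fintype.piFinset_univ] at this
    rw [← this]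
    simp
  have ha : (1 : ℝ) ≤ Fintype.card α := by exact_mod_cast Fintype.card_pos
  rw [av_eq, h3, Nat.card_fun, Nat.cast_pow, ← div_pow]
  apply pow_le_pow_left₀
  · exact div_nonneg (Finset.sum_nonneg fun o _ => by simp only [φ]; split_ifs <;> norm_num)
      (by positivity)
  · rw [Fintype.sum_option]
    simp [φ]
    rw [div_le_iff₀ (by positivity)]
    linarith

theorem insens_hasSub [Finite α] [Nonempty α] (h : DHJ α) (b : α) (r : ℕ) (β : ℝ) (hβ : 0 < β) :
    ∃ m : ℕ, ∀ D : Set (Fin m → Option α), Insens b D → β ≤ dens D → HasSub r D := by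
  obtain ⟨N, hN⟩ := mdhj h r (β / 2) (by positivity)
  obtain ⟨m, hm⟩ : ∃ m : ℕ, 2 ^ N * (3 / 4 : ℝ) ^ m < β / 2 := by
    obtain ⟨m, hm⟩ := exists_pow_lt_of_lt_one (show (0 : ℝ) < β / 2 / 2 ^ N by positivity)
      (show (3 / 4 : ℝ) < 1 by norm_num)
    refine ⟨m, ?_⟩
    rw [lt_div_iff₀ (by positivity)] at hm
    linarith
  refine ⟨m, fun D hD hd => ?_⟩
  have hs := small_support (ι := Fin m) (α := α) N
  rw [Nat.card_fin] at hs
  unfold dens at hd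
  rw [← av_mix] at hd
  have h1 : β / 2 ≤ av (fun x : Fin m → Option α => av (fun v => ind (mix x v ∈ D)) -
      ind (Nat.card {c // x c ≠ none} < N)) := by
    rw [av_sub]; linarith
  obtain ⟨x, hx⟩ := exists_le_of_av h1
  have hle : av (fun v => ind (mix x v ∈ D)) ≤ 1 := dens_le_one {v | mix x v ∈ D}
  have hc : N ≤ Nat.card {c // x c ≠ none} := by
    by_contra hc
    rw [ind_true (not_le.mp hc)] at hx
    linarith
  rw [ind_false (not_lt.mpr hc), sub_zero] at hx
  classical
  let e : Fin m ≃ {c // x c ≠ none} ⊕ {c // ¬ x c ≠ none} := (Equiv.sumCompl _).symm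
  rw [av_join e] at hx
  obtain ⟨y, hy⟩ := exists_le_of_av hx
  obtain ⟨g, hg, hgD⟩ := hN _ hc {v | mix x (join e v y) ∈ D} hy
  refine ⟨fun i => Sum.elim (fun c => Sum.map some id (g c)) (fun _ => Sum.inl none) (e i), ?_, ?_⟩
  · intro k
    obtain ⟨i, hi⟩ := hg k
    exact ⟨e.symm (Sum.inl i), by simp [hi]⟩
  · intro z
    refine hD _ _ ?_ (hgD (sub z b))
    funext i
    simp only [sub, mix, join, sp]
    rcases hei : e i with c | c
    · have hi : i = c.1 := by
        have : i = e.symm (Sum.inl c) := by rw [← hei, e.symm_apply_apply]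
        rw [this]; simp [e]
      have hxi := c.2
      rw [← hi] at hxi
      obtain ⟨a, ha⟩ := Option.ne_none_iff_exists'.mp hxi
      rcases hgc : g c with a' | k <;> simp [ha, hgc, sp, sub]
    · have hi : i = c.1 := by
        have : i = e.symm (Sum.inr c) := by rw [← hei, e.symm_apply_apply]
        rw [this]; simp [e]
      have hxi := c.2
      rw [← hi] at hxi
      simp at hxi
      simp [hxi]

open Classical in
/-- chosen removed subspace -/
noncomputable def rem (r : ℕ) (E : Set (ι → α)) : Set (ι → α) :=
  if h : HasSub r E then Set.range (sp h.choose) else ∅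

lemma rem_subset (r : ℕ) (E : Set (ι → α)) : rem r E ⊆ E := by
  unfold rem
  split_ifs with h
  · rintro _ ⟨x, rfl⟩
    exact h.choose_spec.2 x
  · simp

lemma dens_rem [Finite ι] [Finite α] [Nonempty α] {r : ℕ} {E : Set (ι → α)} (h : HasSub r E) :
    1 / (Nat.card (ι → α) : ℝ) ≤ dens (rem r E) := by
  have hx : sp h.choose (fun _ => Classical.arbitrary α) ∈ rem r E := by
    unfold rem; rw [dif_pos h]; exact ⟨_, rfl⟩
  have := av_single (f := fun x => ind (x ∈ rem r E)) (fun x => ind_nonneg _) _ |>.trans_eq' 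
    (congrArg (fun t => t / (Nat.card (ι → α) : ℝ)) (ind_true hx))
  exact this

lemma av_rem [Finite ι] [Finite α] {r : ℕ} {E : Set (ι → α)} (h : (ι → α) → ℝ)
    (hh : ∀ g : ι → α ⊕ Fin r, Proper g → (∀ x, sp g x ∈ E) → av (fun x => h (sp g x)) ≤ 0) :
    av (fun x => h x * ind (x ∈ rem r E)) ≤ 0 := by
  classical
  have := Fintype.ofFinite (ι → α)
  have := Fintype.ofFinite (Fin r → α)
  by_cases hE : HasSub r E
  · have h0 := hh _ hE.choose_spec.1 hE.choose_spec.2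
    have hrem : rem r E = Set.range (sp hE.choose) := by unfold rem; rw [dif_pos hE]
    set g := hE.choose
    have hinj := sp_injective hE.choose_spec.1
    rcases isEmpty_or_nonempty (Fin r → α) with he | he
    · apply av_nonpos
      intro x
      rw [hrem, ind_false, mul_zero]
      rintro ⟨y, -⟩
      exact he.false y
    have hpos : (0 : ℝ) < Nat.card (Fin r → α) := by exact_mod_cast Nat.card_pos
    rw [av_eq] at h0 ⊢
    have h1 : ∑ x, h (sp g x) ≤ 0 := by
      by_contra hc
      exact absurd h0 (not_le.mpr (div_pos (not_le.mp hc) hpos))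
    apply div_nonpos_of_nonpos_of_nonneg _ (by positivity)
    refine le_of_eq_of_le ?_ h1
    rw [hrem]
    have h2 : ∑ x, h (sp g x) = ∑ x ∈ Finset.univ.image (sp g), h x :=
      (Finset.sum_image (fun a _ b _ hab => hinj hab)).symm
    rw [h2, ← Finset.sum_subset (Finset.subset_univ (Finset.univ.image (sp g)))]
    · apply Finset.sum_congr rfl
      intro x hx
      rw [ind_true (by simpa using hx), mul_one]
    · intro x _ hx
      rw [ind_false (by simpa using hx), mul_zero]
  · apply av_nonpos
    intro x
    have : rem r E = ∅ := by unfold rem; rw [dif_neg hE]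
    rw [this, ind_false (by simp), mul_zero]

lemma sub_join (e : ι ≃ κ ⊕ τ) (x : κ → Option α) (y : τ → Option α) (b : α) :
    sub (join e x y) b = join e (sub x b) (sub y b) := by
  funext i
  simp only [sub, join]
  rcases e i with c | c <;> simp [sub]

theorem insens_av [Finite α] [Nonempty α] (h : DHJ α) (b : α) (r : ℕ) (ε : ℝ) (hε : 0 < ε) :
    ∃ N : ℕ, ∀ (ι : Type) [Finite ι], N ≤ Nat.card ι → ∀ D : Set (ι → Option α), Insens b D →
      ∀ f : (ι → Option α) → ℝ, (∀ x, f x ≤ 1) →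
      (∀ g : ι → Option α ⊕ Fin r, Proper g → (∀ x, sp g x ∈ D) → av (fun x => f (sp g x)) ≤ 0) →
      av (fun x => f x * ind (x ∈ D)) ≤ ε := by
  obtain ⟨m, hm⟩ := insens_hasSub h b r (ε / 2) (by positivity)
  set κ : ℝ := 1 / (Nat.card (Fin m → Option α) : ℝ) with hκ
  have hC : (1 : ℝ) ≤ Nat.card (Fin m → Option α) := by exact_mod_cast Nat.card_pos
  have hκ0 : 0 < κ := by positivity
  have hκ1 : κ ≤ 1 := by rw [hκ, div_le_one (by positivity)]; exact hC
  have key : ∀ t : ℕ, ∀ (ι : Type) [Finite ι], t * m ≤ Nat.card ι →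
      ∀ D : Set (ι → Option α), Insens b D →
      ∀ f : (ι → Option α) → ℝ, (∀ x, f x ≤ 1) →
      (∀ g : ι → Option α ⊕ Fin r, Proper g → (∀ x, sp g x ∈ D) → av (fun x => f (sp g x)) ≤ 0) →
      av (fun x => f x * ind (x ∈ D)) ≤ ε / 2 + (1 - κ) ^ t * (dens D - ε / 2) := by
    intro t
    induction t with
    | zero =>
      intro ι _ _ D _ f hf _
      have : av (fun x => f x * ind (x ∈ D)) ≤ dens D :=
        av_mono fun x => mul_le_of_le_one_left (ind_nonneg _) (hf x)
      simp only [pow_zero]; linarith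
    | succ t ih =>
      intro ι _ hc D hD f hf hfD
      rw [add_mul, one_mul] at hc
      obtain ⟨e⟩ := exists_split (show m ≤ Nat.card ι by omega)
      set p := Nat.card ι - m with hp
      let Dz : (Fin p → Option α) → Set (Fin m → Option α) := fun z => {x | join e x z ∈ D}
      have hDz : ∀ z z', sub z b = sub z' b → Dz z = Dz z' := by
        intro z z' hzz
        ext x
        constructor
        · intro hx; exact hD _ _ (by rw [sub_join, sub_join, hzz]) hx
        · intro hx; exact hD _ _ (by rw [sub_join, sub_join, hzz]) hx
      have hDzI : ∀ z, Insens b (Dz z) := by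
        intro z x x' hxx hx
        exact hD _ _ (by rw [sub_join, sub_join, hxx]) hx
      let D' : (Fin m → Option α) → Set (Fin p → Option α) :=
        fun x => {z | x ∈ Dz z ∧ x ∉ rem r (Dz z)}
      have hD'I : ∀ x, Insens b (D' x) := by
        intro x z z' hzz hz
        simp only [D', Set.mem_ofPred_eq] at hz ⊢
        rw [← hDz z z' hzz]; exact hz
      have hind : ∀ x z, ind (join e x z ∈ D) = ind (x ∈ rem r (Dz z)) + ind (z ∈ D' x) := by
        intro x z
        have h1 : (join e x z ∈ D) = (x ∈ Dz z) := rfl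
        have h2 : (z ∈ D' x) = (x ∈ Dz z ∧ x ∉ rem r (Dz z)) := rfl
        rw [h1, h2]
        by_cases hx : x ∈ rem r (Dz z)
        · rw [ind_true (rem_subset _ _ hx), ind_true hx, ind_false (fun h => h.2 hx), add_zero]
        · rw [ind_and, ind_true (p := ¬ _) hx, ind_false hx, mul_one, zero_add]
      -- first part
      have hA : ∀ z, av (fun x => f (join e x z) * ind (x ∈ rem r (Dz z))) ≤ 0 := by
        intro z
        apply av_rem (fun x => f (join e x z))
        intro g hg hgD
        have := hfD (fun i => Sum.elim g (fun c => Sum.inl (z c)) (e i)) ?_ ?_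
        · convert this using 4 with x
          funext i
          simp only [join, sp]
          rcases e i with c | c <;> simp [sp]
        · intro k
          obtain ⟨i, hi⟩ := hg k
          exact ⟨e.symm (Sum.inl i), by simp [hi]⟩
        · intro x
          have := hgD x
          simp only [Dz, Set.mem_ofPred_eq] at this
          convert this using 1
          funext i
          simp only [join, sp]
          rcases e i with c | c <;> simp [sp]
      have hB : ∀ x, av (fun z => f (join e x z) * ind (z ∈ D' x)) ≤
          ε / 2 + (1 - κ) ^ t * (dens (D' x) - ε / 2) := by
        intro x
        apply ih (Fin p) (by simp; omega) (D' x) (hD'I x) (fun z => f (join e x z)) (fun z => hf _)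
        intro g hg hgD
        have := hfD (fun i => Sum.elim (fun c => Sum.inl (x c)) g (e i)) ?_ ?_
        · convert this using 4 with x
          funext i
          simp only [join, sp]
          rcases e i with c | c <;> simp [sp]
        · intro k
          obtain ⟨i, hi⟩ := hg k
          exact ⟨e.symm (Sum.inr i), by simp [hi]⟩
        · intro z
          have := (hgD z).1
          simp only [Dz, Set.mem_ofPred_eq] at this
          convert this using 1
          funext i
          simp only [join, sp]
          rcases e i with c | c <;> simp [sp]
      have hdens : dens D = av (fun z => dens (rem r (Dz z))) + av (fun x => dens (D' x)) := by
        rw [dens_join e]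
        unfold dens
        rw [av_comm (fun x z => ind (z ∈ D' x)), ← av_add]
        congr 1
        funext z
        rw [← av_add]
        congr 1
        funext x
        exact hind x z
      have hrem : κ * (dens D - ε / 2) ≤ av (fun z => dens (rem r (Dz z))) := by
        have h1 := av_markov (a := ε / 2) (fun z => dens_le_one (Dz z)) (by positivity)
        have h2 : av (fun z => dens (Dz z)) = dens D := (dens_join e D).symm
        rw [h2] at h1
        calc κ * (dens D - ε / 2) ≤ κ * av (fun z => ind (ε / 2 ≤ dens (Dz z))) := by gcongr
          _ = av (fun z => κ * ind (ε / 2 ≤ dens (Dz z))) := (av_mul _ _).symm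
          _ ≤ _ := by
            apply av_mono
            intro z
            by_cases hz : ε / 2 ≤ dens (Dz z)
            · rw [ind_true hz, mul_one]
              exact dens_rem (hm _ (hDzI z) hz)
            · rw [ind_false hz, mul_zero]; exact dens_nonneg _
      have hsplit : av (fun x => f x * ind (x ∈ D)) =
          av (fun z => av (fun x => f (join e x z) * ind (x ∈ rem r (Dz z)))) +
          av (fun x => av (fun z => f (join e x z) * ind (z ∈ D' x))) := by
        rw [av_join e, av_comm (fun x z => f (join e x z) * ind (z ∈ D' x)), ← av_add]
        congr 1
        funext z
        rw [← av_add]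
        congr 1
        funext x
        rw [hind, mul_add]
      have hB' := av_mono hB
      rw [av_add, av_mul, av_sub, av_const] at hB'
      have hA' := av_nonpos hA
      have hpow : 0 ≤ (1 - κ) ^ t := pow_nonneg (by linarith) _
      rw [hsplit, pow_succ]
      have : (1 - κ) ^ t * (av (fun x => dens (D' x)) - ε / 2) ≤
          (1 - κ) ^ t * ((1 - κ) * (dens D - ε / 2)) := by
        gcongr
        linarith
      linarith
  obtain ⟨t, ht⟩ := exists_pow_lt_of_lt_one (show (0 : ℝ) < ε / 2 by positivity)
    (show 1 - κ < 1 by linarith)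
  refine ⟨t * m, fun ι _ hc D hD f hf hfD => ?_⟩
  have h1 := key t ι hc D hD f hf hfD
  have hpow : 0 ≤ (1 - κ) ^ t := pow_nonneg (by linarith) _
  have : (1 - κ) ^ t * (dens D - ε / 2) ≤ (1 - κ) ^ t * 1 := by
    gcongr
    linarith [dens_le_one D]
  linarith

end words
end DHJProof


namespace DHJProof
section words
variable {α ι κ τ η : Type}

lemma hasLine_of_slice' (e : ι ≃ κ ⊕ τ) (x : κ → α) {A : Set (ι → α)}
    (h : HasLine {y | join e x y ∈ A}) : HasLine A := by
  obtain ⟨w, ⟨p, hp⟩, hw⟩ := h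
  refine ⟨fun i => Sum.elim (fun c => some (x c)) w (e i), ⟨e.symm (Sum.inr p), by simp [hp]⟩,
    fun a => ?_⟩
  have := hw a
  simp only [Set.mem_ofPred_eq] at this
  convert this using 1
  funext i
  simp only [sub, join]
  rcases e i with c | c <;> simp [sub]

lemma insens_sp {b : α} {D : Set (ι → Option α)} (hD : Insens b D) (g : ι → Option α ⊕ η) :
    Insens b {x | sp g x ∈ D} := by
  intro x x' hxx hx
  refine hD _ _ ?_ hx
  funext i
  simp only [sub, sp]
  rcases g i with c | c
  · simp
  · exact congrFun hxx c

lemma insens_compl {b : α} {D : Set (ι → Option α)} (hD : Insens b D) : Insens b Dᶜ := by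
  intro x x' hxx hx hx'
  exact hx (hD _ _ hxx.symm hx')

lemma prod_ind_nonneg (s : Finset κ) (P : κ → Prop) : 0 ≤ ∏ a ∈ s, ind (P a) :=
  Finset.prod_nonneg fun _ _ => ind_nonneg _

lemma prod_ind_le_one (s : Finset κ) (P : κ → Prop) : ∏ a ∈ s, ind (P a) ≤ 1 :=
  Finset.prod_le_one (fun _ _ => ind_nonneg _) fun _ _ => ind_le_one _

lemma prod_ind_univ [Fintype κ] (P : κ → Prop) : ∏ a, ind (P a) = ind (∀ a, P a) := by
  by_cases h : ∀ a, P a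
  · rw [ind_true h]; exact Finset.prod_eq_one fun a _ => ind_true (h a)
  · rw [ind_false h]
    push Not at h
    obtain ⟨a, ha⟩ := h
    exact Finset.prod_eq_zero (Finset.mem_univ a) (ind_false ha)

theorem inter_bound [Finite α] [Nonempty α] (h : DHJ α) (l : ℝ) (hl : 0 ≤ l) (N₀ : ℕ)
    (hN₀ : Good (Option α) (Fin N₀) l) (s : Finset α) : ∀ ε : ℝ, 0 < ε → ∃ N : ℕ,
    ∀ (ι : Type) [Finite ι], N ≤ Nat.card ι → ∀ A : Set (ι → Option α), ¬ HasLine A →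
    ∀ D : α → Set (ι → Option α), (∀ a, Insens a (D a)) →
    av (fun x => (ind (x ∈ A) - l) * ∏ a ∈ s, ind (x ∈ D a)) ≤ ε := by
  classical
  induction s using Finset.induction_on with
  | empty =>
    intro ε hε
    refine ⟨N₀, fun ι _ hc A hA D hD => ?_⟩
    simp only [Finset.prod_empty, mul_one]
    rw [av_sub, av_const]
    have : dens A < l := by
      by_contra hcon
      exact hA (good_mono hN₀ hc A (not_lt.mp hcon))
    unfold dens at this
    linarith
  | insert b s hb ih =>
    intro ε hε
    obtain ⟨r, hr⟩ := ih (ε / 2) (by positivity)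
    obtain ⟨N, hN⟩ := insens_av h b r (ε / 2) (by positivity)
    refine ⟨N, fun ι _ hc A hA D hD => ?_⟩
    have h1 := hN ι hc (D b) (hD b)
      (fun x => (ind (x ∈ A) - l) * ∏ a ∈ s, ind (x ∈ D a) - ε / 2) ?_ ?_
    · have h2 : av (fun x => (ind (x ∈ A) - l) * ∏ a ∈ insert b s, ind (x ∈ D a)) ≤
          av (fun x => ((ind (x ∈ A) - l) * ∏ a ∈ s, ind (x ∈ D a) - ε / 2) * ind (x ∈ D b)
            + ε / 2) := by
        apply av_mono
        intro x
        rw [Finset.prod_insert hb]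
        nlinarith [ind_le_one (x ∈ D b)]
      rw [av_add, av_const] at h2
      linarith
    · intro x
      have h3 := prod_ind_nonneg s (fun a => x ∈ D a)
      have h4 := prod_ind_le_one s (fun a => x ∈ D a)
      have h5 := ind_le_one (x ∈ A)
      nlinarith
    · intro g hg _
      have h3 := hr (Fin r) (by simp) {x | sp g x ∈ A} (fun hL => hA (hasLine_of_sp hg hL))
        (fun a => {x | sp g x ∈ D a}) (fun a => insens_sp (hD a) g)
      rw [av_sub, av_const]
      simp only [Set.mem_ofPred_eq] at h3
      linarith

theorem compl_bound [Finite α] [Nonempty α] (h : DHJ α) (l : ℝ) (hl : 0 ≤ l) (N₀ : ℕ)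
    (hN₀ : Good (Option α) (Fin N₀) l) (s : Finset α) : ∀ ε : ℝ, 0 < ε → ∃ N : ℕ,
    ∀ (ι : Type) [Finite ι], N ≤ Nat.card ι → ∀ A : Set (ι → Option α), ¬ HasLine A →
    ∀ D : α → Set (ι → Option α), (∀ a, Insens a (D a)) →
    av (fun x => (ind (x ∈ A) - l) * (1 - ∏ a ∈ s, ind (x ∈ D a))) ≤ ε := by
  classical
  induction s using Finset.induction_on with
  | empty =>
    intro ε hε
    refine ⟨0, fun ι _ hc A hA D hD => ?_⟩
    simp only [Finset.prod_empty, sub_self, mul_zero]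
    rw [av_const]; exact hε.le
  | insert b s hb ih =>
    intro ε hε
    obtain ⟨N1, h1⟩ := ih (ε / 2) (by positivity)
    obtain ⟨N2, h2⟩ := inter_bound h l hl N₀ hN₀ (insert b s) (ε / 2) (by positivity)
    refine ⟨max N1 N2, fun ι _ hc A hA D hD => ?_⟩
    have h3 := h1 ι ((le_max_left _ _).trans hc) A hA D hD
    have h4 := h2 ι ((le_max_right _ _).trans hc) A hA (Function.update D b (D b)ᶜ) ?_
    · have h5 : av (fun x => (ind (x ∈ A) - l) * (1 - ∏ a ∈ insert b s, ind (x ∈ D a))) =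
          av (fun x => (ind (x ∈ A) - l) * (1 - ∏ a ∈ s, ind (x ∈ D a))) +
          av (fun x => (ind (x ∈ A) - l) *
            ∏ a ∈ insert b s, ind (x ∈ Function.update D b (D b)ᶜ a)) := by
        rw [← av_add]
        congr 1
        funext x
        rw [Finset.prod_insert hb, Finset.prod_insert hb]
        have h6 : ∏ a ∈ s, ind (x ∈ Function.update D b (D b)ᶜ a) = ∏ a ∈ s, ind (x ∈ D a) := by
          apply Finset.prod_congr rfl
          intro a ha
          rw [Function.update_of_ne (by rintro rfl; exact hb ha)]
        have h7 : ind (x ∈ Function.update D b (D b)ᶜ b) = 1 - ind (x ∈ D b) := by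
          rw [Function.update_self, ← ind_not]; rfl
        rw [h6, h7]
        ring
      rw [h5]; linarith
    · intro a
      by_cases hab : a = b
      · subst hab
        rw [Function.update_self]; exact insens_compl (hD a)
      · rw [Function.update_of_ne hab]; exact hD a

lemma av_update [Finite ι] [DecidableEq ι] [Finite κ] [Nonempty κ] (p : ι) (F : (ι → κ) → ℝ) :
    av F = av (fun b => av (fun x => F (Function.update b p x))) := by
  let e : ((ι → κ) × κ) ≃ ((ι → κ) × κ) :=
    { toFun := fun q => (Function.update q.1 p q.2, q.1 p)
      invFun := fun q => (Function.update q.1 p q.2, q.1 p)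
      left_inv := fun q => by simp
      right_inv := fun q => by simp }
  have h := av_equiv e (fun q => F q.1)
  rw [av_prod, av_prod] at h
  simp only [e, Equiv.coe_fn_mk, av_const] at h
  exact h.symm

/-- the block template of a line -/
def wl {m M : ℕ} (b : Fin m → Fin M → Option α) (w : Fin m → Option α) :
    Fin m × Option (Fin M) → Option (Option α) := fun q =>
  q.2.elim ((w q.1).map some) (fun c => (b q.1 c).elim ((w q.1).map some) (fun a => some (some a)))

/-- block word -/
def st {m M : ℕ} (b : Fin m → Fin M → Option α) (v : Fin m → α) :
    Fin m × Option (Fin M) → Option α := fun q =>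
  q.2.elim (some (v q.1)) (fun c => some ((b q.1 c).getD (v q.1)))

lemma sub_wl_some {m M : ℕ} (b : Fin m → Fin M → Option α) (w : Fin m → Option α) (a : α) :
    sub (wl b w) (some a) = st b (sub w a) := by
  funext ⟨p, o⟩
  rcases o with _ | c
  · rcases h : w p with _ | a' <;> simp [sub, wl, st, h]
  · rcases h : w p with _ | a' <;> rcases h' : b p c with _ | a'' <;> simp [sub, wl, st, h, h']

theorem dhj_step [Finite α] [Nonempty α] (h : DHJ α) : DHJ (Option α) := by
  classical
  have := Fintype.ofFinite α
  by_contra hcon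
  unfold DHJ at hcon
  push Not at hcon
  obtain ⟨δ, hδ, hbad⟩ := hcon
  let G : Set ℝ := {d | ∃ n, Good (Option α) (Fin n) d}
  have hGne : G.Nonempty := ⟨2, 0, fun A hA => by linarith [dens_le_one A]⟩
  have hGlb : ∀ d ∈ G, δ ≤ d := by
    rintro d ⟨n, hn⟩
    by_contra hd
    exact hbad n fun A hA => hn A (by linarith)
  have hGbdd : BddBelow G := ⟨δ, hGlb⟩
  obtain ⟨c, hc⟩ : ∃ c, c = sInf G := ⟨_, rfl⟩
  have hc0 : 0 < c := by rw [hc]; exact hδ.trans_le (le_csInf hGne hGlb)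
  have F1 : ∀ γ : ℝ, 0 < γ → ∃ n, Good (Option α) (Fin n) (c + γ) := by
    intro γ hγ
    obtain ⟨d, ⟨n, hn⟩, hd⟩ := exists_lt_of_csInf_lt hGne (show sInf G < c + γ by linarith)
    exact ⟨n, fun A hA => hn A (by linarith)⟩
  have F2 : ∀ γ : ℝ, 0 < γ → ∀ n, ∃ A : Set (Fin n → Option α), c - γ ≤ dens A ∧ ¬ HasLine A := by
    intro γ hγ n
    by_contra! hA
    have := csInf_le hGbdd (show c - γ ∈ G from ⟨n, hA⟩)
    linarith
  obtain ⟨m, hm⟩ := h (c / 4) (by positivity)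
  have hL : (1 : ℝ) ≤ Nat.card (Fin m → Option α) := by exact_mod_cast Nat.card_pos
  obtain ⟨θ, hθ⟩ : ∃ θ : ℝ, θ = c / 4 / Nat.card (Fin m → Option α) := ⟨_, rfl⟩
  have hθ0 : 0 < θ := by rw [hθ]; positivity
  have hc2 : c ≤ 1 := by
    obtain ⟨A, hA, -⟩ := F2 (c / 2) (by positivity) 0
    by_contra hc1
    obtain ⟨A, hA, -⟩ := F2 (c - 1) (by linarith) 0
    by_contra
    obtain ⟨A, hA, -⟩ := F2 ((c - 1) / 2) (by linarith) 0
    linarith [dens_le_one A]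
  have hθ1 : θ ≤ 1 / 4 := by
    rw [hθ, div_le_iff₀ (by positivity)]
    nlinarith
  have hcθ : 0 < c * θ := by positivity
  obtain ⟨N₀, hN₀⟩ := F1 (c * θ / 4) (by positivity)
  obtain ⟨M, hM⟩ := compl_bound h (c + c * θ / 4) (by positivity) N₀ hN₀ Finset.univ
    (c * θ / 4) (by positivity)
  have hC : (1 : ℝ) ≤ Nat.card (Fin m × Option (Fin M) → Option α) := by exact_mod_cast Nat.card_pos
  obtain ⟨C, hCdef⟩ : ∃ C : ℝ, C = Nat.card (Fin m × Option (Fin M) → Option α) := ⟨_, rfl⟩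
  rw [← hCdef] at hC
  obtain ⟨η, hη⟩ : ∃ η : ℝ, η = c * θ / (8 * C) := ⟨_, rfl⟩
  have hη0 : 0 < η := by rw [hη]; positivity
  have hCη : 2 * η * C = c * θ / 4 := by rw [hη]; field_simp; norm_num
  obtain ⟨p, hp⟩ := F1 η hη0
  obtain ⟨A, hAd, hA⟩ := F2 η hη0 (Nat.card ((Fin m × Option (Fin M)) ⊕ Fin p))
  let e : Fin (Nat.card ((Fin m × Option (Fin M)) ⊕ Fin p)) ≃ (Fin m × Option (Fin M)) ⊕ Fin p :=
    (Finite.equivFin _).symm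
  -- all slices are dense
  have hslice : ∀ y, c - c * θ / 4 ≤ av (fun z => ind (join e y z ∈ A)) := by
    have hub : ∀ y, 0 ≤ c + η - av (fun z => ind (join e y z ∈ A)) := by
      intro y
      by_contra hlt
      exact hA (hasLine_of_slice' e y (hp {z | join e y z ∈ A} (by unfold dens; simp only [Set.mem_ofPred_eq]; linarith)))
    intro y
    have h1 := av_single hub y
    rw [av_sub, av_const, ← hCdef, ← av_comm] at h1
    have h2 : dens A = av (fun z => av (fun y => ind (join e y z ∈ A))) := av_join e _
    rw [← h2, div_le_iff₀ (by positivity)] at h1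
    nlinarith
  have hbz : ∀ b : Fin m → Fin M → Option α, c / 4 ≤ av (fun z => ind (∃ w : Fin m → Option α,
      (∃ p, w p = none) ∧ ∀ a, join e (st b (sub w a)) z ∈ A)) := by
    intro b
    have h1 := av_markov (a := c / 4) (fun z => dens_le_one {v | join e (st b v) z ∈ A})
      (by positivity)
    have h2 : c - c * θ / 4 ≤ av (fun z => dens {v | join e (st b v) z ∈ A}) := by
      unfold dens
      simp only [Set.mem_ofPred_eq]
      rw [av_comm]
      have h3 := av_mono (fun v : Fin m → α => hslice (st b v))
      rw [av_const] at h3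
      exact h3
    have h4 : c / 4 ≤ av (fun z => ind (c / 4 ≤ dens {v | join e (st b v) z ∈ A})) := by
      nlinarith
    refine h4.trans (av_mono fun z => ind_mono fun hz => ?_)
    obtain ⟨w, hw1, hw2⟩ := hm _ hz
    exact ⟨w, hw1, hw2⟩
  have hbz' : c / 4 ≤ av (fun q : (Fin m → Fin M → Option α) × (Fin p → Option α) =>
      ind (∃ w : Fin m → Option α,
      (∃ p, w p = none) ∧ ∀ a, join e (st q.1 (sub w a)) q.2 ∈ A)) := by
    rw [av_prod]
    have := av_mono hbz
    rwa [av_const] at this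
  obtain ⟨w, hw⟩ := av_pigeon hbz'
  rw [← hθ, av_prod] at hw
  obtain ⟨p0, hp0⟩ : ∃ p, w p = none := by
    by_contra hno
    have : av (fun b : Fin m → Fin M → Option α => av (fun z : Fin p → Option α =>
        ind ((∃ p, w p = none) ∧ ∀ a, join e (st b (sub w a)) z ∈ A))) ≤ 0 :=
      av_nonpos fun b => av_nonpos fun z => by rw [ind_false (fun hh => hno hh.1)]
    linarith
  let Fa : (Fin m → Fin M → Option α) → (Fin p → Option α) → ℝ :=
    fun b z => ind (join e (sub (wl b w) none) z ∈ A)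
  let Fd : (Fin m → Fin M → Option α) → (Fin p → Option α) → ℝ :=
    fun b z => ind (∀ a, join e (st b (sub w a)) z ∈ A)
  have hFd : θ ≤ av (fun b => av (fun z => Fd b z)) :=
    hw.trans (av_mono fun b => av_mono fun z => ind_mono fun hh => hh.2)
  have hFa : c - c * θ / 4 ≤ av (fun b => av (fun z => Fa b z)) := by
    have := av_mono (fun b : Fin m → Fin M → Option α => hslice (sub (wl b w) none))
    rw [av_const] at this
    exact this
  have hdisj : ∀ b z, Fa b z * Fd b z = 0 := by
    intro b z
    by_contra hne
    have h1 : join e (sub (wl b w) none) z ∈ A := by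
      by_contra hh
      exact hne (by simp only [Fa]; rw [ind_false hh, zero_mul])
    have h2 : ∀ a, join e (st b (sub w a)) z ∈ A := by
      by_contra hh
      exact hne (by simp only [Fd]; rw [ind_false hh, mul_zero])
    apply hA
    have hjoin : ∀ k, sub (fun i => Sum.elim (wl b w) (fun c => some (z c)) (e i)) k =
        join e (sub (wl b w) k) z := by
      intro k
      funext i
      simp only [sub, join]
      rcases e i with c | c <;> simp [sub]
    refine ⟨fun i => Sum.elim (wl b w) (fun c => some (z c)) (e i),
      ⟨e.symm (Sum.inl (p0, none)), by simp [wl, hp0]⟩, fun k => ?_⟩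
    rw [hjoin]
    rcases k with _ | a
    · exact h1
    · rw [sub_wl_some]; exact h2 a
  have hmain : ∀ b z, av (fun x => Fa (Function.update b p0 x) z -
      (c + c * θ / 4) * (1 - Fd (Function.update b p0 x) z)) ≤ c * θ / 4 := by
    intro b z
    have h1 := hM (Fin M) (by simp)
      {x | join e (sub (wl (Function.update b p0 x) w) none) z ∈ A} ?_
      (fun a => {x | join e (st (Function.update b p0 x) (sub w a)) z ∈ A}) ?_
    · refine le_of_eq_of_le ?_ h1
      congr 1
      funext x
      rw [prod_ind_univ]
      have := hdisj (Function.update b p0 x) z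
      simp only [Fa, Fd, Set.mem_ofPred_eq] at this ⊢
      linear_combination this
    · intro hLn
      apply hA
      let g : Fin (Nat.card ((Fin m × Option (Fin M)) ⊕ Fin p)) → Option α ⊕ Fin M := fun i =>
        Sum.elim (fun q => q.2.elim (Sum.inl (w q.1)) (fun c => if q.1 = p0 then Sum.inr c else
          Sum.inl ((b q.1 c).elim (w q.1) some))) (fun c => Sum.inl (z c)) (e i)
      have hg : Proper g := fun k => ⟨e.symm (Sum.inl (p0, some k)), by simp [g]⟩
      apply hasLine_of_sp hg
      convert hLn using 3 with x
      refine iff_of_eq (congrArg (fun y => y ∈ A) ?_)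
      funext i
      simp only [sp, join, g]
      rcases e i with ⟨q, o⟩ | c
      · rcases o with _ | c
        · rcases hq : w q with _ | a <;> simp [sub, wl, hq]
        · by_cases hq : q = p0
          · subst hq
            rcases hx : x c with _ | a <;> simp [sub, wl, hp0, hx]
          · rcases hb : b q c with _ | a <;> rcases hq' : w q with _ | a' <;>
              simp [sub, wl, hq, hq', hb]
      · simp
    · intro a x x' hxx hx
      have : st (Function.update b p0 x) (sub w a) = st (Function.update b p0 x') (sub w a) := by
        funext ⟨q, o⟩
        rcases o with _ | c
        · rfl
        · by_cases hq : q = p0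
          · subst hq
            have := congrFun hxx c
            simp only [sub] at this
            simp [st, sub, hp0, this]
          · simp [st, hq]
      simp only [Set.mem_ofPred_eq] at hx ⊢
      rwa [← this]
  have hfin : av (fun z => av (fun b => av (fun x => Fa (Function.update b p0 x) z -
      (c + c * θ / 4) * (1 - Fd (Function.update b p0 x) z)))) ≤ c * θ / 4 := by
    have := av_mono (fun z => av_mono (fun b => hmain b z))
    rwa [av_const, av_const] at this
  have hfin2 : av (fun z => av (fun b => Fa b z - (c + c * θ / 4) * (1 - Fd b z))) ≤ c * θ / 4 := by
    refine le_of_eq_of_le ?_ hfin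
    congr 1
    funext z
    exact av_update p0 (fun b => Fa b z - (c + c * θ / 4) * (1 - Fd b z))
  simp only [av_sub, av_mul, av_const] at hfin2
  rw [av_comm (fun z b => Fa b z), av_comm (fun z b => Fd b z)] at hfin2
  nlinarith

lemma dhj_equiv {β : Type} [Finite α] [Finite β] (e : α ≃ β) (h : DHJ α) : DHJ β := by
  intro δ hδ
  obtain ⟨n, hn⟩ := h δ hδ
  refine ⟨n, fun A hA => ?_⟩
  obtain ⟨w, ⟨p, hp⟩, hw⟩ := hn {x | (fun i => e (x i)) ∈ A} (by
    refine hA.trans_eq ?_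
    exact (av_equiv (Equiv.arrowCongr (Equiv.refl (Fin n)) e) (fun x => ind (x ∈ A))).symm)
  refine ⟨fun i => (w i).map e, ⟨p, by simp [hp]⟩, fun b => ?_⟩
  have := hw (e.symm b)
  simp only [Set.mem_ofPred_eq] at this
  convert this using 1
  funext i
  rcases h : w i with _ | a <;> simp [sub, h]

theorem dhj_fin (k : ℕ) : DHJ (Option (Fin k)) := by
  induction k with
  | zero =>
    intro δ hδ
    refine ⟨1, fun A hA => ?_⟩
    obtain ⟨x, hx⟩ := nonempty_of_dens (hδ.trans_le hA)
    refine ⟨fun _ => none, ⟨0, rfl⟩, fun a => ?_⟩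
    convert hx using 1
    funext i
    exact Subsingleton.elim _ _
  | succ k ih =>
    exact dhj_equiv (Equiv.optionCongr (finSuccEquiv k).symm) (dhj_step ih)

end words
end DHJProof
namespace DHJProof

/-- composition of transformations along a list of letters -/
def fold {X K : Type*} (S : K → X → X) : List K → X → X
  | [] => id
  | a :: L => S a ∘ fold S L

lemma fold_mp {X K : Type*} [MeasurableSpace X] {μ : Measure X} {S : K → X → X}
    (hS : ∀ a, MeasurePreserving (S a) μ μ) (L : List K) : MeasurePreserving (fold S L) μ μ := by
  induction L with
  | nil => exact MeasurePreserving.id μ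
  | cons a L ih => exact (hS a).comp ih

lemma fold_template {X β : Type*} {S : Option β → X → X} (hnone : S none = id)
    (hcomm : ∀ a b, Function.Commute (S a) (S b)) (a : Option β) (L : List (Option (Option β))) :
    fold S (L.map fun o => o.getD a) =
      (S a)^[L.countP Option.isNone] ∘ fold S (L.map fun o => o.getD none) := by
  induction L with
  | nil => rfl
  | cons o L ih =>
    rcases o with _ | b
    · simp only [List.map_cons, Option.getD_none, fold, ih, hnone, Function.id_comp]
      rw [List.countP_cons_of_pos (by simp), Function.iterate_succ']
      rfl
    · simp only [List.map_cons, Option.getD_some, fold, ih]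
      rw [List.countP_cons_of_neg (by simp), ← Function.comp_assoc, ← Function.comp_assoc,
        ((hcomm b a).iterate_right _).comp_eq]

end DHJProof

open DHJProof in
theorem rational_multiple_recurrence_integer {X : Type*} [MeasurableSpace X] (μ : Measure X)
    [IsProbabilityMeasure μ] (k : ℕ) (T : Fin k → ℤ → X → X)
    (hmp : ∀ j, ∀ n ≠ 0, MeasurePreserving (T j n) μ μ)
    (hcomm : ∀ i j, ∀ m ≠ 0, ∀ n ≠ 0, T i m ∘ T j n = T j n ∘ T i m)
    (A : Set X) (hA : MeasurableSet A) (hA0 : 0 < μ A) :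
    ∃ F : Finset ℤ, F.Nonempty ∧ (∀ t ∈ F, 0 < t) ∧
      ∃ q : ℤ → ℕ, (∀ t ∈ F, 1 ≤ q t ∧ (q t : ℤ) ≤ t) ∧
        (∑ t ∈ F, (q t : ℤ) * (-1) ^ (t.toNat + 1) * (Nat.factorial t.toNat)) ≠ 0 ∧
        0 < μ (A ∩ ⋂ j : Fin k, ratTrans (T j) q F ⁻¹' A) := by
  have hδ : 0 < μ.real A := by
    rw [measureReal_def]; exact ENNReal.toReal_pos hA0.ne' (measure_ne_top μ A)
  obtain ⟨n, hn⟩ := dhj_fin k (μ.real A / 2) (by positivity)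
  obtain ⟨N, hN⟩ : ∃ N : ℕ, N = n + 1 := ⟨_, rfl⟩
  have hgood : Good (Option (Fin k)) (Fin N) (μ.real A / 2) := good_mono hn (by simp; omega)
  have ht0 : (N : ℤ) ≠ 0 := by omega
  let S : Option (Fin k) → X → X := fun o => o.elim id (fun j => T j N)
  have hSmp : ∀ a, MeasurePreserving (S a) μ μ := by
    intro a
    rcases a with _ | j
    · exact MeasurePreserving.id μ
    · exact hmp j N ht0
  have hScomm : ∀ a b, Function.Commute (S a) (S b) := by
    intro a b x
    rcases a with _ | i
    · rfl
    · rcases b with _ | j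
      · rfl
      · exact congrFun (hcomm i j N ht0 N ht0) x
  let W : (Fin N → Option (Fin k)) → X → X := fun w => fold S (List.ofFn w)
  have hW : ∀ w, MeasurePreserving (W w) μ μ := fun w => fold_mp hSmp _
  -- some template works on a set of positive measure
  have hex : ∃ w : Fin N → Option (Option (Fin k)), (∃ p, w p = none) ∧
      μ {x | ∀ a, W (sub w a) x ∈ A} ≠ 0 := by
    by_contra! hnull
    have hae : ∀ᵐ x ∂μ, ∀ w : Fin N → Option (Option (Fin k)), (∃ p, w p = none) →
        ¬ ∀ a, W (sub w a) x ∈ A := by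
      rw [ae_all_iff]
      intro w
      by_cases hp : ∃ p, w p = none
      · have := hnull w hp
        rw [measure_eq_zero_iff_ae_notMem] at this
        filter_upwards [this] with x hx _ h
        exact hx h
      · filter_upwards with x h
        exact absurd h hp
    have hint1 : ∀ w, Integrable (fun x => ind (W w x ∈ A)) μ := by
      intro w
      have : (fun x => ind (W w x ∈ A)) = (W w ⁻¹' A).indicator (fun _ => (1 : ℝ)) := by
        funext x
        by_cases hx : W w x ∈ A
        · rw [ind_true hx, Set.indicator_of_mem (by exact hx)]
        · rw [ind_false hx, Set.indicator_of_notMem (by exact hx)]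
      rw [this]
      exact (integrable_const 1).indicator ((hW w).measurable hA)
    have hint2 : ∀ w, ∫ x, ind (W w x ∈ A) ∂μ = μ.real A := by
      intro w
      have : (fun x => ind (W w x ∈ A)) = (W w ⁻¹' A).indicator (1 : X → ℝ) := by
        funext x
        by_cases hx : W w x ∈ A
        · rw [ind_true hx, Set.indicator_of_mem (by exact hx)]; rfl
        · rw [ind_false hx, Set.indicator_of_notMem (by exact hx)]
      rw [this, integral_indicator_one ((hW w).measurable hA), measureReal_def, measureReal_def,
        (hW w).measure_preimage hA.nullMeasurableSet]
    have hfi : Integrable (fun x => av (fun w => ind (W w x ∈ A))) μ := by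
      simp only [av_eq]
      exact (integrable_finsetSum _ fun w _ => hint1 w).div_const _
    have h1 : ∫ x, av (fun w => ind (W w x ∈ A)) ∂μ = μ.real A := by
      simp only [av_eq]
      rw [integral_div, integral_finsetSum _ fun w _ => hint1 w]
      simp only [hint2]
      rw [← av_eq (fun _ : Fin N → Option (Fin k) => μ.real A), av_const]
    have h2 : ∫ x, av (fun w => ind (W w x ∈ A)) ∂μ ≤ ∫ _x, μ.real A / 2 ∂μ := by
      apply integral_mono_ae hfi (integrable_const _)
      filter_upwards [hae] with x hx
      by_contra hlt
      obtain ⟨w, hw1, hw2⟩ := hgood {w | W w x ∈ A} (not_le.mp hlt).le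
      exact hx w hw1 hw2
    rw [h1] at h2
    simp at h2
    linarith
  obtain ⟨w, ⟨p, hp⟩, hw⟩ := hex
  obtain ⟨q, hq⟩ : ∃ q : ℕ, q = (List.ofFn w).countP Option.isNone := ⟨_, rfl⟩
  have hq1 : 1 ≤ q := by
    rw [hq, Nat.one_le_iff_ne_zero, ← Nat.pos_iff_ne_zero, List.countP_pos_iff]
    exact ⟨w p, by simp [List.mem_ofFn], by simp [hp]⟩
  have hqN : q ≤ N := by
    rw [hq]
    exact List.countP_le_length.trans (by simp)
  have hfac : ∀ a, W (sub w a) = (S a)^[q] ∘ W (sub w none) := by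
    intro a
    have hmap : ∀ a, List.ofFn (sub w a) = (List.ofFn w).map fun o => o.getD a := by
      intro a
      rw [List.map_ofFn]
      rfl
    simp only [W]
    rw [hmap, hmap, hq]
    exact fold_template rfl hScomm a _
  refine ⟨{(N : ℤ)}, Finset.singleton_nonempty _, ?_, fun _ => q, ?_, ?_, ?_⟩
  · simp; omega
  · simp; omega
  · simp [Nat.factorial_ne_zero]; omega
  · have hrat : ∀ j, ratTrans (T j) (fun _ => q) {(N : ℤ)} = (S (some j))^[q] := by
      intro j
      simp [ratTrans, S]
    simp only [hrat]
    have hset : {x | ∀ a, W (sub w a) x ∈ A} =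
        W (sub w none) ⁻¹' (A ∩ ⋂ j : Fin k, (S (some j))^[q] ⁻¹' A) := by
      ext x
      simp only [Set.mem_ofPred_eq, Set.mem_preimage, Set.mem_inter_iff, Set.mem_iInter]
      constructor
      · intro h
        refine ⟨h none, fun j => ?_⟩
        have := h (some j)
        rwa [hfac] at this
      · rintro ⟨h1, h2⟩ a
        rcases a with _ | j
        · exact h1
        · rw [hfac]; exact h2 j
    have hmeas : MeasurableSet (A ∩ ⋂ j : Fin k, (S (some j))^[q] ⁻¹' A) :=
      hA.inter (MeasurableSet.iInter fun j => ((hSmp (some j)).iterate q).measurable hA)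
    rw [hset, (hW _).measure_preimage hmeas.nullMeasurableSet] at hw
    exact pos_iff_ne_zero.mpr hw
end

section
/- Let (X, ℬ, μ) be a measure space with μ(X) = 1, let k ∈ ℕ, and for each 1 ≤ j ≤ k let (T_{n,j})_{n∈ℤ\{0}} be measure-preserving transformations of X such that the whole family {T_{n,j} : n ∈ ℤ\{0}, 1 ≤ j ≤ k} is commuting. Then for every A ∈ ℬ with μ(A) > 0 there exist a nonempty finite set F of NEGATIVE integers and natural numbers (q_t)_{t∈F} with 1 ≤ q_t ≤ -t for each t ∈ F, such that, writing F = {t_1 < … < t_l} and setting 𝒯_j = T_{t_1,j}^{q_{t_1}}∘…∘T_{t_l,j}^{q_{t_l}} for each j, one has μ(A ∩ 𝒯_1^{-1}(A) ∩ … ∩ 𝒯_k^{-1}(A)) > 0. In particular the recurrence is achieved at a nonzero rational q = Σ_{t∈F} q_t·(-1)^{-t}/((-t+1)!) lying in the open interval (e^{−1} − 1, e^{−1}). -/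
open MeasureTheory

/-- The coefficient `c_t` attached to a nonzero integer index `t`:
`c_t = (-1)^{-t}/((-t+1)!)` for `t < 0` and `c_t = (-1)^{t+1}·t!` for `t > 0`. -/
def ratCoeff (t : ℤ) : ℚ :=
  if t < 0 then (-1 : ℚ) ^ (-t).toNat / ((-t).toNat + 1).factorial
  else (-1 : ℚ) ^ (t.toNat + 1) * (t.toNat).factorial

set_option linter.style.haveILetI false

namespace RMR

open Combinatorics

noncomputable section

/-- Average of a real function over a finite type. -/
def avg {X : Type} [Finite X] (f : X → ℝ) : ℝ :=
  letI := Fintype.ofFinite X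
  (∑ x, f x) / (Fintype.card X : ℝ)

lemma avg_eq {X : Type} [Finite X] [Fintype X] (f : X → ℝ) :
    avg f = (∑ x, f x) / (Fintype.card X : ℝ) := by
  unfold avg
  have : Fintype.ofFinite X = (inferInstance : Fintype X) := Subsingleton.elim _ _
  rw [this]

section avgs
variable {X Y : Type} [Finite X] [Finite Y]

lemma avg_add (f g : X → ℝ) : avg (fun x => f x + g x) = avg f + avg g := by
  simp [avg, Finset.sum_add_distrib, add_div]

lemma avg_sub (f g : X → ℝ) : avg (fun x => f x - g x) = avg f - avg g := by
  simp [avg, Finset.sum_sub_distrib, sub_div]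

lemma avg_mul (c : ℝ) (f : X → ℝ) : avg (fun x => c * f x) = c * avg f := by
  simp [avg, ← Finset.mul_sum, mul_div_assoc]

lemma avg_const [Nonempty X] (c : ℝ) : avg (fun _ : X => c) = c := by
  letI := Fintype.ofFinite X
  rw [avg_eq]
  have : (Fintype.card X : ℝ) ≠ 0 := by
    exact_mod_cast Fintype.card_ne_zero
  simp

lemma avg_mono {f g : X → ℝ} (h : ∀ x, f x ≤ g x) : avg f ≤ avg g := by
  unfold avg
  exact div_le_div_of_nonneg_right (Finset.sum_le_sum fun x _ => h x) (by positivity)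

lemma avg_nonneg {f : X → ℝ} (h : ∀ x, 0 ≤ f x) : 0 ≤ avg f := by
  unfold avg
  exact div_nonneg (Finset.sum_nonneg fun x _ => h x) (by positivity)

lemma avg_equiv (e : X ≃ Y) (f : Y → ℝ) : avg (fun x => f (e x)) = avg f := by
  letI := Fintype.ofFinite X
  letI := Fintype.ofFinite Y
  rw [avg_eq, avg_eq, Fintype.card_congr e]
  congr 1
  exact Equiv.sum_comp e f

lemma avg_prod (f : X × Y → ℝ) : avg f = avg fun x => avg fun y => f (x, y) := by
  letI := Fintype.ofFinite X
  letI := Fintype.ofFinite Y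
  simp only [avg_eq]
  rw [Fintype.sum_prod_type, ← Finset.sum_div, Fintype.card_prod]
  push_cast
  rw [div_div, mul_comm]

lemma avg_comm (f : X → Y → ℝ) :
    (avg fun x => avg fun y => f x y) = avg fun y => avg fun x => f x y := by
  rw [← avg_prod (fun p : X × Y => f p.1 p.2), ← avg_prod (fun p : Y × X => f p.2 p.1),
    ← avg_equiv (Equiv.prodComm X Y)]
  rfl

lemma avg_sum {Q : Type} [Fintype Q] (f : Q → X → ℝ) :
    avg (fun x => ∑ q, f q x) = ∑ q, avg (f q) := by
  letI := Fintype.ofFinite X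
  simp only [avg_eq]
  rw [Finset.sum_comm, Finset.sum_div]

lemma exists_avg_le [Nonempty X] (f : X → ℝ) : ∃ x, avg f ≤ f x := by
  by_contra! h
  letI := Fintype.ofFinite X
  have h1 : ∑ x, f x < ∑ _x : X, avg f :=
    Finset.sum_lt_sum_of_nonempty Finset.univ_nonempty fun x _ => h x
  have hc : (0 : ℝ) < Fintype.card X := by exact_mod_cast Fintype.card_pos
  rw [Finset.sum_const, Finset.card_univ, nsmul_eq_mul, avg_eq] at h1
  field_simp at h1
  exact lt_irrefl _ h1

lemma avg_sumArrow {ι κ α : Type} [Finite ι] [Finite κ] [Finite α] (f : (ι ⊕ κ → α) → ℝ) :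
    avg f = avg fun s : ι → α => avg fun t : κ → α => f (Sum.elim s t) := by
  rw [← avg_equiv (Equiv.sumArrowEquivProdArrow ι κ α).symm, avg_prod]
  rfl

open Classical in
/-- Real-valued indicator of a proposition. -/
def ind (p : Prop) : ℝ := if p then 1 else 0

lemma ind_true {p : Prop} (h : p) : ind p = 1 := by simp [ind, h]
lemma ind_false {p : Prop} (h : ¬ p) : ind p = 0 := by simp [ind, h]
lemma ind_nonneg (p : Prop) : 0 ≤ ind p := by unfold ind; split_ifs <;> norm_num
lemma ind_le_one (p : Prop) : ind p ≤ 1 := by unfold ind; split_ifs <;> norm_num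
lemma ind_mono {p q : Prop} (h : p → q) : ind p ≤ ind q := by
  by_cases hp : p
  · rw [ind_true hp, ind_true (h hp)]
  · rw [ind_false hp]; exact ind_nonneg q
lemma ind_compl (p : Prop) : ind (¬ p) = 1 - ind p := by
  by_cases hp : p <;> simp [ind, hp]
lemma ind_and (p q : Prop) : ind (p ∧ q) = ind p * ind q := by
  by_cases hp : p <;> by_cases hq : q <;> simp [ind, hp, hq]

/-- Density of a set in a finite type. -/
def dens (A : Set X) : ℝ := avg fun x => ind (x ∈ A)

lemma dens_nonneg (A : Set X) : 0 ≤ dens A := avg_nonneg fun _ => ind_nonneg _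

lemma dens_le_one [Nonempty X] (A : Set X) : dens A ≤ 1 := by
  rw [← avg_const (X := X) 1]
  exact avg_mono fun _ => ind_le_one _

lemma dens_mono {A B : Set X} (h : A ⊆ B) : dens A ≤ dens B :=
  avg_mono fun _ => ind_mono fun hx => h hx

lemma dens_nonempty {A : Set X} (h : 0 < dens A) : A.Nonempty := by
  by_contra hA
  rw [Set.not_nonempty_iff_eq_empty] at hA
  subst hA
  simp [dens, ind, avg] at h

lemma dens_ge_of_nonempty {A : Set X} (h : A.Nonempty) : 1 / (Nat.card X : ℝ) ≤ dens A := by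
  letI := Fintype.ofFinite X
  obtain ⟨a, ha⟩ := h
  unfold dens
  rw [avg_eq, Nat.card_eq_fintype_card]
  apply div_le_div_of_nonneg_right _ (by positivity)
  rw [← ind_true ha]
  exact Finset.single_le_sum (f := fun x => ind (x ∈ A)) (fun _ _ => ind_nonneg _) (Finset.mem_univ a)

lemma avg_range {f : Y → ℝ} {g : X → Y} (hg : Function.Injective g) [Nonempty X] :
    avg (fun y => f y * ind (y ∈ Set.range g)) = dens (Set.range g) * avg (fun x => f (g x)) := by
  classical
  letI := Fintype.ofFinite X
  letI := Fintype.ofFinite Y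
  have key : ∀ h : Y → ℝ, ∑ y, h y * ind (y ∈ Set.range g) = ∑ x, h (g x) := by
    intro h
    rw [← Finset.sum_image (s := Finset.univ) (g := g) (f := h) (fun a _ b _ hab => hg hab)]
    simp only [ind, mul_ite, mul_one, mul_zero]
    rw [← Finset.sum_filter]
    congr 1
    ext y
    simp
  unfold dens
  rw [avg_eq, avg_eq, avg_eq, key]
  have := key (fun _ => 1)
  simp only [one_mul] at this
  rw [this]
  have hc : (0 : ℝ) < Fintype.card X := by exact_mod_cast Fintype.card_pos
  simp

/-- Pigeonhole: dense families of dense sets share a pattern. -/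
lemma corr {Q : Type} [Finite Q] [Nonempty X] [Nonempty Y] (G : Q → Set Y) {δ : ℝ} (hδ : 0 < δ)
    (h : ∀ B : Set Y, δ / 2 ≤ dens B → ∃ q, G q ⊆ B) (A : X → Set Y)
    (hA : δ ≤ avg fun x => dens (A x)) :
    ∃ q, δ / (2 * (Nat.card Q + 1)) ≤ dens {x | G q ⊆ A x} := by
  by_contra! hq
  letI := Fintype.ofFinite Q
  have h1 : ∀ x, dens (A x) ≤ δ / 2 + ∑ q, ind (G q ⊆ A x) := by
    intro x
    have hs : 0 ≤ ∑ q, ind (G q ⊆ A x) := Finset.sum_nonneg fun _ _ => ind_nonneg _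
    by_cases hx : δ / 2 ≤ dens (A x)
    · obtain ⟨q, hq⟩ := h _ hx
      have : ind (G q ⊆ A x) ≤ ∑ q, ind (G q ⊆ A x) :=
        Finset.single_le_sum (f := fun q => ind (G q ⊆ A x)) (fun _ _ => ind_nonneg _)
          (Finset.mem_univ q)
      rw [ind_true hq] at this
      have := dens_le_one (A x)
      linarith
    · linarith
  have h2 := avg_mono h1
  rw [avg_add, avg_const, avg_sum] at h2
  have h3 : ∑ q, avg (fun x => ind (G q ⊆ A x)) ≤ ∑ _q : Q, δ / (2 * (Nat.card Q + 1)) :=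
    Finset.sum_le_sum fun q _ => (hq q).le
  rw [Finset.sum_const, Finset.card_univ, nsmul_eq_mul, Nat.card_eq_fintype_card] at h3
  have h4 : (Fintype.card Q : ℝ) * (δ / (2 * (Fintype.card Q + 1))) < δ / 2 := by
    have : (0 : ℝ) ≤ Fintype.card Q := by positivity
    rw [← mul_div_assoc, div_lt_div_iff₀ (by positivity) (by positivity)]
    nlinarith
  linarith

end avgs

instance finite_line {α ι : Type} [Finite α] [Finite ι] : Finite (Line α ι) :=
  Finite.of_injective (fun l => l.idxFun) fun _ _ h => Line.ext h

instance finite_subspace {η α ι : Type} [Finite η] [Finite α] [Finite ι] :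
    Finite (Subspace η α ι) :=
  Finite.of_injective (fun l => l.idxFun) fun _ _ h => Subspace.ext h

lemma subspace_injective {η α ι : Type} (V : Subspace η α ι) :
    Function.Injective (fun x => V x) := by
  intro x y h
  funext e
  obtain ⟨i, hi⟩ := V.proper e
  have := congrFun h i
  simpa [Subspace.apply_inr hi] using this

/-- Every set of density at least `δ` contains a line. -/
def DL (α ι : Type) [Finite α] [Finite ι] (δ : ℝ) : Prop :=
  ∀ A : Set (ι → α), δ ≤ dens A → ∃ l : Line α ι, ∀ x, l x ∈ A

/-- Every set of density at least `δ` contains a subspace. -/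
def DS (η α ι : Type) [Finite α] [Finite ι] (δ : ℝ) : Prop :=
  ∀ A : Set (ι → α), δ ≤ dens A → ∃ V : Subspace η α ι, ∀ x, V x ∈ A

/-- The density Hales-Jewett property of an alphabet. -/
def DHJ (α : Type) [Finite α] : Prop :=
  ∀ δ : ℝ, 0 < δ → ∃ (ι : Type) (_ : Finite ι), DL α ι δ

/-- Composition of subspaces. -/
def compS {η ζ α ι : Type} (V : Subspace η α ι) (W : Subspace ζ α η) : Subspace ζ α ι where
  idxFun i := (V.idxFun i).elim Sum.inl W.idxFun
  proper e := by
    obtain ⟨j, hj⟩ := W.proper e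
    obtain ⟨i, hi⟩ := V.proper j
    exact ⟨i, by simp [hi, hj]⟩

lemma compS_apply {η ζ α ι : Type} (V : Subspace η α ι) (W : Subspace ζ α η) (x : ζ → α) :
    compS V W x = V (W x) := by
  funext i
  simp only [Subspace.coe_apply, compS]
  cases V.idxFun i <;> simp [Subspace.coe_apply]

/-- Image of a line in a subspace. -/
def compL {η α ι : Type} (V : Subspace η α ι) (l : Line α η) : Line α ι where
  idxFun i := (V.idxFun i).elim some l.idxFun
  proper := by
    obtain ⟨j, hj⟩ := l.proper
    obtain ⟨i, hi⟩ := V.proper j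
    exact ⟨i, by simp [hi, hj]⟩

lemma compL_apply {η α ι : Type} (V : Subspace η α ι) (l : Line α η) (x : α) :
    compL V l x = V (l x) := by
  funext i
  simp only [Subspace.coe_apply, Line.coe_apply, compL]
  cases V.idxFun i <;> simp

/-- Product of a subspace with a point. -/
def extS {η α ι κ : Type} (V : Subspace η α ι) (t : κ → α) : Subspace η α (ι ⊕ κ) where
  idxFun := Sum.elim V.idxFun (fun j => Sum.inl (t j))
  proper e := by
    obtain ⟨i, hi⟩ := V.proper e
    exact ⟨Sum.inl i, by simp [hi]⟩

lemma extS_apply {η α ι κ : Type} (V : Subspace η α ι) (t : κ → α) (x : η → α) :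
    extS V t x = Sum.elim (V x) t := by
  funext i
  cases i <;> simp [Subspace.coe_apply, extS]

/-- Product of a point with a subspace. -/
def extS' {η α ι κ : Type} (t : κ → α) (V : Subspace η α ι) : Subspace η α (κ ⊕ ι) where
  idxFun := Sum.elim (fun j => Sum.inl (t j)) V.idxFun
  proper e := by
    obtain ⟨i, hi⟩ := V.proper e
    exact ⟨Sum.inr i, by simp [hi]⟩

lemma extS'_apply {η α ι κ : Type} (V : Subspace η α ι) (t : κ → α) (x : η → α) :
    extS' t V x = Sum.elim t (V x) := by
  funext i
  cases i <;> simp [Subspace.coe_apply, extS']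

/-- Product of a line and a subspace. -/
def consS {α ι κ : Type} {d : ℕ} (l : Line α ι) (V : Subspace (Fin d) α κ) :
    Subspace (Fin (d + 1)) α (ι ⊕ κ) where
  idxFun := Sum.elim (fun j => (l.idxFun j).elim (Sum.inr 0) Sum.inl)
    (fun j => (V.idxFun j).map id Fin.succ)
  proper e := by
    refine Fin.cases ?_ (fun e => ?_) e
    · obtain ⟨i, hi⟩ := l.proper
      exact ⟨Sum.inl i, by simp [hi]⟩
    · obtain ⟨i, hi⟩ := V.proper e
      exact ⟨Sum.inr i, by simp [hi]⟩

lemma consS_apply {α ι κ : Type} {d : ℕ} (l : Line α ι) (V : Subspace (Fin d) α κ)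
    (x : Fin (d + 1) → α) : consS l V x = Sum.elim (l (x 0)) (V fun e => x e.succ) := by
  funext i
  rcases i with i | i
  · simp only [Subspace.coe_apply, consS, Sum.elim_inl, Line.coe_apply]
    cases l.idxFun i <;> simp
  · simp only [Subspace.coe_apply, consS, Sum.elim_inr]
    cases V.idxFun i <;> simp

lemma mdhj_fin {α : Type} [Finite α] [Nonempty α] (h : DHJ α) (d : ℕ) :
    ∀ δ : ℝ, 0 < δ → ∃ (ι : Type) (_ : Finite ι), DS (Fin d) α ι δ := by
  induction d with
  | zero =>
    intro δ hδ
    refine ⟨Empty, inferInstance, fun A hA => ?_⟩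
    obtain ⟨a, ha⟩ := dens_nonempty (lt_of_lt_of_le hδ hA)
    refine ⟨⟨fun i => Sum.inl (a i), fun e => e.elim0⟩, fun x => ?_⟩
    convert ha
  | succ d ih =>
    intro δ hδ
    obtain ⟨κ, hκ, hV⟩ := ih (δ / 2) (by positivity)
    obtain ⟨ι, hι, hL⟩ := h (δ / (2 * (Nat.card (Subspace (Fin d) α κ) + 1))) (by positivity)
    refine ⟨ι ⊕ κ, inferInstance, fun A hA => ?_⟩
    unfold dens at hA
    rw [avg_sumArrow] at hA
    obtain ⟨V, hVd⟩ := corr (X := ι → α) (Y := κ → α) (Q := Subspace (Fin d) α κ)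
      (fun V => Set.range fun x => V x) hδ
      (fun B hB => by
        obtain ⟨V, hV⟩ := hV B hB
        exact ⟨V, by rintro _ ⟨x, rfl⟩; exact hV x⟩)
      (fun s => {t | Sum.elim s t ∈ A}) hA
    obtain ⟨l, hl⟩ := hL _ hVd
    refine ⟨consS l V, fun x => ?_⟩
    rw [consS_apply]
    exact hl (x 0) ⟨_, rfl⟩

lemma DS.extend {η α ι κ : Type} [Finite α] [Nonempty α] [Finite ι] [Finite κ] {δ : ℝ}
    (h : DS η α ι δ) : DS η α (ι ⊕ κ) δ := by
  intro A hA
  unfold dens at hA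
  rw [avg_sumArrow, avg_comm] at hA
  obtain ⟨t, ht⟩ := exists_avg_le (fun t : κ → α => avg fun s : ι → α => ind (Sum.elim s t ∈ A))
  obtain ⟨V, hV⟩ := h {s | Sum.elim s t ∈ A} (hA.trans ht)
  exact ⟨extS V t, fun x => by rw [extS_apply]; exact hV x⟩

lemma DS.equiv {η α ι κ : Type} [Finite α] [Finite ι] [Finite κ] {δ : ℝ}
    (h : DS η α ι δ) (e : ι ≃ κ) : DS η α κ δ := by
  intro A hA
  unfold dens at hA
  rw [← avg_equiv (e.arrowCongr (Equiv.refl α))] at hA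
  obtain ⟨V, hV⟩ := h {s | e.arrowCongr (Equiv.refl α) s ∈ A} hA
  refine ⟨V.reindex (Equiv.refl η) (Equiv.refl α) e, fun x => ?_⟩
  have := hV x
  have h2 : (V.reindex (Equiv.refl η) (Equiv.refl α) e) x = e.arrowCongr (Equiv.refl α) (V x) := by
    funext i
    simp
  rw [h2]
  exact this

lemma mdhj {α : Type} [Finite α] [Nonempty α] (h : DHJ α) (η : Type) [Finite η] (δ : ℝ)
    (hδ : 0 < δ) : ∃ N : ℕ, ∀ (ι : Type) [Finite ι], N ≤ Nat.card ι → DS η α ι δ := by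
  obtain ⟨κ, hκ, hV⟩ := mdhj_fin h (Nat.card η) δ hδ
  refine ⟨Nat.card κ, fun ι _ hι => ?_⟩
  have hV' : DS η α κ δ := by
    intro A hA
    obtain ⟨V, hV⟩ := hV A hA
    refine ⟨V.reindex (Finite.equivFin η).symm (Equiv.refl α) (Equiv.refl κ), fun x => ?_⟩
    have h2 := hV (x ∘ (Finite.equivFin η).symm)
    convert h2 using 1
    funext i
    simp
  have e : κ ⊕ Fin (Nat.card ι - Nat.card κ) ≃ ι := by
    refine Nonempty.some (Finite.card_eq.1 ?_)
    rw [Nat.card_sum]; simp; omega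
  exact hV'.extend.equiv e

/-- Replace the letter `none` by `b`. -/
def rep {β ι : Type} (b : β) (x : ι → Option β) : ι → Option β := fun j => some ((x j).getD b)

lemma rep_rep {β ι : Type} (b : β) (x : ι → Option β) : rep b (rep b x) = rep b x := by
  funext j; simp [rep]

lemma rep_elim {β ι κ : Type} (b : β) (x : ι → Option β) (y : κ → Option β) :
    rep b (Sum.elim x y) = Sum.elim (rep b x) (rep b y) := by
  funext j; cases j <;> simp [rep]

/-- Sets insensitive to swapping the letters `none` and `b`. -/
def Insens {β ι : Type} (b : β) (D : Set (ι → Option β)) : Prop := ∀ x, rep b x ∈ D ↔ x ∈ D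

lemma avg_pow {α : Type} [Finite α] (h : α → ℝ) (n : ℕ) :
    avg (fun x : Fin n → α => ∏ j, h (x j)) = avg h ^ n := by
  classical
  letI := Fintype.ofFinite α
  rw [avg_eq, avg_eq, div_pow, Fintype.sum_pow]
  simp

lemma avg_half {β : Type} [Finite β] [Nonempty β] :
    avg (fun o : Option β => if o = none then (1 : ℝ) else 1 / 2) ≤ 3 / 4 := by
  classical
  letI := Fintype.ofFinite β
  rw [avg_eq, Fintype.sum_option]
  simp
  have : (1 : ℝ) ≤ Fintype.card β := by exact_mod_cast Fintype.card_pos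
  rw [div_le_div_iff₀ (by positivity) (by positivity)]
  linarith

lemma small_supp {β : Type} [Finite β] [Nonempty β] (N : ℕ) (ε : ℝ) (hε : 0 < ε) :
    ∃ n : ℕ, dens {x : Fin n → Option β | Nat.card {j // x j ≠ none} < N} ≤ ε := by
  classical
  obtain ⟨n, hn⟩ := exists_pow_lt_of_lt_one (show 0 < ε / 2 ^ N by positivity)
    (show (3 / 4 : ℝ) < 1 by norm_num)
  refine ⟨n, ?_⟩
  have h1 : ∀ x : Fin n → Option β,
      ind (x ∈ {x : Fin n → Option β | Nat.card {j // x j ≠ none} < N}) ≤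
        2 ^ N * ∏ j, (if x j = none then (1 : ℝ) else 1 / 2) := by
    intro x
    have hp : ∏ j, (if x j = none then (1 : ℝ) else 1 / 2)
        = (1 / 2) ^ Nat.card {j // x j ≠ none} := by
      rw [Finset.prod_ite]
      simp [Fintype.card_subtype]
    rw [hp]
    by_cases hx : Nat.card {j // x j ≠ none} < N
    · rw [ind_true (by exact hx)]
      have : (1 / 2 : ℝ) ^ N ≤ (1 / 2) ^ Nat.card {j // x j ≠ none} :=
        pow_le_pow_of_le_one (by norm_num) (by norm_num) hx.le
      calc (1 : ℝ) = 2 ^ N * (1 / 2) ^ N := by rw [← mul_pow]; norm_num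
        _ ≤ _ := by gcongr
    · rw [ind_false (by exact hx)]
      positivity
  calc dens _ ≤ _ := avg_mono h1
    _ = 2 ^ N * avg (fun o : Option β => if o = none then (1 : ℝ) else 1 / 2) ^ n := by
        rw [avg_mul, avg_pow (fun o : Option β => if o = none then (1 : ℝ) else 1 / 2)]
    _ ≤ 2 ^ N * (3 / 4) ^ n := by
        gcongr
        · apply avg_nonneg; intro o; split_ifs <;> norm_num
        · exact avg_half
    _ ≤ 2 ^ N * (ε / 2 ^ N) := by gcongr
    _ = ε := by field_simp

/-- Resampling of the non-`none` letters. -/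
def swapE (ι β : Type) : (ι → Option β) × (ι → β) ≃ (ι → Option β) × (ι → β) where
  toFun p := (fun j => (p.1 j).map fun _ => p.2 j, fun j => (p.1 j).getD (p.2 j))
  invFun p := (fun j => (p.1 j).map fun _ => p.2 j, fun j => (p.1 j).getD (p.2 j))
  left_inv p := by
    rcases p with ⟨x, y⟩
    refine Prod.ext (funext fun j => ?_) (funext fun j => ?_)
    · cases h : x j <;> simp [h]
    · cases h : x j <;> simp [h]
  right_inv p := by
    rcases p with ⟨x, y⟩
    refine Prod.ext (funext fun j => ?_) (funext fun j => ?_)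
    · cases h : x j <;> simp [h]
    · cases h : x j <;> simp [h]

lemma avg_resample {ι β : Type} [Finite ι] [Finite β] [Nonempty β] (f : (ι → Option β) → ℝ) :
    avg f = avg fun x : ι → Option β => avg fun y : ι → β =>
      f fun j => (x j).map fun _ => y j := by
  have h1 : avg f = avg (fun p : (ι → Option β) × (ι → β) => f p.1) := by
    rw [avg_prod]
    simp only [avg_const]
  rw [h1, ← avg_equiv (swapE ι β), avg_prod]
  rfl

open Classical in
/-- Dense insensitive sets contain subspaces. -/
lemma insens_subspace {β : Type} [Finite β] [Nonempty β] (h : DHJ β) (η : Type) [Finite η]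
    (δ : ℝ) (hδ : 0 < δ) :
    ∃ (ι : Type) (_ : Finite ι), ∀ (b : β) (D : Set (ι → Option β)), Insens b D → δ ≤ dens D →
      ∃ V : Subspace η (Option β) ι, ∀ x, V x ∈ D := by
  obtain ⟨N, hN⟩ := mdhj h η (δ / 3) (by positivity)
  obtain ⟨n, hn⟩ := small_supp (β := β) N (δ / 3) (by positivity)
  refine ⟨Fin n, inferInstance, fun b D hD hd => ?_⟩
  have : ∃ x : Fin n → Option β, N ≤ Nat.card {j // x j ≠ none} ∧
      δ / 3 ≤ avg fun y : Fin n → β => ind ((fun j => (x j).map fun _ => y j) ∈ D) := by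
    by_contra! hx
    have h1 : ∀ x : Fin n → Option β,
        (avg fun y : Fin n → β => ind ((fun j => (x j).map fun _ => y j) ∈ D)) ≤
        ind (x ∈ {x : Fin n → Option β | Nat.card {j // x j ≠ none} < N}) + δ / 3 := by
      intro x
      by_cases hc : N ≤ Nat.card {j // x j ≠ none}
      · have := (hx x hc).le
        have h0 := ind_nonneg (x ∈ {x : Fin n → Option β | Nat.card {j // x j ≠ none} < N})
        linarith
      · rw [ind_true (by simpa using hc)]
        have := dens_le_one {y : Fin n → β | (fun j => (x j).map fun _ => y j) ∈ D}
        unfold dens at this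
        simp only [Set.mem_ofPred_eq] at this
        linarith
    have h2 := avg_mono h1
    rw [← avg_resample (fun x => ind (x ∈ D)), avg_add, avg_const] at h2
    unfold dens at hd hn
    linarith
  obtain ⟨x, hxN, hx⟩ := this
  -- the word obtained from `x` and letters on the support
  let g : ({j // x j ≠ none} → β) → Fin n → Option β :=
    fun y j => if hj : x j ≠ none then some (y ⟨j, hj⟩) else none
  have hg : δ / 3 ≤ dens {y | g y ∈ D} := by
    rw [← avg_equiv (Equiv.piEquivPiSubtypeProd (fun j => x j ≠ none) (fun _ => β)).symm,
      avg_prod] at hx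
    refine hx.trans (le_of_eq ?_)
    unfold dens
    congr 1
    funext y
    rw [← avg_const (X := {j // ¬ (x j ≠ none)} → β) (ind (y ∈ {y | g y ∈ D}))]
    congr 1
    funext z
    simp only [Set.mem_ofPred_eq]
    congr 2
    funext j
    by_cases hj : x j = none
    · simp [hj, g]
    · obtain ⟨c, hc⟩ := Option.ne_none_iff_exists'.1 hj
      simp [hc, g, Equiv.piEquivPiSubtypeProd]
  obtain ⟨V, hV⟩ := hN {j // x j ≠ none} hxN _ hg
  refine ⟨⟨fun j => if hj : x j ≠ none then (V.idxFun ⟨j, hj⟩).map some id else Sum.inl none, ?_⟩, ?_⟩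
  · intro e
    obtain ⟨⟨j, hj⟩, h2⟩ := V.proper e
    exact ⟨j, by simp [hj, h2]⟩
  · intro z
    rw [← hD]
    have h3 := hV (fun e => (z e).getD b)
    simp only [Set.mem_ofPred_eq] at h3
    rw [← hD] at h3
    convert h3 using 1
    funext j
    simp only [rep, Subspace.coe_apply, g]
    by_cases hj : x j = none
    · simp [hj]
    · simp only [ne_eq, hj, not_false_eq_true, dite_true]
      cases V.idxFun ⟨j, hj⟩ <;> simp

lemma tile_round {β : Type} [Finite β] [Nonempty β] (η : Type) [Finite η]
    (ε : ℝ) (hε : 0 < ε) (M : Type) [Finite M]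
    (hM : ∀ (b : β) (D : Set (M → Option β)), Insens b D → ε ≤ dens D →
      ∃ V : Subspace η (Option β) M, ∀ x, V x ∈ D) (γ : ℝ)
    (hγ : γ = 1 / (Nat.card (M → Option β) : ℝ)) (hγ1 : γ ≤ 1) (r : ℕ) :
    ∃ (ι : Type) (_ : Finite ι), ∀ (b : β) (D : Set (ι → Option β)) (f : (ι → Option β) → ℝ),
      (∀ x, f x ≤ 1) → Insens b D →
      (∀ V : Subspace η (Option β) ι, avg (fun z => f (V z)) ≤ ε) →
      avg (fun x => f x * ind (x ∈ D)) ≤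
        ε * dens D + (1 - γ) ^ r * dens D + (1 - (1 - γ) ^ r) * ε := by
  have hγ0 : 0 ≤ γ := by rw [hγ]; positivity
  induction r with
  | zero =>
    refine ⟨Empty, inferInstance, fun b D f hf _ _ => ?_⟩
    have h1 : avg (fun x => f x * ind (x ∈ D)) ≤ dens D := avg_mono fun x => by
      have := mul_le_mul_of_nonneg_right (hf x) (ind_nonneg (x ∈ D))
      linarith
    have := dens_nonneg D
    have := mul_nonneg hε.le this
    simp
    linarith
  | succ r ih =>
    obtain ⟨ι, hι, ih⟩ := ih
    refine ⟨ι ⊕ M, inferInstance, fun b D f hf hD hV => ?_⟩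
    have hpick : ∀ E : Set (M → Option β), ∃ P : Set (M → Option β), P ⊆ E ∧
        (P = ∅ ∨ ∃ V : Subspace η (Option β) M, P = Set.range fun z => V z) ∧
        (Insens b E → ε ≤ dens E → P.Nonempty) := by
      intro E
      by_cases hE : ∃ V : Subspace η (Option β) M, ∀ x, V x ∈ E
      · obtain ⟨V, hV⟩ := hE
        exact ⟨Set.range fun z => V z, by rintro _ ⟨z, rfl⟩; exact hV z, Or.inr ⟨V, rfl⟩,
          fun _ _ => Set.range_nonempty _⟩
      · exact ⟨∅, Set.empty_subset _, Or.inl rfl, fun h1 h2 => absurd (hM b E h1 h2) hE⟩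
    choose P hPsub hPform hPne using hpick
    let Dt : (ι → Option β) → Set (M → Option β) := fun t => {y | Sum.elim t y ∈ D}
    have hDt : ∀ t, Insens b (Dt t) := by
      intro t y
      change Sum.elim t (rep b y) ∈ D ↔ Sum.elim t y ∈ D
      rw [← hD, rep_elim, rep_rep, ← rep_elim, hD]
    have hDrep : ∀ t, Dt (rep b t) = Dt t := by
      intro t
      ext y
      change Sum.elim (rep b t) y ∈ D ↔ Sum.elim t y ∈ D
      rw [← hD, rep_elim, rep_rep, ← rep_elim, hD]
    let R : (M → Option β) → Set (ι → Option β) := fun y => {t | y ∈ Dt t ∧ y ∉ P (Dt t)}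
    have hR : ∀ y, Insens b (R y) := by
      intro y t
      change (y ∈ Dt (rep b t) ∧ y ∉ P (Dt (rep b t))) ↔ (y ∈ Dt t ∧ y ∉ P (Dt t))
      rw [hDrep]
    have hind : ∀ t y, ind (Sum.elim t y ∈ D) = ind (y ∈ P (Dt t)) + ind (t ∈ R y) := by
      intro t y
      by_cases h1 : y ∈ P (Dt t)
      · have h2 : Sum.elim t y ∈ D := hPsub _ h1
        have h3 : t ∉ R y := fun h => h.2 h1
        rw [ind_true h1, ind_true h2, ind_false h3]; norm_num
      · rw [ind_false h1, zero_add]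
        congr 1
        apply propext
        exact ⟨fun h => ⟨h, h1⟩, fun h => h.1⟩
    set ρP := avg fun t => dens (P (Dt t)) with hρP
    set ρR := avg fun y => dens (R y) with hρR
    have hρD : dens D = ρP + ρR := by
      have : dens D = avg fun t => avg fun y => ind (Sum.elim t y ∈ D) := avg_sumArrow _
      rw [this]
      simp only [hind, avg_add]
      congr 1
      rw [avg_comm]
      rfl
    have hPlow : γ * (dens D - ε) ≤ ρP := by
      have : dens D = avg fun t => dens (Dt t) := avg_sumArrow _
      rw [this, ← avg_const (X := ι → Option β) ε, ← avg_sub, ← avg_mul]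
      apply avg_mono
      intro t
      by_cases hd : ε ≤ dens (Dt t)
      · have h1 := dens_ge_of_nonempty (hPne _ (hDt t) hd)
        rw [← hγ] at h1
        have h2 := dens_le_one (Dt t)
        nlinarith
      · have := dens_nonneg (P (Dt t))
        push Not at hd
        nlinarith
    have hmain : avg (fun x => f x * ind (x ∈ D)) ≤
        ε * ρP + (ε * ρR + (1 - γ) ^ r * ρR + (1 - (1 - γ) ^ r) * ε) := by
      rw [avg_sumArrow]
      simp only [hind, mul_add, avg_add]
      apply add_le_add
      · rw [← avg_mul]
        apply avg_mono
        intro t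
        rcases hPform (Dt t) with h0 | ⟨V, hVP⟩
        · rw [h0]
          have : dens (∅ : Set (M → Option β)) = 0 := by
            simp [dens, ind, avg]
          rw [this]
          simp [ind, avg]
        · rw [hVP, avg_range (f := fun y => f (Sum.elim t y)) (subspace_injective V), mul_comm]
          apply mul_le_mul_of_nonneg_right _ (dens_nonneg _)
          have := hV (extS' t V)
          simpa only [extS'_apply] using this
      · rw [avg_comm]
        have h1 : ∀ y, (avg fun t => f (Sum.elim t y) * ind (t ∈ R y)) ≤
            ε * dens (R y) + (1 - γ) ^ r * dens (R y) + (1 - (1 - γ) ^ r) * ε := by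
          intro y
          apply ih b (R y) (fun t => f (Sum.elim t y)) (fun t => hf _) (hR y)
          intro V
          have := hV (extS V y)
          simpa only [extS_apply] using this
        refine (avg_mono h1).trans (le_of_eq ?_)
        rw [avg_add, avg_add, avg_mul, avg_mul, avg_const]
    have hp : 0 ≤ (1 - γ) ^ r := pow_nonneg (by linarith) r
    have hprod := mul_nonneg hp (sub_nonneg.2 hPlow)
    refine hmain.trans ?_
    rw [pow_succ]
    rw [hρD] at hprod ⊢
    nlinarith

lemma tile1 {β : Type} [Finite β] [Nonempty β] (h : DHJ β) (η : Type) [Finite η]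
    (ε : ℝ) (hε : 0 < ε) :
    ∃ (ι : Type) (_ : Finite ι), ∀ (b : β) (D : Set (ι → Option β)) (f : (ι → Option β) → ℝ),
      (∀ x, f x ≤ 1) → Insens b D →
      (∀ V : Subspace η (Option β) ι, avg (fun z => f (V z)) ≤ ε) →
      avg (fun x => f x * ind (x ∈ D)) ≤ 3 * ε := by
  obtain ⟨M, hMf, hM⟩ := insens_subspace h η ε hε
  have hc : 0 < Nat.card (M → Option β) := Nat.card_pos
  have hc1 : (1 : ℝ) ≤ Nat.card (M → Option β) := by exact_mod_cast hc
  set γ : ℝ := 1 / (Nat.card (M → Option β) : ℝ) with hγ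
  have hγ1 : γ ≤ 1 := by rw [hγ, div_le_one (by linarith)]; exact hc1
  have hγ0 : 0 < γ := by positivity
  obtain ⟨r, hr⟩ := exists_pow_lt_of_lt_one hε (show 1 - γ < 1 by linarith)
  obtain ⟨ι, hι, hT⟩ := tile_round η ε hε M hM γ hγ hγ1 r
  refine ⟨ι, hι, fun b D f hf hD hV => (hT b D f hf hD hV).trans ?_⟩
  have h0 := dens_nonneg D
  have h1 := dens_le_one D
  have hp : 0 ≤ (1 - γ) ^ r := pow_nonneg (by linarith) r
  have h2 : ε * dens D ≤ ε * 1 := by gcongr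
  have h3 : (1 - γ) ^ r * dens D ≤ (1 - γ) ^ r * 1 := by gcongr
  have h4 := mul_nonneg hp hε.le
  nlinarith

lemma rep_sub {β η ι : Type} (b : β) (V : Subspace η (Option β) ι) (z : η → Option β) :
    rep b (V (rep b z)) = rep b (V z) := by
  funext j
  simp only [rep, Subspace.coe_apply]
  cases V.idxFun j <;> simp [rep]

lemma tile2 {β : Type} [Finite β] [Nonempty β] (h : DHJ β) (η : Type) [Finite η]
    (S : Finset β) : ∀ ε : ℝ, 0 < ε →
    ∃ (ι : Type) (_ : Finite ι), ∀ f : (ι → Option β) → ℝ, (∀ x, f x ≤ 1) →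
      (∀ V : Subspace η (Option β) ι, avg (fun z => f (V z)) ≤ 0) →
      ∀ C : β → Set (ι → Option β), (∀ i, Insens i (C i)) →
      avg f ≤ ε ∧ avg (fun x => f x * ind (¬ ∀ i ∈ S, x ∈ C i)) ≤ ε := by
  classical
  induction S using Finset.induction_on with
  | empty =>
    intro ε hε
    refine ⟨η, inferInstance, fun f hf hV C hC => ⟨?_, ?_⟩⟩
    · have := hV ⟨Sum.inr, fun i => ⟨i, rfl⟩⟩
      exact le_trans this hε.le
    · simp [ind, avg, hε.le]
  | insert a S ha ih =>
    intro ε hε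
    obtain ⟨η₁, hη₁, h1⟩ := ih (ε / 6) (by positivity)
    obtain ⟨ι, hι, h2⟩ := tile1 h η₁ (ε / 6) (by positivity)
    refine ⟨ι, hι, fun f hf hV C hC => ?_⟩
    have hW : ∀ W : Subspace η₁ (Option β) ι, avg (fun z => f (W z)) ≤ ε / 6 ∧
        avg (fun z => f (W z) * ind (¬ ∀ i ∈ S, W z ∈ C i)) ≤ ε / 6 := by
      intro W
      apply h1 (fun z => f (W z)) (fun z => hf _) _ (fun i => {z | W z ∈ C i})
      · intro i z
        change W (rep i z) ∈ C i ↔ W z ∈ C i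
        rw [← hC i, rep_sub, hC]
      · intro V
        have := hV (compS W V)
        simpa only [compS_apply] using this
    have e1 := h2 a Set.univ f hf (fun x => by simp) (fun W => (hW W).1)
    have e2 := h2 a (C a)ᶜ f hf (fun x => not_congr (hC a x)) (fun W => (hW W).1)
    have e3 := h2 a (C a) (fun x => f x * ind (¬ ∀ i ∈ S, x ∈ C i)) (fun x => by
        by_cases hx : ∀ i ∈ S, x ∈ C i
        · rw [ind_false (not_not.2 hx)]; simp
        · rw [ind_true hx, mul_one]; exact hf x) (hC a) (fun W => (hW W).2)
    simp only [Set.mem_univ, ind_true, mul_one] at e1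
    refine ⟨by linarith, ?_⟩
    have : ∀ x, f x * ind (¬ ∀ i ∈ insert a S, x ∈ C i) =
        f x * ind (x ∈ (C a)ᶜ) + f x * ind (¬ ∀ i ∈ S, x ∈ C i) * ind (x ∈ C a) := by
      intro x
      rw [mul_assoc, ← mul_add]
      congr 1
      by_cases h3 : x ∈ C a <;> by_cases h4 : ∀ i ∈ S, x ∈ C i <;>
        simp only [ind, Finset.forall_mem_insert, h3, h4, Set.mem_compl_iff] <;> simp
    simp only [this, avg_add]
    linarith

lemma avg_lower {X : Type} [Finite X] [Nonempty X] (f : X → ℝ) (c η : ℝ) (h : ∀ x, f x ≤ c)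
    (ha : c - η ≤ avg f) (x₀ : X) : c - Nat.card X * η ≤ f x₀ := by
  letI := Fintype.ofFinite X
  have hc : (0 : ℝ) < Fintype.card X := by exact_mod_cast Fintype.card_pos
  have h1 : c - f x₀ ≤ ∑ x, (c - f x) :=
    Finset.single_le_sum (f := fun x => c - f x) (fun x _ => sub_nonneg.2 (h x))
      (Finset.mem_univ x₀)
  rw [avg_eq, le_div_iff₀ hc] at ha
  rw [Finset.sum_sub_distrib, Finset.sum_const, Finset.card_univ, nsmul_eq_mul] at h1
  rw [Nat.card_eq_fintype_card]
  nlinarith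

lemma DL.mono {α ι : Type} [Finite α] [Finite ι] {δ δ' : ℝ} (h : DL α ι δ) (hd : δ ≤ δ') :
    DL α ι δ' := fun A hA => h A (hd.trans hA)

/-- Fill in the letters of a tied word. -/
def wd {β Λ ι : Type} (u : Λ → Option β) (τ : ι → β ⊕ Λ) : Λ ⊕ ι → Option β :=
  Sum.elim u fun j => (τ j).elim some u

lemma rep_wd {β Λ ι : Type} (u : Λ → Option β) (τ : ι → β ⊕ Λ) (i : β) :
    rep i (wd u τ) = wd (rep i u) τ := by
  funext j
  rcases j with j | j
  · simp [rep, wd]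
  · simp only [rep, wd, Sum.elim_inr]
    cases τ j <;> simp [rep]

/-- The subspace obtained by fixing the first part. -/
def phiS {β Λ ι m : Type} (u : Λ → Option β) (V : Subspace m (β ⊕ Λ) ι) :
    Subspace m (Option β) (Λ ⊕ ι) where
  idxFun := Sum.elim (fun q => Sum.inl (u q))
    (fun j => (V.idxFun j).elim (fun c => Sum.inl (c.elim some u)) Sum.inr)
  proper e := by
    obtain ⟨j, hj⟩ := V.proper e
    exact ⟨Sum.inr j, by simp [hj]⟩

lemma phiS_apply {β Λ ι m : Type} (u : Λ → Option β) (V : Subspace m (β ⊕ Λ) ι) (p : Λ)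
    (hp : u p = none) (v : m → Option β) :
    phiS u V v = wd u (V fun e => (v e).elim (Sum.inr p) Sum.inl) := by
  funext j
  rcases j with j | j
  · simp [Subspace.coe_apply, phiS, wd]
  · simp only [Subspace.coe_apply, phiS, wd, Sum.elim_inr]
    cases V.idxFun j with
    | inl c => simp
    | inr e =>
      simp
      cases v e <;> simp [hp]

/-- The line with a given word whose fixed part is followed by a point. -/
def wordLine {β l κ : Type} (w : l → Option β) (s : κ → Option β) (t : l) (ht : w t = none) :
    Line (Option β) (l ⊕ κ) where
  idxFun := Sum.elim (fun j => (w j).map some) (fun j => some (s j))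
  proper := ⟨Sum.inl t, by simp [ht]⟩

lemma wordLine_none {β l κ : Type} (w : l → Option β) (s : κ → Option β) (t : l)
    (ht : w t = none) : wordLine w s t ht none = Sum.elim w s := by
  funext j
  rcases j with j | j
  · simp only [Line.coe_apply, wordLine, Sum.elim_inl]
    cases w j <;> simp
  · simp [wordLine]

lemma wordLine_some {β l κ : Type} (w : l → Option β) (s : κ → Option β) (t : l)
    (ht : w t = none) (i : β) : wordLine w s t ht (some i) = Sum.elim (rep i w) s := by
  funext j
  rcases j with j | j
  · simp only [Line.coe_apply, wordLine, Sum.elim_inl, rep]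
    cases w j <;> simp
  · simp [wordLine]

lemma dhj_step {β : Type} [Finite β] [Nonempty β] (h : DHJ β) (δ : ℝ) (hδ : 0 < δ)
    (hup : ∀ e : ℝ, 0 < e → ∃ (ι : Type) (_ : Finite ι), DL (Option β) ι (δ + e)) :
    ∃ e' : ℝ, 0 < e' ∧ ∃ (ι : Type) (_ : Finite ι), DL (Option β) ι (δ - e') := by
  obtain ⟨Λ, hΛf, hΛ⟩ := h (δ / 2 / 2) (by positivity)
  set θ : ℝ := δ / 2 / (2 * (Nat.card (Line β Λ) + 1)) with hθ
  have hθ0 : 0 < θ := by positivity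
  obtain ⟨e, he⟩ : ∃ e : ℝ, e = min (δ * θ / 8) (δ / 8) := ⟨_, rfl⟩
  have he0 : 0 < e := by rw [he]; positivity
  have he1 : e ≤ δ * θ / 8 := by rw [he]; exact min_le_left _ _
  have he2 : e ≤ δ / 8 := by rw [he]; exact min_le_right _ _
  obtain ⟨ζ, hζf, hζ⟩ := hup e he0
  have hβ : ∃ S : Finset β, ∀ i, i ∈ S := by
    letI := Fintype.ofFinite β
    exact ⟨Finset.univ, Finset.mem_univ⟩
  obtain ⟨S, hS⟩ := hβ
  obtain ⟨m, hmf, hm⟩ := tile2 h ζ S e he0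
  obtain ⟨ι', hι'f, hHJ⟩ := Subspace.exists_mono_in_high_dimension (β ⊕ Λ) (Set (Λ → Option β)) m
  set K : ℝ := (Nat.card (Λ ⊕ ι' → Option β) : ℝ) with hK
  have hK1 : 1 ≤ K := by
    rw [hK]
    exact_mod_cast (Nat.card_pos : 0 < Nat.card (Λ ⊕ ι' → Option β))
  obtain ⟨e', he'⟩ : ∃ e' : ℝ, e' = e / (2 * K) := ⟨_, rfl⟩
  have he'0 : 0 < e' := by rw [he']; positivity
  have he'K : K * (2 * e') = e := by rw [he']; field_simp
  obtain ⟨κ, hκf, hκ⟩ := hup e' he'0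
  refine ⟨e', he'0, (Λ ⊕ ι') ⊕ κ, inferInstance, fun A hA => ?_⟩
  by_contra hno
  -- all slices have density close to `δ`
  have hslice : ∀ t : Λ ⊕ ι' → Option β,
      δ - e ≤ dens {s : κ → Option β | Sum.elim t s ∈ A} := by
    intro t
    have hup' : ∀ t : Λ ⊕ ι' → Option β,
        dens {s : κ → Option β | Sum.elim t s ∈ A} ≤ δ + e' := by
      intro t
      by_contra! hlt
      obtain ⟨l, hl⟩ := hκ _ hlt.le
      exact hno ⟨l.vertical t, fun x => by rw [Line.vertical_apply]; exact hl x⟩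
    unfold dens at hA
    rw [avg_sumArrow] at hA
    have := avg_lower (fun t : Λ ⊕ ι' → Option β => dens {s : κ → Option β | Sum.elim t s ∈ A})
      (δ + e') (2 * e') hup' (by refine le_trans ?_ hA; linarith) t
    rw [← hK, he'K] at this
    linarith
  -- colouring
  obtain ⟨V, c, hc⟩ := hHJ fun τ => {u | θ ≤ dens {s : κ → Option β |
    ∀ i : β, Sum.elim (rep i (wd u τ)) s ∈ A}}
  have hgood : ∃ L : Line β Λ, L.idxFun ∈ c := by
    let v₀ : m → β ⊕ Λ := fun _ => Sum.inl (Classical.arbitrary β)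
    obtain ⟨L, hL⟩ := corr (X := κ → Option β) (Y := Λ → β) (Q := Line β Λ)
      (fun L => Set.range fun i => L i) (half_pos hδ)
      (fun B hB => by
        obtain ⟨L, hL⟩ := hΛ B hB
        exact ⟨L, by rintro _ ⟨x, rfl⟩; exact hL x⟩)
      (fun s => {u | Sum.elim (wd (fun q => some (u q)) (V v₀)) s ∈ A})
      (by
        unfold dens
        rw [avg_comm, ← avg_const (X := Λ → β) (δ / 2)]
        apply avg_mono
        intro u
        have := hslice (wd (fun q => some (u q)) (V v₀))
        unfold dens at this
        refine le_trans ?_ this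
        linarith)
    refine ⟨L, ?_⟩
    rw [← hc v₀]
    change θ ≤ _
    refine hL.trans (dens_mono ?_)
    intro s hs i
    have := hs ⟨i, rfl⟩
    rw [rep_wd]
    exact this
  obtain ⟨L, hL⟩ := hgood
  obtain ⟨p, hp⟩ := L.proper
  set φ := phiS L.idxFun V with hφ
  have hφgood : ∀ v : m → Option β,
      θ ≤ dens {s : κ → Option β | ∀ i : β, Sum.elim (rep i (φ v)) s ∈ A} := by
    intro v
    rw [hφ, phiS_apply _ _ p hp]
    rw [← hc (fun e => (v e).elim (Sum.inr p) Sum.inl)] at hL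
    exact hL
  have hφp : ∀ v, φ v (Sum.inl p) = none := by
    intro v
    rw [hφ, phiS_apply _ _ p hp]
    simp [wd, hp]
  have hdisj : ∀ v s, Sum.elim (φ v) s ∈ A → ¬ ∀ i : β, Sum.elim (rep i (φ v)) s ∈ A := by
    intro v s h1 h2
    refine hno ⟨wordLine (φ v) s (Sum.inl p) (hφp v), fun x => ?_⟩
    cases x with
    | none => rw [wordLine_none]; exact h1
    | some i => rw [wordLine_some]; exact h2 i
  have htile : ∀ s : κ → Option β, avg (fun v => (ind (Sum.elim (φ v) s ∈ A) - (δ + e)) *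
      ind (¬ ∀ i ∈ S, v ∈ {v | Sum.elim (rep i (φ v)) s ∈ A})) ≤ e := by
    intro s
    refine (hm (fun v => ind (Sum.elim (φ v) s ∈ A) - (δ + e)) ?_ ?_
      (fun i => {v | Sum.elim (rep i (φ v)) s ∈ A}) ?_).2
    · intro v
      have := ind_le_one (Sum.elim (φ v) s ∈ A)
      linarith
    · intro W
      rw [avg_sub, avg_const, sub_nonpos]
      by_contra! hlt
      obtain ⟨l, hl⟩ := hζ {z | Sum.elim (φ (W z)) s ∈ A} hlt.le
      refine hno ⟨compL (compS (extS φ s) W) l, fun x => ?_⟩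
      rw [compL_apply, compS_apply, extS_apply]
      exact hl x
    · intro i v
      change Sum.elim (rep i (φ (rep i v))) s ∈ A ↔ Sum.elim (rep i (φ v)) s ∈ A
      rw [rep_sub]
  have hpt : ∀ s v, ind (Sum.elim (φ v) s ∈ A) - (δ + e) +
      (δ + e) * ind (∀ i : β, Sum.elim (rep i (φ v)) s ∈ A) ≤
      (ind (Sum.elim (φ v) s ∈ A) - (δ + e)) *
      ind (¬ ∀ i ∈ S, v ∈ {v | Sum.elim (rep i (φ v)) s ∈ A}) := by
    intro s v
    by_cases hC : ∀ i : β, Sum.elim (rep i (φ v)) s ∈ A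
    · have hB : ¬ Sum.elim (φ v) s ∈ A := fun hB => hdisj v s hB hC
      have h3 : ¬ ¬ ∀ i ∈ S, v ∈ {v | Sum.elim (rep i (φ v)) s ∈ A} := not_not.2 fun i _ => hC i
      rw [ind_true hC, ind_false hB, ind_false h3]
      linarith
    · rw [ind_false hC, ind_true (fun hh => hC fun i => hh i (hS i))]
      linarith
  have hfin : (avg fun s : κ → Option β => avg fun v : m → Option β =>
      ind (Sum.elim (φ v) s ∈ A) - (δ + e) +
      (δ + e) * ind (∀ i : β, Sum.elim (rep i (φ v)) s ∈ A)) ≤ e := by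
    refine le_trans ?_ (avg_const (X := κ → Option β) e).le
    exact avg_mono fun s => (avg_mono (hpt s)).trans (htile s)
  rw [avg_comm] at hfin
  have hlow : (δ - e) - (δ + e) + (δ + e) * θ ≤ (avg fun v : m → Option β =>
      avg fun s : κ → Option β => ind (Sum.elim (φ v) s ∈ A) - (δ + e) +
      (δ + e) * ind (∀ i : β, Sum.elim (rep i (φ v)) s ∈ A)) := by
    rw [← avg_const (X := m → Option β) ((δ - e) - (δ + e) + (δ + e) * θ)]
    apply avg_mono
    intro v
    rw [avg_add, avg_sub, avg_mul, avg_const]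
    have h1 := hslice (φ v)
    have h2 := mul_le_mul_of_nonneg_left (hφgood v) (show 0 ≤ δ + e by linarith)
    unfold dens at h1 h2
    exact add_le_add (sub_le_sub_right h1 _) h2
  have : 0 < e * θ := by positivity
  have : 0 < δ * θ := by positivity
  nlinarith

lemma dhj_option {β : Type} [Finite β] [Nonempty β] (h : DHJ β) : DHJ (Option β) := by
  by_contra hno
  unfold DHJ at hno
  push Not at hno
  obtain ⟨δ₀, hδ₀, hno⟩ := hno
  let S : Set ℝ := {δ | ∃ (ι : Type) (_ : Finite ι), DL (Option β) ι δ}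
  have hlow : ∀ δ ∈ S, δ₀ ≤ δ := by
    rintro δ ⟨ι, hι, hd⟩
    by_contra! hlt
    exact hno ι hι (hd.mono hlt.le)
  have hne : S.Nonempty := by
    refine ⟨2, Empty, inferInstance, fun A hA => ?_⟩
    have := dens_le_one A
    linarith
  have hbdd : BddBelow S := ⟨δ₀, hlow⟩
  have hpos : 0 < sInf S := lt_of_lt_of_le hδ₀ (le_csInf hne hlow)
  obtain ⟨e', he', hmem⟩ := dhj_step h (sInf S) hpos (fun e he => by
    obtain ⟨δ, ⟨ι, hι, hd⟩, hlt⟩ := exists_lt_of_csInf_lt hne (show sInf S < sInf S + e by linarith)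
    exact ⟨ι, hι, hd.mono hlt.le⟩)
  have := csInf_le hbdd (show sInf S - e' ∈ S from hmem)
  linarith

lemma dhj_all (α : Type) [Finite α] : DHJ α := by
  have key : ∀ (α : Type) [Finite α], ∀ _ : Finite α, DHJ α := by
    intro α _
    refine Finite.induction_empty_option (P := fun α => ∀ _ : Finite α, DHJ α) ?_ ?_ ?_ α
    · intro α α' e ih hf δ hδ
      haveI : Finite α := Finite.of_equiv _ e.symm
      obtain ⟨ι, hι, hd⟩ := ih this δ hδ
      refine ⟨ι, hι, fun A hA => ?_⟩
      unfold dens at hA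
      rw [← avg_equiv ((Equiv.refl ι).arrowCongr e)] at hA
      obtain ⟨l, hl⟩ := hd {s | (Equiv.refl ι).arrowCongr e s ∈ A} hA
      refine ⟨l.map e, fun x => ?_⟩
      obtain ⟨y, rfl⟩ := e.surjective x
      rw [Line.map_apply]
      exact hl y
    · intro hf δ hδ
      exact ⟨Unit, inferInstance, fun A hA => ⟨default, fun x => x.elim⟩⟩
    · intro β _ ih hf δ hδ
      by_cases hn : Nonempty β
      · exact dhj_option (ih inferInstance) δ hδ
      · rw [not_nonempty_iff] at hn
        refine ⟨Unit, inferInstance, fun A hA => ⟨Line.diagonal _ _, fun x => ?_⟩⟩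
        obtain ⟨a, ha⟩ := dens_nonempty (lt_of_lt_of_le hδ hA)
        convert ha
        funext j
        exact Subsingleton.elim _ _
  exact key α inferInstance

end

end RMR

namespace RMR

open Combinatorics

lemma exists_line_pos {X : Type*} [MeasurableSpace X] (μ : Measure X) [IsProbabilityMeasure μ]
    {α ι : Type} [Finite α] [Finite ι] [Nonempty α] (δ : ℝ) (hDL : DL α ι δ)
    (τ : (ι → α) → X → X) (hτ : ∀ w, MeasurePreserving (τ w) μ μ)
    (A : Set X) (hA : MeasurableSet A) (hδ : δ < μ.real A) :
    ∃ l : Line α ι, μ (⋂ a, τ (l a) ⁻¹' A) ≠ 0 := by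
  by_contra! hno
  have hae : ∀ᵐ x ∂μ, ∀ l : Line α ι, x ∉ ⋂ a, τ (l a) ⁻¹' A :=
    ae_all_iff.2 fun l => measure_eq_zero_iff_ae_notMem.1 (hno l)
  let _ : Fintype (ι → α) := Fintype.ofFinite _
  have hK : (0 : ℝ) < (Fintype.card (ι → α) : ℝ) := by exact_mod_cast Fintype.card_pos
  have hle : ∀ᵐ x ∂μ, (∑ w, (τ w ⁻¹' A).indicator (fun _ => (1 : ℝ)) x) ≤
      δ * (Fintype.card (ι → α) : ℝ) := by
    filter_upwards [hae] with x hx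
    have hd : dens {w | τ w x ∈ A} < δ := by
      by_contra! hge
      obtain ⟨l, hl⟩ := hDL _ hge
      exact hx l (Set.mem_iInter.2 fun a => hl a)
    unfold dens at hd
    rw [avg_eq, div_lt_iff₀ hK] at hd
    refine le_trans (le_of_eq ?_) hd.le
    refine Finset.sum_congr rfl fun w _ => ?_
    by_cases h : τ w x ∈ A
    · rw [ind_true (show w ∈ {w | τ w x ∈ A} from h), Set.indicator_of_mem (show x ∈ τ w ⁻¹' A from h)]
    · rw [ind_false (show ¬ w ∈ {w | τ w x ∈ A} from h),
        Set.indicator_of_notMem (show x ∉ τ w ⁻¹' A from h)]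
  have hms : ∀ w, MeasurableSet (τ w ⁻¹' A) := fun w => (hτ w).measurable hA
  have hintg : ∀ w, Integrable ((τ w ⁻¹' A).indicator (fun _ => (1 : ℝ))) μ := fun w =>
    (integrable_const _).indicator (hms w)
  have h1 := integral_mono_ae (integrable_finsetSum Finset.univ fun w _ => hintg w)
    (integrable_const (μ := μ) (δ * (Fintype.card (ι → α) : ℝ))) hle
  rw [integral_finsetSum _ fun w _ => hintg w, integral_const] at h1
  have h2 : ∀ w, ∫ x, (τ w ⁻¹' A).indicator (fun _ => (1 : ℝ)) x ∂μ = μ.real A := by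
    intro w
    rw [integral_indicator_const _ (hms w), smul_eq_mul, mul_one, measureReal_def,
      (hτ w).measure_preimage hA.nullMeasurableSet, ← measureReal_def]
  simp only [h2, Finset.sum_const, Finset.card_univ, nsmul_eq_mul, probReal_univ, one_smul] at h1
  rw [mul_comm] at h1
  have := le_of_mul_le_mul_right h1 hK
  linarith

lemma end_pow {X : Type*} (f : Function.End X) (n : ℕ) : ((f ^ n : Function.End X) : X → X) = f^[n] := by
  induction n with
  | zero => rfl
  | succ n ih =>
    have h : ((f ^ (n + 1) : Function.End X) : X → X) =
      ((f ^ n : Function.End X) : X → X) ∘ (f : X → X) := by rw [pow_succ]; rfl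
    rw [h, ih]
    rfl

/-- Multiple recurrence for finitely many commuting maps, with bounded exponent. -/
lemma recur {X : Type*} [MeasurableSpace X] (μ : Measure X) [IsProbabilityMeasure μ]
    (k : ℕ) {ι : Type} [Finite ι] (δ : ℝ) (hDL : DL (Option (Fin k)) ι δ)
    (S : Fin k → X → X) (hS : ∀ j, MeasurePreserving (S j) μ μ)
    (hcomm : ∀ i j, S i ∘ S j = S j ∘ S i)
    (A : Set X) (hA : MeasurableSet A) (hδ : δ < μ.real A) :
    ∃ q, 1 ≤ q ∧ q ≤ Nat.card ι ∧ 0 < μ (A ∩ ⋂ j, (S j)^[q] ⁻¹' A) := by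
  classical
  let _ : Fintype ι := Fintype.ofFinite _
  let S' : Fin k → Function.End X := S
  let M := Submonoid.closure (Set.range S')
  let _ : CommMonoid M := Submonoid.closureCommMonoidOfComm _ (by
    rintro _ ⟨i, rfl⟩ _ ⟨j, rfl⟩
    exact hcomm i j)
  have hM : ∀ m : M, MeasurePreserving ((m : Function.End X) : X → X) μ μ := by
    rintro ⟨m, hm⟩
    induction hm using Submonoid.closure_induction with
    | mem x h => obtain ⟨j, rfl⟩ := h; exact hS j
    | one => exact MeasurePreserving.id μ
    | mul x y hx hy h1 h2 => exact h1.comp h2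
  let g : Option (Fin k) → M := fun o => o.elim 1 fun j => ⟨S' j, Submonoid.subset_closure ⟨j, rfl⟩⟩
  obtain ⟨l, hl⟩ := exists_line_pos μ δ hDL (fun w => ((∏ i, g (w i) : M) : Function.End X))
    (fun w => hM _) A hA hδ
  let P : M := ∏ i, (l.idxFun i).elim 1 g
  let q := (Finset.univ.filter fun i => l.idxFun i = none).card
  have hfac : ∀ a, ∏ i, g (l a i) = g a ^ q * P := by
    intro a
    have h1 : ∀ i, g (l a i) = (if l.idxFun i = none then g a else 1) * (l.idxFun i).elim 1 g := by
      intro i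
      rw [Line.apply_def]
      cases h : l.idxFun i <;> simp [h]
    simp only [h1]
    rw [Finset.prod_mul_distrib, ← Finset.prod_filter, Finset.prod_const]
  refine ⟨q, ?_, ?_, ?_⟩
  · obtain ⟨i, hi⟩ := l.proper
    exact Finset.card_pos.2 ⟨i, by simp [hi]⟩
  · rw [Nat.card_eq_fintype_card]
    exact Finset.card_le_univ _
  · have hset : (⋂ a, ((∏ i, g (l a i) : M) : Function.End X) ⁻¹' A) =
        ((P : Function.End X) : X → X) ⁻¹' (A ∩ ⋂ j, (S j)^[q] ⁻¹' A) := by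
      ext x
      have key : ∀ a, ((∏ i, g (l a i) : M) : Function.End X) x =
          ((g a : Function.End X) : X → X)^[q] ((P : Function.End X) x) := by
        intro a
        rw [hfac a, ← end_pow]
        rfl
      have hL : (x ∈ ⋂ a, ((∏ i, g (l a i) : M) : Function.End X) ⁻¹' A) ↔
          ∀ a, ((g a : Function.End X) : X → X)^[q] ((P : Function.End X) x) ∈ A := by
        rw [Set.mem_iInter]
        exact forall_congr' fun a => by rw [← key a]; rfl
      have hR : (x ∈ ((P : Function.End X) : X → X) ⁻¹' (A ∩ ⋂ j, (S j)^[q] ⁻¹' A)) ↔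
          ((P : Function.End X) x ∈ A ∧ ∀ j, (S j)^[q] ((P : Function.End X) x) ∈ A) := by
        exact and_congr Iff.rfl Set.mem_iInter
      rw [hL, hR]
      have h0 : ∀ y : X, ((g none : Function.End X) : X → X)^[q] y = y := by
        intro y
        exact Function.iterate_fixed rfl q
      constructor
      · intro h
        refine ⟨?_, fun j => h (some j)⟩
        have := h none
        rwa [h0] at this
      · rintro ⟨h1, h2⟩ (_ | j)
        · rwa [h0]
        · exact h2 j
    have hmeas : MeasurableSet (A ∩ ⋂ j, (S j)^[q] ⁻¹' A) :=
      hA.inter (MeasurableSet.iInter fun j => ((hS j).iterate q).measurable hA)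
    rw [pos_iff_ne_zero, ← (hM P).measure_preimage hmeas.nullMeasurableSet, ← hset]
    exact hl

end RMR

/-- Multiple recurrence for rational systems along the negative indices: the finite set `F`
can be taken to consist of negative integers, with dominated exponents `1 ≤ q_t ≤ -t`;
the recurrence is then achieved at the nonzero rational `Σ_{t∈F} q_t·(-1)^{-t}/((-t+1)!)`,
which lies in the open interval `(e⁻¹ − 1, e⁻¹)`. -/
theorem rational_multiple_recurrence_interval {X : Type*} [MeasurableSpace X] (μ : Measure X)
    [IsProbabilityMeasure μ] (k : ℕ) (T : Fin k → ℤ → X → X)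
    (hmp : ∀ j, ∀ n ≠ 0, MeasurePreserving (T j n) μ μ)
    (hcomm : ∀ i j, ∀ m ≠ 0, ∀ n ≠ 0, T i m ∘ T j n = T j n ∘ T i m)
    (A : Set X) (hA : MeasurableSet A) (hA0 : 0 < μ A) :
    ∃ F : Finset ℤ, F.Nonempty ∧ (∀ t ∈ F, t < 0) ∧
      ∃ q : ℤ → ℕ, (∀ t ∈ F, 1 ≤ q t ∧ (q t : ℤ) ≤ -t) ∧
        (∑ t ∈ F, (q t : ℚ) * ratCoeff t) ≠ 0 ∧
        Real.exp (-1) - 1 < ((∑ t ∈ F, (q t : ℚ) * ratCoeff t : ℚ) : ℝ) ∧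
        ((∑ t ∈ F, (q t : ℚ) * ratCoeff t : ℚ) : ℝ) < Real.exp (-1) ∧
        0 < μ (A ∩ ⋂ j : Fin k, ratTrans (T j) q F ⁻¹' A) := by
  classical
  have hAr : 0 < μ.real A := by
    rw [measureReal_def]
    exact ENNReal.toReal_pos hA0.ne' (measure_ne_top _ _)
  obtain ⟨ι, hι, hDL⟩ := RMR.dhj_all (Option (Fin k)) (μ.real A / 2) (by positivity)
  obtain ⟨N, hN⟩ : ∃ N, N = 2 * Nat.card ι + 1 := ⟨_, rfl⟩
  have ht0 : (-(N : ℤ)) ≠ 0 := by omega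
  obtain ⟨q, hq1, hq2, hq⟩ := RMR.recur μ k (μ.real A / 2) hDL (fun j => T j (-(N : ℤ)))
    (fun j => hmp j _ ht0) (fun i j => hcomm i j _ ht0 _ ht0) A hA (by linarith)
  have hsum : ∑ t ∈ {(-(N : ℤ))}, (((fun _ => q) t : ℕ) : ℚ) * ratCoeff t =
      -((q : ℚ) / ((N + 1).factorial : ℚ)) := by
    have hlt : (-(N : ℤ)) < 0 := by omega
    have hodd : (-1 : ℚ) ^ N = -1 := Odd.neg_one_pow ⟨_, hN⟩
    rw [Finset.sum_singleton, ratCoeff, if_pos hlt, neg_neg, Int.toNat_natCast, hodd]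
    ring
  have hfpos : (0 : ℚ) < ((N + 1).factorial : ℚ) := by exact_mod_cast Nat.factorial_pos _
  have hqpos : (0 : ℚ) < q := by exact_mod_cast hq1
  have hpos : (0 : ℚ) < (q : ℚ) / ((N + 1).factorial : ℚ) := div_pos hqpos hfpos
  have hhalf : (q : ℚ) / ((N + 1).factorial : ℚ) ≤ 1 / 2 := by
    rw [div_le_div_iff₀ hfpos (by norm_num)]
    have h1 : q * 2 ≤ (N + 1).factorial := by
      have := Nat.self_le_factorial (N + 1)
      omega
    have h2 : (q : ℚ) * 2 ≤ ((N + 1).factorial : ℚ) := by exact_mod_cast h1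
    linarith
  have hexp : Real.exp (-1) < 1 / 2 := by
    rw [Real.exp_neg, one_div]
    apply inv_strictAnti₀ (by norm_num)
    have := Real.exp_one_gt_d9
    linarith
  refine ⟨{(-(N : ℤ))}, Finset.singleton_nonempty _, ?_, fun _ => q, ?_, ?_, ?_, ?_, ?_⟩
  · intro t ht
    rw [Finset.mem_singleton] at ht
    omega
  · intro t ht
    rw [Finset.mem_singleton] at ht
    subst ht
    exact ⟨hq1, show (q : ℤ) ≤ _ by omega⟩
  · rw [hsum]
    exact (neg_lt_zero.2 hpos).ne
  · rw [hsum]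
    have h : ((-(1 / 2) : ℚ) : ℝ) ≤ ((-((q : ℚ) / ((N + 1).factorial : ℚ)) : ℚ) : ℝ) :=
      Rat.cast_le.2 (neg_le_neg hhalf)
    have h' : ((-(1 / 2) : ℚ) : ℝ) = -(1 / 2) := by norm_num
    rw [h'] at h
    linarith
  · rw [hsum]
    have h : ((-((q : ℚ) / ((N + 1).factorial : ℚ)) : ℚ) : ℝ) < ((0 : ℚ) : ℝ) :=
      Rat.cast_lt.2 (neg_lt_zero.2 hpos)
    rw [Rat.cast_zero] at h
    exact h.trans (Real.exp_pos _)
  · have hr : ∀ j, ratTrans (T j) (fun _ => q) {(-(N : ℤ))} = (T j (-(N : ℤ)))^[q] := by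
      intro j
      simp [ratTrans]
    simp only [hr]
    exact hq
end

section
/- Let ℱ = (F_n)_{n∈ℕ} be a left Følner sequence of nonempty finite subsets of ℚ (under addition), and let A ⊆ ℚ with d̄_ℱ(A) > 0. Then for each k ∈ ℕ there exists a nonzero rational number q such that d̄_ℱ(A ∩ (−q + A) ∩ (−2q + A) ∩ … ∩ (−kq + A)) > 0. -/
open scoped symmDiff

/-- `(F_n)` is a left Følner sequence of nonempty finite subsets of `ℚ`. -/
def IsLeftFolner (F : ℕ → Finset ℚ) : Prop :=
  (∀ n, (F n).Nonempty) ∧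
    ∀ s : ℚ, Filter.Tendsto
      (fun n => ((((F n).image (s + ·)) ∆ (F n)).card : ℝ) / (F n).card)
      Filter.atTop (nhds 0)

/-- The upper density `d̄_ℱ(A) = limsup_n |A ∩ F_n| / |F_n|`. -/
noncomputable def upperDensity (F : ℕ → Finset ℚ) (A : Set ℚ) : ℝ :=
  Filter.limsup (fun n => (Set.ncard (A ∩ ↑(F n)) : ℝ) / (F n).card) Filter.atTop


namespace DHJ

/-- Indicator of a proposition as a real number. -/
noncomputable def ind (p : Prop) : ℝ := by
  classical exact if p then 1 else 0

theorem ind_true {p : Prop} (h : p) : ind p = 1 := by simp [ind, h]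
theorem ind_false {p : Prop} (h : ¬ p) : ind p = 0 := by simp [ind, h]
theorem ind_nonneg (p : Prop) : 0 ≤ ind p := by unfold ind; split_ifs <;> norm_num
theorem ind_le_one (p : Prop) : ind p ≤ 1 := by unfold ind; split_ifs <;> norm_num
theorem ind_mono {p q : Prop} (h : p → q) : ind p ≤ ind q := by
  by_cases hp : p
  · rw [ind_true hp, ind_true (h hp)]
  · rw [ind_false hp]; exact ind_nonneg q
theorem ind_congr {p q : Prop} (h : p ↔ q) : ind p = ind q := by
  rw [propext h]
theorem ind_not (p : Prop) : ind (¬ p) = 1 - ind p := by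
  by_cases hp : p <;> simp [ind, hp]
theorem ind_and (p q : Prop) : ind (p ∧ q) = ind p * ind q := by
  by_cases hp : p <;> by_cases hq : q <;> simp [ind, hp, hq]

/-- Sum over a finite type, independent of the choice of `Fintype` instance. -/
noncomputable def tsm {X : Type*} [Finite X] (f : X → ℝ) : ℝ :=
  letI := Fintype.ofFinite X
  ∑ x, f x

/-- Average over a finite type. -/
noncomputable def avg {X : Type*} [Finite X] (f : X → ℝ) : ℝ := tsm f / Nat.card X

theorem tsm_eq {X : Type*} [Finite X] [i : Fintype X] (f : X → ℝ) : tsm f = ∑ x, f x := by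
  unfold tsm
  congr!

section
variable {X Y : Type*} [Finite X] [Finite Y]

theorem avg_eq [Fintype X] (f : X → ℝ) : avg f = (∑ x, f x) / Fintype.card X := by
  rw [avg, tsm_eq, Nat.card_eq_fintype_card]

theorem avg_mono {f g : X → ℝ} (h : ∀ x, f x ≤ g x) : avg f ≤ avg g := by
  have := Fintype.ofFinite X
  rw [avg_eq, avg_eq]
  gcongr with x
  exact h x

theorem avg_congr {f g : X → ℝ} (h : ∀ x, f x = g x) : avg f = avg g := by
  rw [funext h]

theorem avg_nonneg {f : X → ℝ} (h : ∀ x, 0 ≤ f x) : 0 ≤ avg f := by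
  have := Fintype.ofFinite X
  rw [avg_eq]
  exact div_nonneg (Finset.sum_nonneg fun x _ => h x) (by positivity)

theorem avg_add (f g : X → ℝ) : avg (fun x => f x + g x) = avg f + avg g := by
  have := Fintype.ofFinite X
  simp only [avg_eq, Finset.sum_add_distrib, add_div]

theorem avg_sub (f g : X → ℝ) : avg (fun x => f x - g x) = avg f - avg g := by
  have := Fintype.ofFinite X
  simp only [avg_eq, Finset.sum_sub_distrib, sub_div]

theorem avg_mul_left (c : ℝ) (f : X → ℝ) : avg (fun x => c * f x) = c * avg f := by
  have := Fintype.ofFinite X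
  simp only [avg_eq, ← Finset.mul_sum, mul_div_assoc]

theorem avg_const [Nonempty X] (c : ℝ) : avg (fun _ : X => c) = c := by
  have := Fintype.ofFinite X
  rw [avg_eq]
  simp [Finset.sum_const, nsmul_eq_mul]

theorem avg_le_of_le [Nonempty X] {f : X → ℝ} {c : ℝ} (h : ∀ x, f x ≤ c) : avg f ≤ c := by
  rw [← avg_const (X := X) c]; exact avg_mono h

theorem le_avg_of_le [Nonempty X] {f : X → ℝ} {c : ℝ} (h : ∀ x, c ≤ f x) : c ≤ avg f := by
  rw [← avg_const (X := X) c]; exact avg_mono h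

theorem exists_le_avg [Nonempty X] (f : X → ℝ) : ∃ x, avg f ≤ f x := by
  by_contra! h
  have := Fintype.ofFinite X
  have h1 : ∑ x, f x < ∑ _x : X, avg f :=
    Finset.sum_lt_sum_of_nonempty Finset.univ_nonempty fun x _ => h x
  have h2 : (∑ _x : X, avg f) = ∑ x, f x := by
    rw [Finset.sum_const, avg_eq, nsmul_eq_mul, Finset.card_univ]
    field_simp
  linarith

theorem avg_equiv (e : X ≃ Y) (f : Y → ℝ) : avg (fun x => f (e x)) = avg f := by
  have := Fintype.ofFinite X
  have := Fintype.ofFinite Y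
  rw [avg_eq, avg_eq, Fintype.card_congr e, Equiv.sum_comp e f]

theorem avg_prod (f : X × Y → ℝ) : avg f = avg fun x => avg fun y => f (x, y) := by
  have := Fintype.ofFinite X
  have := Fintype.ofFinite Y
  simp only [avg_eq, Fintype.sum_prod_type, Fintype.card_prod, ← Finset.sum_div, Nat.cast_mul]
  rw [div_div, mul_comm]

theorem avg_comm (f : X → Y → ℝ) :
    (avg fun x => avg fun y => f x y) = avg fun y => avg fun x => f x y := by
  have h1 := avg_prod fun p : X × Y => f p.1 p.2
  have h2 := avg_prod fun p : Y × X => f p.2 p.1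
  rw [← h1, ← h2, ← avg_equiv (Equiv.prodComm X Y)]
  rfl

theorem avg_sum {Z : Type*} (s : Finset Z) (f : Z → X → ℝ) :
    (avg fun x => ∑ z ∈ s, f z x) = ∑ z ∈ s, avg (f z) := by
  have := Fintype.ofFinite X
  simp only [avg_eq]
  rw [Finset.sum_comm, Finset.sum_div]

theorem avg_split {ι κ α : Type*} [Finite ι] [Finite κ] [Finite α] (f : (ι ⊕ κ → α) → ℝ) :
    avg f = avg fun v : κ → α => avg fun u : ι → α => f (Sum.elim u v) := by
  rw [← avg_comm, ← avg_prod (fun p : (ι → α) × (κ → α) => f (Sum.elim p.1 p.2)),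
    ← avg_equiv (Equiv.sumArrowEquivProdArrow ι κ α).symm]
  rfl

/-- Markov type inequality. -/
theorem avg_markov [Nonempty X] {f : X → ℝ} (h1 : ∀ x, f x ≤ 1) (c : ℝ) (hc : 0 ≤ c) :
    avg f ≤ (avg fun x => ind (c ≤ f x)) + c := by
  rw [← avg_const (X := X) c, ← avg_add, avg_const]
  refine avg_mono fun x => ?_
  by_cases hx : c ≤ f x
  · rw [ind_true hx]; linarith [h1 x]
  · rw [ind_false hx]; linarith

/-- Pigeonhole. -/
theorem avg_pigeon {Z : Type*} [Finite Z] [Nonempty Z] (p : X → Prop) (P : X → Z → Prop)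
    (h : ∀ x, p x → ∃ z, P x z) :
    ∃ z, (avg fun x => ind (p x)) / Nat.card Z ≤ avg fun x => ind (P x z) := by
  have := Fintype.ofFinite Z
  have h1 : (avg fun x => ind (p x)) ≤ avg fun x => ∑ z : Z, ind (P x z) := by
    refine avg_mono fun x => ?_
    by_cases hx : p x
    · obtain ⟨z, hz⟩ := h x hx
      rw [ind_true hx, ← ind_true hz]
      exact Finset.single_le_sum (f := fun z => ind (P x z)) (fun i _ => ind_nonneg _)
        (Finset.mem_univ z)
    · rw [ind_false hx]
      exact Finset.sum_nonneg fun i _ => ind_nonneg _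
  rw [avg_sum] at h1
  obtain ⟨z, hz⟩ := exists_le_avg fun z => avg fun x => ind (P x z)
  refine ⟨z, le_trans ?_ hz⟩
  rw [avg_eq (X := Z), Nat.card_eq_fintype_card]
  gcongr

end

/-- Word of a subspace applied to a point. -/
def app {ι α η : Type*} (w : ι → α ⊕ η) (z : η → α) : ι → α := fun i => Sum.elim id z (w i)

/-- Properness of a subspace word. -/
def Proper {ι α η : Type*} (w : ι → α ⊕ η) : Prop := ∀ e, ∃ i, w i = Sum.inr e

/-- Word of a subspace over `α` applied to a point over `Option α`. -/
def appO {ι α η : Type*} (w : ι → α ⊕ η) (z : η → Option α) : ι → Option α :=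
  fun i => Sum.elim some z (w i)

/-- Filling the wildcards of a line. -/
def fill {ι α : Type*} (t : ι → Option α) (a : α) : ι → α := fun i => (t i).getD a

theorem app_injective {ι α η : Type*} {w : ι → α ⊕ η} (hw : Proper w) :
    Function.Injective (app w) := by
  intro z z' h
  funext e
  obtain ⟨i, hi⟩ := hw e
  have := congrFun h i
  simpa [app, hi] using this

/-- Composition of subspaces. -/
def comp {ι α η ζ : Type*} (w : ι → α ⊕ η) (v : η → α ⊕ ζ) : ι → α ⊕ ζ :=
  fun i => Sum.elim Sum.inl v (w i)

theorem app_comp {ι α η ζ : Type*} (w : ι → α ⊕ η) (v : η → α ⊕ ζ) (z : ζ → α) :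
    app (comp w v) z = app w (app v z) := by
  funext i
  unfold app comp
  cases w i <;> rfl

theorem proper_comp {ι α η ζ : Type*} {w : ι → α ⊕ η} {v : η → α ⊕ ζ} (hw : Proper w)
    (hv : Proper v) : Proper (comp w v) := by
  intro e
  obtain ⟨j, hj⟩ := hv e
  obtain ⟨i, hi⟩ := hw j
  exact ⟨i, by simp [comp, hi, hj]⟩

theorem app_some {ι α η : Type*} (w : ι → α ⊕ η) (z : η → Option α) :
    app (fun i => (w i).map some id) z = appO w z := by
  funext i
  cases h : w i <;> simp [app, appO, h]

theorem proper_some {ι α η : Type*} {w : ι → α ⊕ η} (hw : Proper w) :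
    Proper (fun i => ((w i).map some id : Option α ⊕ η)) := by
  intro e
  obtain ⟨i, hi⟩ := hw e
  exact ⟨i, by simp [hi]⟩

end DHJ

namespace DHJ
open Combinatorics

/-- Make colours depend only on the set of wildcards. -/
theorem insens_exists (α : Type) [Finite α] (η : Type) [Finite η] :
    ∀ (κ : Type) [Finite κ], ∃ (ι : Type) (_ : Finite ι), ∀ c : (ι → Option α) → κ,
      ∃ w : ι → α ⊕ η, Proper w ∧ ∀ z z' : η → Option α, (∀ i, z i = none ↔ z' i = none) →
        c (appO w z) = c (appO w z') := by
  induction η using Finite.induction_empty_option with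
  | of_equiv e ih =>
    intro κ _
    obtain ⟨ι, hι, h⟩ := ih κ
    refine ⟨ι, hι, fun c => ?_⟩
    obtain ⟨w, hw, hc⟩ := h c
    have key : ∀ z, appO (fun i => (w i).map id e) z = appO w (fun i => z (e i)) := by
      intro z; funext i
      cases h : w i <;> simp [appO, h]
    refine ⟨fun i => (w i).map id e, ?_, ?_⟩
    · intro x
      obtain ⟨i, hi⟩ := hw (e.symm x)
      exact ⟨i, by simp [hi]⟩
    · intro z z' hz
      rw [key, key]
      exact hc _ _ fun i => hz _
  | h_empty =>
    intro κ _
    refine ⟨Empty, inferInstance, fun c => ⟨fun i => i.elim, fun e => e.elim, fun z z' _ => ?_⟩⟩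
    congr 1
    funext i
    exact i.elim
  | h_option ih =>
    rename_i η _
    intro κ _
    obtain ⟨ι', hι', h'⟩ := ih (Option α → κ)
    obtain ⟨X, hX, hl⟩ := Line.exists_mono_in_high_dimension α ((ι' → Option α) → κ)
    refine ⟨X ⊕ ι', inferInstance, fun c => ?_⟩
    obtain ⟨l, col, hcol⟩ := hl fun u v => c (Sum.elim (fun i => some (u i)) v)
    let L : Option α → X → Option α := fun o i => (l.idxFun i).elim o some
    obtain ⟨w', hw', hc'⟩ := h' fun v o => c (Sum.elim (L o) v)
    let w : X ⊕ ι' → α ⊕ Option η :=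
      Sum.elim (fun i => (l.idxFun i).elim (Sum.inr none) Sum.inl)
        (fun i => (w' i).map id some)
    have key : ∀ z, appO w z = Sum.elim (L (z none)) (appO w' fun i => z (some i)) := by
      intro z; funext i
      rcases i with i | i
      · cases h : l.idxFun i <;> simp [appO, w, L, h]
      · cases h : w' i <;> simp [appO, w, h]
    have hL : ∀ a v, c (Sum.elim (L (some a)) v) = col v := by
      intro a v
      rw [← hcol a]
      congr 2
      funext i
      cases h : l.idxFun i <;> simp [L, h]
    refine ⟨w, ?_, ?_⟩
    · rintro (_ | e)
      · obtain ⟨i, hi⟩ := l.proper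
        exact ⟨Sum.inl i, by simp [w, hi]⟩
      · obtain ⟨i, hi⟩ := hw' e
        exact ⟨Sum.inr i, by simp [w, hi]⟩
    · intro z z' hz
      rw [key, key]
      have h1 := congrFun (hc' (fun i => z (some i)) (fun i => z' (some i)) fun i => hz _) (z none)
      refine h1.trans ?_
      have h0 := hz none
      rcases hzn : z none with _ | a <;> rcases hzn' : z' none with _ | b
      · rfl
      · simp [hzn, hzn'] at h0
      · simp [hzn, hzn'] at h0
      · simp only [hL]

/-- Disjoint nonempty blocks such that the colour of a union depends only on the first block. -/
theorem fu_exists (κ : Type) [Finite κ] (n : ℕ) :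
    ∃ (ι : Type) (_ : Finite ι), ∀ f : (ι → Bool) → κ,
      ∃ (s : ι → Option (Fin n)) (col : Fin n → κ), (∀ e, ∃ x, s x = some e) ∧
        ∀ (z : Fin n → Bool) (i : Fin n), z i = true → (∀ j < i, z j = false) →
          f (fun x => (s x).elim false z) = col i := by
  induction n with
  | zero =>
    exact ⟨Empty, inferInstance, fun f => ⟨fun x => x.elim, fun x => x.elim0, fun x => x.elim0,
      fun z i => i.elim0⟩⟩
  | succ n ih =>
    obtain ⟨ι', hι', h'⟩ := ih
    obtain ⟨N, hN, hU⟩ := Subspace.exists_mono_in_high_dimension Bool κ ι'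
    refine ⟨Option N, inferInstance, fun f => ?_⟩
    obtain ⟨U, c0, hc0⟩ := hU fun v => f (fun x => x.elim true v)
    obtain ⟨s', col', hs', hcol'⟩ := h' fun y => f (fun x => x.elim false
      fun i => (U.idxFun i).elim (fun _ => false) y)
    let s : Option N → Option (Fin (n + 1)) := fun x => x.elim (some 0) fun i =>
      (U.idxFun i).elim (fun b => if b then some 0 else none) fun e => (s' e).map Fin.succ
    refine ⟨s, Fin.cons c0 col', ?_, ?_⟩
    · intro e
      refine Fin.cases ⟨none, rfl⟩ (fun e => ?_) e
      obtain ⟨x, hx⟩ := hs' e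
      obtain ⟨i, hi⟩ := U.proper x
      exact ⟨some i, by simp [s, hi, hx]⟩
    · intro z i hi hlt
      cases hz0 : z 0 with
      | true =>
        have : i = 0 := by
          by_contra h
          have := hlt 0 (Fin.pos_of_ne_zero h)
          simp [hz0] at this
        subst this
        simp only [Fin.cons_zero]
        rw [← hc0 fun e => (s' e).elim false fun j => z j.succ]
        congr 1
        funext x
        rcases x with _ | x
        · simp [s, hz0]
        · rcases h : U.idxFun x with b | e
          · cases b <;> simp [s, h, hz0, Subspace.coe_apply]
          · cases h2 : s' e <;> simp [s, h, h2, Subspace.coe_apply]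
      | false =>
        have hi0 : i ≠ 0 := by rintro rfl; simp [hz0] at hi
        obtain ⟨j, rfl⟩ := Fin.exists_succ_eq.2 hi0
        simp only [Fin.cons_succ]
        rw [← hcol' (fun j => z j.succ) j hi fun j' hj' => hlt _ (Fin.succ_lt_succ_iff.2 hj')]
        congr 1
        funext x
        rcases x with _ | x
        · simp [s, hz0]
        · rcases h : U.idxFun x with b | e
          · cases b <;> simp [s, h, hz0]
          · cases h2 : s' e <;> simp [s, h, h2]

/-- Finite unions theorem for two colours. -/
theorem fu_mono (μ : Type) [Finite μ] :
    ∃ (ι : Type) (_ : Finite ι), ∀ f : (ι → Bool) → Bool,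
      ∃ (s : ι → Option μ) (col : Bool), (∀ e, ∃ x, s x = some e) ∧
        ∀ z : μ → Bool, (∃ i, z i = true) → f (fun x => (s x).elim false z) = col := by
  classical
  have := Fintype.ofFinite μ
  obtain ⟨ι, hι, h⟩ := fu_exists Bool (2 * Fintype.card μ)
  refine ⟨ι, hι, fun f => ?_⟩
  obtain ⟨s, col, hs, hcol⟩ := h f
  obtain ⟨c, hc⟩ : ∃ c, Fintype.card μ ≤ (Finset.univ.filter fun i => col i = c).card := by
    by_contra! hcon
    have h1 := hcon true
    have h2 := hcon false
    have h3 := Finset.card_filter_add_card_filter_not (s := (Finset.univ : Finset (Fin (2 * Fintype.card μ))))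
      (fun i => col i = true)
    simp only [Bool.not_eq_true, Finset.card_univ, Fintype.card_fin] at h3
    omega
  obtain ⟨g⟩ : Nonempty (μ ↪ {i // col i = c}) := by
    rw [Function.Embedding.nonempty_iff_card_le, Fintype.card_subtype]
    exact hc
  let g' : Fin (2 * Fintype.card μ) → Option μ := fun i =>
    if h : ∃ m, (g m : Fin _) = i then some h.choose else none
  have hg' : ∀ m, g' (g m) = some m := by
    intro m
    have hex : ∃ m', (g m' : Fin (2 * Fintype.card μ)) = g m := ⟨m, rfl⟩
    simp only [g', dif_pos hex]
    congr 1
    exact g.injective (Subtype.ext hex.choose_spec)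
  have hg2 : ∀ i m, g' i = some m → (g m : Fin _) = i := by
    intro i m him
    simp only [g'] at him
    split_ifs at him with hex
    have := hex.choose_spec
    simp only [Option.some.injEq] at him
    rwa [him] at this
  refine ⟨fun x => (s x).bind g', c, ?_, ?_⟩
  · intro e
    obtain ⟨x, hx⟩ := hs (g e)
    exact ⟨x, by simp [hx, hg']⟩
  · rintro z ⟨m, hm⟩
    let Z : Fin (2 * Fintype.card μ) → Bool := fun i => (g' i).elim false z
    have hne : (Finset.univ.filter fun i => Z i = true).Nonempty :=
      ⟨g m, by simp [Z, hg', hm]⟩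
    set i := (Finset.univ.filter fun i => Z i = true).min' hne with hi
    have hiZ : Z i = true := by
      have := Finset.min'_mem _ hne
      rw [← hi] at this
      simpa using this
    have hcoli : col i = c := by
      rcases hgi : g' i with _ | m'
      · simp [Z, hgi] at hiZ
      · rw [← hg2 i m' hgi]; exact (g m').2
    rw [← hcoli, ← hcol Z i hiZ]
    · congr 1
      funext x
      cases h : s x <;> simp [Z, h]
    · intro j hj
      by_contra hcon
      have := Finset.min'_le (Finset.univ.filter fun i => Z i = true) j (by simpa using hcon)
      rw [← hi] at this
      exact absurd hj (not_lt.2 this)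

/-- The Graham-Rothschild theorem for lines and two colours. -/
theorem graham_rothschild (α : Type) [Finite α] [Nonempty α] (μ : Type) [Finite μ] :
    ∃ (ι : Type) (_ : Finite ι), ∀ c : (ι → Option α) → Prop,
      ∃ w : ι → α ⊕ μ, Proper w ∧ ∀ z z' : μ → Option α, (∃ i, z i = none) → (∃ i, z' i = none) →
        (c (appO w z) ↔ c (appO w z')) := by
  classical
  obtain ⟨ι₂, hι₂, hfu⟩ := fu_mono μ
  obtain ⟨ι, hι, hins⟩ := insens_exists α ι₂ Bool
  let a0 : α := Classical.arbitrary α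
  refine ⟨ι, hι, fun c => ?_⟩
  obtain ⟨v, hv, hvc⟩ := hins fun x => decide (c x)
  obtain ⟨s, col, hs, hcol⟩ := hfu fun b =>
    decide (c (appO v fun i => if b i then none else some a0))
  let w' : ι₂ → α ⊕ μ := fun e => (s e).elim (Sum.inl a0) Sum.inr
  have hmain : ∀ z : μ → Option α, (∃ i, z i = none) → decide (c (appO (comp v w') z)) = col := by
    rintro z ⟨i, hi⟩
    rw [← hcol (fun m => decide (z m = none)) ⟨i, by simp [hi]⟩]
    have h1 : appO (comp v w') z = appO v (appO w' z) := by
      funext i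
      cases h : v i <;> simp [appO, comp, h]
    rw [h1]
    refine hvc _ _ fun e => ?_
    cases h : s e <;> simp [appO, w', h]
  refine ⟨comp v w', proper_comp hv ?_, fun z z' hz hz' => ?_⟩
  · intro e
    obtain ⟨x, hx⟩ := hs e
    exact ⟨x, by simp [w', hx]⟩
  · have h1 := hmain z hz
    rw [← hmain z' hz'] at h1
    simpa using h1

end DHJ

namespace DHJ

/-- The density Hales-Jewett property of an alphabet. -/
def DHJProp (α : Type) [Finite α] : Prop :=
  ∀ δ : ℝ, 0 < δ → ∃ m : ℕ, ∀ A : Set (Fin m → α), δ ≤ avg (fun x => ind (x ∈ A)) →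
    ∃ t : Fin m → Option α, (∃ i, t i = none) ∧ ∀ a, fill t a ∈ A

theorem exists_split (ι : Type) [Finite ι] (m n : ℕ) (h : m + n ≤ Nat.card ι) :
    ∃ r : ℕ, n ≤ r ∧ Nonempty (ι ≃ Fin m ⊕ Fin r) := by
  refine ⟨Nat.card ι - m, by omega, ?_⟩
  have := Fintype.ofFinite ι
  rw [← Fintype.card_eq]
  simp only [Fintype.card_sum, Fintype.card_fin, Nat.card_eq_fintype_card] at h ⊢
  omega

theorem multi_dhj {α : Type} [Finite α] [Nonempty α] (hα : DHJProp α) (n : ℕ) :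
    ∀ δ : ℝ, 0 < δ → ∃ m : ℕ, ∀ (ι : Type) [Finite ι], m ≤ Nat.card ι → ∀ A : Set (ι → α),
      δ ≤ avg (fun x => ind (x ∈ A)) → ∃ w : ι → α ⊕ Fin n, Proper w ∧ ∀ z, app w z ∈ A := by
  induction n with
  | zero =>
    intro δ hδ
    refine ⟨0, fun ι _ _ A hA => ?_⟩
    obtain ⟨x, hx⟩ := exists_le_avg fun x => ind (x ∈ A)
    have hxA : x ∈ A := by
      by_contra h
      have h0 : ind (x ∈ A) = 0 := ind_false h
      linarith
    exact ⟨fun i => Sum.inl (x i), fun e => e.elim0, fun z => hxA⟩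
  | succ n ih =>
    intro δ hδ
    obtain ⟨m, hm⟩ := hα (δ / 2) (by positivity)
    have hL : (0 : ℝ) < Nat.card (Fin m → Option α) := by
      exact_mod_cast Nat.card_pos
    obtain ⟨m', hm'⟩ := ih ((δ / 2) / Nat.card (Fin m → Option α)) (by positivity)
    refine ⟨m + m', fun ι _ hι A hA => ?_⟩
    obtain ⟨r, hr, ⟨e⟩⟩ := exists_split ι m m' hι
    have hA2 : δ ≤ avg fun x : Fin m ⊕ Fin r → α => ind ((fun i => x (e i)) ∈ A) := by
      rw [← avg_equiv (e.arrowCongr (Equiv.refl α)).symm] at hA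
      exact hA
    rw [avg_split] at hA2
    have h1 := avg_markov (f := fun v : Fin r → α => avg fun u : Fin m → α =>
      ind ((fun i => Sum.elim u v (e i)) ∈ A)) (fun v => avg_le_of_le fun u => ind_le_one _)
      (δ / 2) (by positivity)
    obtain ⟨t, ht⟩ := avg_pigeon
      (fun v : Fin r → α => δ / 2 ≤ avg fun u : Fin m → α =>
        ind ((fun i => Sum.elim u v (e i)) ∈ A))
      (fun v (t : Fin m → Option α) => (∃ i, t i = none) ∧
        ∀ a, (fun i => Sum.elim (fill t a) v (e i)) ∈ A)
      (fun v hv => hm {u | (fun i => Sum.elim u v (e i)) ∈ A} hv)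
    obtain ⟨w', hw', hB⟩ := hm' (Fin r) (by simpa using hr)
      {v | (∃ i, t i = none) ∧ ∀ a, (fun i => Sum.elim (fill t a) v (e i)) ∈ A} (by
        refine le_trans ?_ ht
        gcongr
        linarith)
    let w : Fin m ⊕ Fin r → α ⊕ Fin (n + 1) :=
      Sum.elim (fun i => (t i).elim (Sum.inr 0) Sum.inl) (fun i => (w' i).map id Fin.succ)
    have htp := (hB (Classical.arbitrary _)).1
    refine ⟨fun i => w (e i), ?_, ?_⟩
    · intro x
      refine Fin.cases ?_ (fun x => ?_) x
      · obtain ⟨i, hi⟩ := htp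
        exact ⟨e.symm (Sum.inl i), by simp [w, hi]⟩
      · obtain ⟨i, hi⟩ := hw' x
        exact ⟨e.symm (Sum.inr i), by simp [w, hi]⟩
    · intro z
      convert (hB fun i => z i.succ).2 (z 0) using 1
      funext i
      simp only [app]
      rcases e i with j | j
      · cases h : t j <;> simp [w, h, fill]
      · cases h : w' j <;> simp [w, h, app]

end DHJ

namespace DHJ

/-- Insensitivity with respect to exchanging `none` and `some a`. -/
def Insens {ι α : Type} (a : α) (D : (ι → Option α) → Prop) : Prop :=
  ∀ x y, (∀ i, (x i).getD a = (y i).getD a) → (D x ↔ D y)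

/-- Resampling the letters different from `none`. -/
def mix {ι α : Type} (x : ι → Option α) (y : ι → α) : ι → Option α :=
  fun i => (x i).map fun _ => y i

theorem avg_mix {ι α : Type} [Finite ι] [Finite α] [Nonempty α] (f : (ι → Option α) → ℝ) :
    (avg fun x => avg fun y : ι → α => f (mix x y)) = avg f := by
  let T : (ι → Option α) × (ι → α) → (ι → Option α) × (ι → α) := fun p =>
    (mix p.1 p.2, fun i => (p.1 i).getD (p.2 i))
  have hT : Function.Involutive T := by
    rintro ⟨x, y⟩
    refine Prod.ext ?_ ?_
    · funext i
      cases h : x i <;> simp [T, mix, h]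
    · funext i
      cases h : x i <;> simp [T, mix, h]
  have h1 : avg f = avg fun x => avg fun _ : ι → α => f x :=
    avg_congr fun x => (avg_const _).symm
  rw [h1, ← avg_prod fun p : (ι → Option α) × (ι → α) => f p.1, ← avg_equiv hT.toPerm,
    avg_prod]
  rfl

theorem avg_tail (α : Type) [Finite α] [Nonempty α] (m₂ : ℕ) (η : ℝ) (hη : 0 < η) :
    ∃ m : ℕ, (avg fun x : Fin m → Option α => ind (Nat.card {i // x i ≠ none} < m₂)) < η := by
  classical
  have := Fintype.ofFinite α
  set q : ℝ := (avg fun o : Option α => if o = none then (1 : ℝ) else 1 / 2) with hq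
  have hk : (0 : ℝ) < Fintype.card α := by exact_mod_cast Fintype.card_pos
  have hq0 : 0 ≤ q := avg_nonneg fun o => by split_ifs <;> norm_num
  have hq1 : q < 1 := by
    rw [hq, avg_eq, Fintype.sum_option]
    simp only [if_true, Fintype.card_option]
    have : ∑ x : α, (if (some x : Option α) = none then (1 : ℝ) else 1 / 2)
        = Fintype.card α * (1 / 2) := by
      simp
    rw [this, div_lt_one (by positivity)]
    push_cast
    linarith
  obtain ⟨m, hm⟩ := exists_pow_lt_of_lt_one (show 0 < η / 2 ^ m₂ by positivity) hq1
  refine ⟨m, ?_⟩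
  have hprod : (avg fun x : Fin m → Option α => ∏ i, if x i = none then (1 : ℝ) else 1 / 2)
      = q ^ m := by
    have h1 := Finset.sum_prod_piFinset (ι := Fin m) (Finset.univ : Finset (Option α))
      (fun _ o => if o = none then (1 : ℝ) else 1 / 2)
    rw [Fintype.piFinset_univ] at h1
    rw [avg_eq, h1, hq, avg_eq]
    simp only [Finset.prod_const, Finset.card_univ, Fintype.card_fin, Fintype.card_pi,
      Nat.cast_pow, div_pow]
  have hpt : ∀ x : Fin m → Option α, ind (Nat.card {i // x i ≠ none} < m₂) ≤
      2 ^ m₂ * ∏ i, if x i = none then (1 : ℝ) else 1 / 2 := by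
    intro x
    by_cases hx : Nat.card {i // x i ≠ none} < m₂
    · rw [ind_true hx, Finset.prod_ite]
      simp only [Finset.prod_const_one, Finset.prod_const, one_mul]
      rw [Nat.card_eq_fintype_card, Fintype.card_subtype] at hx
      have h3 : ((1 : ℝ) / 2) ^ m₂ ≤ (1 / 2) ^ (Finset.univ.filter fun i => ¬ x i = none).card :=
        pow_le_pow_of_le_one (by norm_num) (by norm_num) hx.le
      calc (1 : ℝ) = 2 ^ m₂ * (1 / 2) ^ m₂ := by rw [← mul_pow]; norm_num
        _ ≤ _ := by gcongr
    · rw [ind_false hx]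
      have : 0 ≤ ∏ i, if x i = none then (1 : ℝ) else 1 / 2 :=
        Finset.prod_nonneg fun i _ => by split_ifs <;> norm_num
      positivity
  calc _ ≤ avg fun x : Fin m → Option α => 2 ^ m₂ * ∏ i, if x i = none then (1 : ℝ) else 1 / 2 :=
        avg_mono hpt
    _ = 2 ^ m₂ * q ^ m := by rw [avg_mul_left, hprod]
    _ < 2 ^ m₂ * (η / 2 ^ m₂) := by gcongr
    _ = η := by field_simp

theorem block {α : Type} [Finite α] [Nonempty α] (hα : DHJProp α) (n : ℕ) (a : α) (η : ℝ)
    (hη : 0 < η) : ∃ m : ℕ, ∀ D : (Fin m → Option α) → Prop, Insens a D →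
      η ≤ avg (fun x => ind (D x)) → ∃ w : Fin m → Option α ⊕ Fin n, Proper w ∧
        ∀ z, D (app w z) := by
  classical
  obtain ⟨m₂, hm₂⟩ := multi_dhj hα n (η / 2) (by positivity)
  obtain ⟨m, hm⟩ := avg_tail α m₂ (η / 2) (by positivity)
  refine ⟨m, fun D hD hdens => ?_⟩
  obtain ⟨x, hx1, hx2⟩ : ∃ x : Fin m → Option α, m₂ ≤ Nat.card {i // x i ≠ none} ∧
      η / 2 ≤ avg fun y : Fin m → α => ind (D (mix x y)) := by
    by_contra! hcon
    rw [← avg_mix] at hdens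
    have h1 : (avg fun x => avg fun y : Fin m → α => ind (D (mix x y))) ≤
        avg fun x : Fin m → Option α => ind (Nat.card {i // x i ≠ none} < m₂) + η / 2 := by
      refine avg_mono fun x => ?_
      by_cases hx : Nat.card {i // x i ≠ none} < m₂
      · rw [ind_true hx]
        have : (avg fun y : Fin m → α => ind (D (mix x y))) ≤ 1 :=
          avg_le_of_le fun y => ind_le_one _
        linarith
      · have := hcon x (not_lt.1 hx)
        rw [ind_false hx]
        linarith
    rw [avg_add, avg_const] at h1
    linarith
  let e := (Equiv.sumCompl fun i => x i ≠ none).symm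
  rw [← avg_equiv (e.arrowCongr (Equiv.refl α)).symm, avg_split] at hx2
  obtain ⟨v, hv⟩ := exists_le_avg fun v : {i // ¬ x i ≠ none} → α =>
    avg fun u : {i // x i ≠ none} → α =>
      ind (D (mix x ((e.arrowCongr (Equiv.refl α)).symm (Sum.elim u v))))
  obtain ⟨w, hw, hwD⟩ := hm₂ {i // x i ≠ none} hx1
    {u | D (mix x ((e.arrowCongr (Equiv.refl α)).symm (Sum.elim u v)))} (hx2.trans hv)
  refine ⟨fun i => if h : x i ≠ none then (w ⟨i, h⟩).map some id else Sum.inl none, ?_, ?_⟩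
  · intro f
    obtain ⟨⟨i, hi⟩, hif⟩ := hw f
    exact ⟨i, by simp [hi, hif]⟩
  · intro z
    refine (hD _ _ fun i => ?_).1 (hwD fun j => (z j).getD a)
    by_cases h : x i = none
    · simp [mix, h, app]
    · obtain ⟨b, hb⟩ := Option.ne_none_iff_exists'.1 h
      have he : e i = Sum.inl ⟨i, h⟩ := by
        simp [e, h]
      cases hwi : w ⟨i, h⟩ <;> simp [mix, hb, app, Equiv.arrowCongr, he, hwi]

theorem avg_image {X Z : Type} [Finite X] [Finite Z] [Nonempty X] (g : Z → X)
    (hg : Function.Injective g) (h : X → ℝ) (η : ℝ) (hle : avg (fun z => h (g z)) ≤ η) [Nonempty Z] :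
    avg (fun x => h x * ind (∃ z, g z = x)) ≤ η * avg (fun x => ind (∃ z, g z = x)) := by
  classical
  have := Fintype.ofFinite X
  have := Fintype.ofFinite Z
  have key : ∀ h : X → ℝ, ∑ x, h x * ind (∃ z, g z = x) = ∑ z, h (g z) := by
    intro h
    rw [← Finset.sum_image (s := Finset.univ) (g := g) (f := h) (fun _ _ _ _ hh => hg hh)]
    rw [← Finset.sum_subset (Finset.subset_univ (Finset.univ.image g))]
    · refine Finset.sum_congr rfl fun x hx => ?_
      have : ∃ z, g z = x := by simpa using hx
      rw [ind_true this, mul_one]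
    · intro x _ hx
      have : ¬ ∃ z, g z = x := by simpa using hx
      rw [ind_false this, mul_zero]
  have h1 := key h
  have h2 := key fun _ => 1
  simp only [one_mul] at h2
  rw [avg_eq, avg_eq, h1, h2, ← mul_div_assoc]
  gcongr
  rw [avg_eq, div_le_iff₀ (by exact_mod_cast Fintype.card_pos)] at hle
  simpa using hle

theorem insens_one {α : Type} [Finite α] [Nonempty α] (hα : DHJProp α) (n : ℕ) (a : α) (η : ℝ)
    (hη : 0 < η) : ∃ M : ℕ, ∀ (ι : Type) [Finite ι], M ≤ Nat.card ι →
      ∀ h : (ι → Option α) → ℝ, (∀ x, h x ≤ 1) →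
        (∀ w : ι → Option α ⊕ Fin n, Proper w → avg (fun z => h (app w z)) ≤ η) →
        ∀ D, Insens a D → avg (fun x => h x * ind (D x)) ≤ 3 * η := by
  classical
  obtain ⟨m, hm⟩ := block hα n a η hη
  have hm2 : ∀ D : (Fin m → Option α) → Prop, ∃ w : Fin m → Option α ⊕ Fin n,
      (Insens a D ∧ η ≤ avg (fun x => ind (D x))) → Proper w ∧ ∀ z, D (app w z) := by
    intro D
    by_cases hD : Insens a D ∧ η ≤ avg (fun x => ind (D x))
    · obtain ⟨w, hw⟩ := hm D hD.1 hD.2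
      exact ⟨w, fun _ => hw⟩
    · exact ⟨fun _ => Sum.inl none, fun h => absurd h hD⟩
  choose W hW using hm2
  set ρ : ℝ := 1 / Nat.card (Fin m → Option α) with hρ
  have hN : (1 : ℝ) ≤ Nat.card (Fin m → Option α) := by
    exact_mod_cast Nat.card_pos
  have hρ0 : 0 < ρ := by positivity
  have hρ1 : ρ ≤ 1 := by rw [hρ, div_le_one (by positivity)]; exact hN
  have claim : ∀ t : ℕ, ∀ (ι : Type) [Finite ι], t * m ≤ Nat.card ι →
      ∀ h : (ι → Option α) → ℝ, (∀ x, h x ≤ 1) →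
        (∀ w : ι → Option α ⊕ Fin n, Proper w → avg (fun z => h (app w z)) ≤ η) →
        ∀ D, Insens a D → avg (fun x => h x * ind (D x)) ≤
          η * avg (fun x => ind (D x)) + η + (1 - ρ) ^ t * (avg (fun x => ind (D x)) - η) := by
    intro t
    induction t with
    | zero =>
      intro ι _ _ h h1 _ D _
      have h2 : avg (fun x => h x * ind (D x)) ≤ avg (fun x => ind (D x)) :=
        avg_mono fun x => by nlinarith [h1 x, ind_nonneg (D x)]
      have h3 : 0 ≤ avg (fun x => ind (D x)) := avg_nonneg fun x => ind_nonneg _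
      have h4 := mul_nonneg hη.le h3
      simp only [pow_zero, one_mul]
      linarith
    | succ t ih =>
      intro ι _ hcard h h1 hsub D hD
      obtain ⟨r, hr, ⟨e⟩⟩ := exists_split ι m (t * m) (by rw [Nat.succ_mul] at hcard; omega)
      let E : (Fin m → Option α) → (Fin r → Option α) → ι → Option α :=
        fun u v i => Sum.elim u v (e i)
      have hsplit : ∀ f : (ι → Option α) → ℝ, avg f = avg fun v => avg fun u => f (E u v) := by
        intro f
        rw [← avg_equiv (e.arrowCongr (Equiv.refl _)).symm, avg_split]
        rfl
      let G : (Fin r → Option α) → Prop := fun v => η ≤ avg fun u => ind (D (E u v))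
      let I : (Fin m → Option α) → (Fin r → Option α) → Prop := fun u v =>
        G v ∧ ∃ z, app (W fun u => D (E u v)) z = u
      have hins : ∀ v, Insens a fun u => D (E u v) := by
        intro v x y hxy
        refine hD _ _ fun i => ?_
        simp only [E]
        rcases e i with j | j
        · simpa using hxy j
        · simp
      have hWv : ∀ v, G v → Proper (W fun u => D (E u v)) ∧
          ∀ z, D (E (app (W fun u => D (E u v)) z) v) := fun v hv => hW _ ⟨hins v, hv⟩
      have hID : ∀ u v, I u v → D (E u v) := by
        rintro u v ⟨hG, z, rfl⟩
        exact (hWv v hG).2 z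
      -- the part covered by subspaces
      have part1 : (avg fun v => avg fun u => h (E u v) * ind (I u v)) ≤
          η * avg fun v => avg fun u => ind (I u v) := by
        rw [← avg_mul_left]
        refine avg_mono fun v => ?_
        by_cases hG : G v
        · have hI : ∀ u, ind (I u v) = ind (∃ z, app (W fun u => D (E u v)) z = u) :=
            fun u => ind_congr ⟨fun h => h.2, fun h => ⟨hG, h⟩⟩
          simp only [hI]
          refine avg_image _ (app_injective (hWv v hG).1) (fun u => h (E u v)) η ?_
          convert hsub (fun i => Sum.elim (W fun u => D (E u v)) (fun j => Sum.inl (v j)) (e i))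
            ?_ using 3 with z
          · congr 1
            funext i
            simp only [E, app]
            rcases e i with j | j <;> simp [app]
          · intro x
            obtain ⟨i, hi⟩ := (hWv v hG).1 x
            exact ⟨e.symm (Sum.inl i), by simp [hi]⟩
        · have hI : ∀ u, ind (I u v) = 0 := fun u => ind_false fun h => hG h.1
          simp only [hI, mul_zero, avg_const, le_refl]
      -- the remaining part
      have part2 : ∀ u, (avg fun v => h (E u v) * ind (D (E u v) ∧ ¬ I u v)) ≤
          η * avg (fun v => ind (D (E u v) ∧ ¬ I u v)) + η
            + (1 - ρ) ^ t * (avg (fun v => ind (D (E u v) ∧ ¬ I u v)) - η) := by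
        intro u
        refine ih (Fin r) (by simpa using hr) (fun v => h (E u v)) (fun v => h1 _) ?_
          (fun v => D (E u v) ∧ ¬ I u v) ?_
        · intro w hw
          convert hsub (fun i => Sum.elim (fun j => Sum.inl (u j)) w (e i)) ?_ using 3 with z
          · congr 1
            funext i
            simp only [E, app]
            rcases e i with j | j <;> simp [app]
          · intro x
            obtain ⟨i, hi⟩ := hw x
            exact ⟨e.symm (Sum.inr i), by simp [hi]⟩
        · intro v v' hv
          have hDD : ∀ u, D (E u v) = D (E u v') := by
            intro u
            refine propext (hD _ _ fun i => ?_)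
            simp only [E]
            rcases e i with j | j
            · simp
            · simpa using hv j
          simp only [I, G, hDD]
      have hsum : ∀ u v, ind (D (E u v)) = ind (I u v) + ind (D (E u v) ∧ ¬ I u v) := by
        intro u v
        by_cases hI : I u v
        · rw [ind_true hI, ind_true (hID u v hI), ind_false (fun h => h.2 hI), add_zero]
        · rw [ind_false hI, zero_add]
          exact ind_congr ⟨fun h => ⟨h, hI⟩, fun h => h.1⟩
      have hd : avg (fun x => ind (D x)) = (avg fun v => avg fun u => ind (I u v)) +
          avg fun u => avg fun v => ind (D (E u v) ∧ ¬ I u v) := by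
        rw [hsplit, avg_comm (fun u v => ind (D (E u v) ∧ ¬ I u v)), ← avg_add]
        refine avg_congr fun v => ?_
        rw [← avg_add]
        exact avg_congr fun u => hsum u v
      have hh : avg (fun x => h x * ind (D x)) =
          (avg fun v => avg fun u => h (E u v) * ind (I u v)) +
          avg fun u => avg fun v => h (E u v) * ind (D (E u v) ∧ ¬ I u v) := by
        rw [hsplit, avg_comm (fun u v => h (E u v) * ind (D (E u v) ∧ ¬ I u v)), ← avg_add]
        refine avg_congr fun v => ?_
        rw [← avg_add]
        exact avg_congr fun u => by rw [hsum u v, mul_add]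
      have part2' : (avg fun u => avg fun v => h (E u v) * ind (D (E u v) ∧ ¬ I u v)) ≤
          η * (avg fun u => avg (fun v => ind (D (E u v) ∧ ¬ I u v))) + η
            + (1 - ρ) ^ t * ((avg fun u => avg (fun v => ind (D (E u v) ∧ ¬ I u v))) - η) := by
        refine (avg_mono part2).trans (le_of_eq ?_)
        rw [avg_add, avg_add, avg_mul_left, avg_mul_left, avg_sub, avg_const]
      have hr2 : ρ * (avg (fun x => ind (D x)) - η) ≤ avg fun v => avg fun u => ind (I u v) := by
        have hmk := avg_markov (f := fun v => avg fun u => ind (D (E u v)))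
          (fun v => avg_le_of_le fun u => ind_le_one _) η hη.le
        rw [← hsplit (fun x => ind (D x))] at hmk
        have : ρ * (avg fun v => ind (G v)) ≤ avg fun v => avg fun u => ind (I u v) := by
          rw [← avg_mul_left]
          refine avg_mono fun v => ?_
          by_cases hG : G v
          · rw [ind_true hG, mul_one, hρ, avg]
            gcongr
            have := Fintype.ofFinite (Fin m → Option α)
            rw [tsm_eq]
            let u0 := app (W fun u => D (E u v)) (fun _ => none)
            have h0 : I u0 v := ⟨hG, _, rfl⟩
            rw [← ind_true h0]
            exact Finset.single_le_sum (f := fun u => ind (I u v)) (fun i _ => ind_nonneg _)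
              (Finset.mem_univ u0)
          · rw [ind_false hG, mul_zero]
            exact avg_nonneg fun u => ind_nonneg _
        refine le_trans ?_ this
        gcongr
        linarith
      have hpow : 0 ≤ (1 - ρ) ^ t := pow_nonneg (by linarith) t
      rw [hh, hd] at *
      set r' := avg fun v => avg fun u => ind (I u v)
      set d' := avg fun u => avg fun v => ind (D (E u v) ∧ ¬ I u v)
      have h5 : (1 - ρ) ^ t * (d' - η) ≤ (1 - ρ) ^ t * ((1 - ρ) * (r' + d' - η)) := by
        gcongr
        linarith
      rw [pow_succ, mul_assoc]
      linarith
  obtain ⟨t, ht⟩ := exists_pow_lt_of_lt_one hη (show 1 - ρ < 1 by linarith)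
  refine ⟨t * m, fun ι _ hι h h1 hsub D hD => (claim t ι hι h h1 hsub D hD).trans ?_⟩
  have hd1 : avg (fun x => ind (D x)) ≤ 1 := avg_le_of_le fun x => ind_le_one _
  have hpow : 0 ≤ (1 - ρ) ^ t := pow_nonneg (by linarith) t
  nlinarith

end DHJ

namespace DHJ

theorem Insens.not {ι α : Type} {a : α} {D : (ι → Option α) → Prop} (h : Insens a D) :
    Insens a (fun x => ¬ D x) := fun x y hxy => not_congr (h x y hxy)

theorem Insens.app {ι κ α : Type} {a : α} {D : (ι → Option α) → Prop} (h : Insens a D)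
    (w : ι → Option α ⊕ κ) : Insens a (fun z => D (app w z)) := by
  intro x y hxy
  refine h _ _ fun i => ?_
  unfold DHJ.app
  cases w i with
  | inl o => rfl
  | inr j => exact hxy j

theorem insens_list {α : Type} [Finite α] [Nonempty α] (hα : DHJProp α) (n : ℕ) (l : List α) :
    ∀ η : ℝ, 0 < η → ∃ M : ℕ, ∀ (ι : Type) [Finite ι], M ≤ Nat.card ι →
      ∀ h : (ι → Option α) → ℝ, (∀ x, h x ≤ 1) →
        (∀ w : ι → Option α ⊕ Fin n, Proper w → avg (fun z => h (app w z)) ≤ 0) →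
        ∀ C : α → (ι → Option α) → Prop, (∀ a, Insens a (C a)) →
          avg (fun x => h x * ind (¬ ∀ a ∈ l, C a x)) ≤ η := by
  induction l with
  | nil =>
    intro η hη
    refine ⟨0, fun ι _ _ h _ _ C _ => ?_⟩
    have : ∀ x, h x * ind (¬ ∀ a ∈ ([] : List α), C a x) = 0 := fun x => by
      rw [ind_false (by simp), mul_zero]
    rw [avg_congr this, avg_const]
    exact hη.le
  | cons a l ih =>
    intro η hη
    obtain ⟨n₂, hn₂⟩ := ih (η / 6) (by positivity)
    obtain ⟨M₁, hM₁⟩ := insens_one hα n a (η / 6) (by positivity)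
    obtain ⟨M₂, hM₂⟩ := insens_one hα n₂ a (η / 6) (by positivity)
    refine ⟨max M₁ M₂, fun ι _ hι h h1 hsub C hC => ?_⟩
    have e1 := hM₁ ι ((le_max_left _ _).trans hι) h h1
      (fun w hw => (hsub w hw).trans (by positivity)) _ (hC a).not
    have e2 := hM₂ ι ((le_max_right _ _).trans hι) (fun x => h x * ind (¬ ∀ a ∈ l, C a x)) ?_ ?_
      _ (hC a)
    · have : ∀ x, h x * ind (¬ ∀ b ∈ a :: l, C b x) = h x * ind (¬ C a x) +
          h x * ind (¬ ∀ a ∈ l, C a x) * ind (C a x) := by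
        intro x
        simp only [ind_not, List.forall_mem_cons, ind_and]
        ring
      rw [avg_congr this, avg_add]
      linarith
    · intro x
      by_cases h3 : ∀ a ∈ l, C a x
      · rw [ind_false (by simpa using h3)]; simp
      · rw [ind_true h3]; simpa using h1 x
    · intro w hw
      refine hn₂ (Fin n₂) (by simp) (fun z => h (app w z)) (fun z => h1 _) ?_
        (fun b z => C b (app w z)) (fun b => (hC b).app w)
      intro v hv
      have := hsub (comp w v) (proper_comp hw hv)
      simpa only [app_comp] using this

end DHJ

namespace DHJ

/-- A set of words without combinatorial line. -/
def LineFree {ι α : Type} (A : Set (ι → α)) : Prop :=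
  ¬ ∃ t : ι → Option α, (∃ i, t i = none) ∧ ∀ a, fill t a ∈ A

theorem LineFree.comap {ι κ α : Type} {A : Set (ι → α)} (hA : LineFree A) {w : ι → α ⊕ κ}
    (hw : Proper w) : LineFree {z | app w z ∈ A} := by
  rintro ⟨t, ⟨j, hj⟩, ht⟩
  refine hA ⟨appO w t, ?_, fun a => ?_⟩
  · obtain ⟨i, hi⟩ := hw j
    exact ⟨i, by simp [appO, hi, hj]⟩
  · have : fill (appO w t) a = app w (fill t a) := by
      funext i
      cases h : w i <;> simp [fill, appO, app, h]
    rw [this]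
    exact ht a

theorem extremal {O : Type} [Finite O] [Nonempty O] (h : ¬ DHJProp O) :
    ∃ c : ℝ, 0 < c ∧ c ≤ 1 ∧
      (∀ γ : ℝ, 0 < γ → ∃ n : ℕ, ∀ A : Set (Fin n → O), LineFree A →
        avg (fun x => ind (x ∈ A)) < c + γ) ∧
      (∀ γ : ℝ, 0 < γ → ∀ (ι : Type) [Finite ι], ∃ A : Set (ι → O), LineFree A ∧
        c - γ ≤ avg (fun x => ind (x ∈ A))) := by
  unfold DHJProp at h
  push Not at h
  obtain ⟨δ₀, hδ₀, hd⟩ := h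
  let S : Set ℝ := {δ | ∀ n : ℕ, ∃ A : Set (Fin n → O), LineFree A ∧
    δ ≤ avg (fun x => ind (x ∈ A))}
  have h0 : δ₀ ∈ S := by
    intro n
    obtain ⟨A, hA, hA2⟩ := hd n
    refine ⟨A, ?_, hA⟩
    rintro ⟨t, ht, ht2⟩
    obtain ⟨a, ha⟩ := hA2 t ht
    exact ha (ht2 a)
  have h1 : ∀ δ ∈ S, δ ≤ 1 := by
    intro δ hδ
    obtain ⟨A, _, hA⟩ := hδ 0
    exact hA.trans (avg_le_of_le fun x => ind_le_one _)
  have hb : BddAbove S := ⟨1, h1⟩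
  refine ⟨sSup S, hδ₀.trans_le (le_csSup hb h0), csSup_le ⟨_, h0⟩ h1, ?_, ?_⟩
  · intro γ hγ
    have : sSup S + γ ∉ S := fun hh => by
      have := le_csSup hb hh
      linarith
    simp only [S, Set.mem_ofPred_eq] at this
    push Not at this
    exact this
  · intro γ hγ ι _
    obtain ⟨δ, hδ, hlt⟩ := exists_lt_of_lt_csSup ⟨_, h0⟩ (show sSup S - γ < sSup S by linarith)
    obtain ⟨n, ⟨e⟩⟩ := Finite.exists_equiv_fin ι
    obtain ⟨A, hA, hA2⟩ := hδ n
    refine ⟨{z | app (fun i => Sum.inr (e.symm i)) z ∈ A}, hA.comap ?_, ?_⟩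
    · exact fun i => ⟨e i, by simp⟩
    · refine hlt.le.trans (hA2.trans (le_of_eq ?_))
      rw [← avg_equiv (e.arrowCongr (Equiv.refl O))]
      rfl

theorem avg_lower {X : Type} [Finite X] [Nonempty X] {f : X → ℝ} {a b : ℝ} (hb : ∀ x, f x ≤ b)
    (ha : a ≤ avg f) (x : X) : b - Nat.card X * (b - a) ≤ f x := by
  have := Fintype.ofFinite X
  have hK : (0 : ℝ) < Fintype.card X := by exact_mod_cast Fintype.card_pos
  rw [avg_eq, le_div_iff₀ hK] at ha
  have h1 : b - f x ≤ ∑ y, (b - f y) :=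
    Finset.single_le_sum (f := fun y => b - f y) (fun y _ => by linarith [hb y])
      (Finset.mem_univ x)
  rw [Finset.sum_sub_distrib, Finset.sum_const, Finset.card_univ, nsmul_eq_mul] at h1
  rw [Nat.card_eq_fintype_card]
  linarith

theorem avg_none (α : Type) [Finite α] [Nonempty α] (s : ℝ) (hs : 0 < s) :
    ∃ m : ℕ, ∀ (μ : Type) [Finite μ], m ≤ Nat.card μ →
      avg (fun z : μ → Option α => ind (∀ i, z i ≠ none)) ≤ s := by
  classical
  have := Fintype.ofFinite α
  set q : ℝ := avg fun o : Option α => ind (o ≠ none) with hq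
  have hk : (0 : ℝ) < Fintype.card α := by exact_mod_cast Fintype.card_pos
  have hq0 : 0 ≤ q := avg_nonneg fun o => ind_nonneg _
  have hq1 : q < 1 := by
    rw [hq, avg_eq, Fintype.sum_option, Fintype.card_option]
    have : ∑ x : α, ind ((some x : Option α) ≠ none) = Fintype.card α := by
      rw [Finset.sum_congr rfl fun x _ => ind_true (Option.some_ne_none x)]
      simp
    rw [this, ind_false (by simp), zero_add, div_lt_one (by positivity)]
    push_cast
    linarith
  obtain ⟨m, hm⟩ := exists_pow_lt_of_lt_one hs hq1
  refine ⟨m, fun μ _ hμ => ?_⟩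
  have := Fintype.ofFinite μ
  have hind : ∀ z : μ → Option α, ind (∀ i, z i ≠ none) = ∏ i, ind (z i ≠ none) := by
    intro z
    by_cases h : ∀ i, z i ≠ none
    · rw [ind_true h, Finset.prod_congr rfl fun i _ => ind_true (h i)]
      simp
    · rw [ind_false h]
      push Not at h
      obtain ⟨i, hi⟩ := h
      exact (Finset.prod_eq_zero (Finset.mem_univ i) (ind_false (by simpa using hi))).symm
  have hprod : (avg fun x : μ → Option α => ∏ i, ind (x i ≠ none)) = q ^ Fintype.card μ := by
    have h1 := Finset.sum_prod_piFinset (ι := μ) (Finset.univ : Finset (Option α))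
      (fun _ o => ind (o ≠ none))
    rw [Fintype.piFinset_univ] at h1
    rw [avg_eq, h1, hq, avg_eq]
    simp only [Finset.prod_const, Finset.card_univ, Fintype.card_pi,
      Nat.cast_pow, div_pow]
  rw [avg_congr hind, hprod]
  rw [Nat.card_eq_fintype_card] at hμ
  exact (pow_le_pow_of_le_one hq0 hq1.le hμ).trans hm.le

theorem dhj_step {α : Type} [Finite α] [Nonempty α] (hα : DHJProp α) : DHJProp (Option α) := by
  classical
  by_contra hcon
  have := Fintype.ofFinite α
  let a₀ : α := Classical.arbitrary α
  obtain ⟨c, hc, hc1, hup, hlow⟩ := extremal hcon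
  obtain ⟨m₀, hm₀⟩ := hα (c / 4) (by positivity)
  have hN : (1 : ℝ) ≤ Nat.card (Fin m₀ → Option α) := by
    exact_mod_cast Nat.card_pos
  set θ : ℝ := (c / 4) / Nat.card (Fin m₀ → Option α) with hθ
  have hθ0 : 0 < θ := by positivity
  have hθ1 : θ ≤ 1 / 4 := by
    rw [hθ, div_le_iff₀ (by positivity)]
    linarith
  set s : ℝ := c * θ / 16 with hs
  have hs0 : 0 < s := by positivity
  have hsc : s ≤ c / 16 := by
    rw [hs]; nlinarith
  obtain ⟨n₁, hn₁⟩ := hup s hs0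
  obtain ⟨M₁, hM₁⟩ := insens_list hα n₁ (Finset.univ : Finset α).toList s hs0
  obtain ⟨M₂, hM₂⟩ := avg_none α s hs0
  let μ := Fin m₀ ⊕ Fin (max M₁ M₂)
  have hμ : max M₁ M₂ ≤ Nat.card μ := by simp [μ]
  obtain ⟨ι, _, hGR⟩ := graham_rothschild α μ
  obtain ⟨K, hK⟩ : ∃ K : ℝ, K = ((Nat.card (ι → Option α) : ℕ) : ℝ) := ⟨_, rfl⟩
  have hK1 : (1 : ℝ) ≤ K := by
    rw [hK]
    exact_mod_cast Nat.card_pos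
  set γ : ℝ := s / (2 * K) with hγ
  have hγ0 : 0 < γ := by positivity
  have hKγ : K * (2 * γ) = s := by
    rw [hγ]; field_simp
  obtain ⟨n₀, hn₀⟩ := hup γ hγ0
  obtain ⟨A, hA, hdens⟩ := hlow γ hγ0 (ι ⊕ Fin n₀)
  rw [avg_split, ← avg_comm] at hdens
  have hslice : ∀ x : ι → Option α, (avg fun y => ind (Sum.elim x y ∈ A)) ≤ c + γ := by
    intro x
    have h1 : LineFree {y : Fin n₀ → Option α | Sum.elim x y ∈ A} := by
      have h2 := hA.comap (w := Sum.elim (fun i => Sum.inl (x i)) Sum.inr)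
        (fun j => ⟨Sum.inr j, rfl⟩)
      convert h2 using 4 with y
      funext i
      cases i <;> rfl
    exact (hn₀ _ h1).le
  have hlo : ∀ x : ι → Option α, c - s ≤ avg fun y => ind (Sum.elim x y ∈ A) := by
    intro x
    have := avg_lower hslice hdens x
    rw [← hK] at this
    have h3 : K * (c + γ - (c - γ)) = s := by rw [← hKγ]; ring
    linarith
  obtain ⟨w, hw, hwc⟩ := hGR fun x => θ ≤ avg fun y : Fin n₀ → Option α =>
    ind (∀ a : α, Sum.elim (fun i => some ((x i).getD a)) y ∈ A)
  have happ : ∀ (z : μ → Option α) (a : α), (fun i => some ((appO w z i).getD a)) =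
      appO w fun j => some ((z j).getD a) := by
    intro z a
    funext i
    cases h : w i <;> simp [appO, h]
  simp only [happ] at hwc
  have hfirst : ∃ z : μ → Option α, (∃ i, z i = none) ∧ θ ≤ avg fun y : Fin n₀ → Option α =>
      ind (∀ a : α, Sum.elim (appO w fun j => some ((z j).getD a)) y ∈ A) := by
    let P : (Fin m₀ → α) → (Fin n₀ → Option α) → Prop := fun v y =>
      Sum.elim (appO w (Sum.elim (fun j => some (v j)) (fun _ => some a₀))) y ∈ A
    have h1 : c - s ≤ avg fun y => avg fun v => ind (P v y) := by
      rw [avg_comm]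
      exact le_avg_of_le fun v => hlo _
    have h2 := avg_markov (f := fun y => avg fun v => ind (P v y))
      (fun y => avg_le_of_le fun v => ind_le_one _) (c / 4) (by positivity)
    obtain ⟨t, ht⟩ := avg_pigeon (fun y => c / 4 ≤ avg fun v => ind (P v y))
      (fun y (t : Fin m₀ → Option α) => (∃ i, t i = none) ∧ ∀ a, P (fill t a) y)
      (fun y hy => hm₀ {v | P v y} hy)
    have h3 : θ ≤ avg fun y => ind ((∃ i, t i = none) ∧ ∀ a, P (fill t a) y) := by
      refine le_trans ?_ ht
      rw [hθ]
      gcongr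
      linarith
    have h4 : ∃ i, t i = none := by
      obtain ⟨y, hy⟩ := exists_le_avg fun y => ind ((∃ i, t i = none) ∧ ∀ a, P (fill t a) y)
      by_contra hno
      rw [ind_false (fun h => hno h.1)] at hy
      linarith
    refine ⟨Sum.elim t (fun _ => some a₀), ?_, h3.trans (avg_mono fun y => ind_mono ?_)⟩
    · obtain ⟨i, hi⟩ := h4
      exact ⟨Sum.inl i, hi⟩
    · rintro ⟨-, h⟩ a
      convert h a using 4 with j
      cases j <;> rfl
  have hgood : ∀ z : μ → Option α, (∃ i, z i = none) → θ ≤ avg fun y : Fin n₀ → Option α =>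
      ind (∀ a : α, Sum.elim (appO w fun j => some ((z j).getD a)) y ∈ A) := by
    obtain ⟨z₀, hz₀, hz₀'⟩ := hfirst
    exact fun z hz => (hwc z₀ z hz₀ hz).1 hz₀'
  let A' : (μ → Option α) → (Fin n₀ → Option α) → Prop := fun z y => Sum.elim (appO w z) y ∈ A
  let C : α → (μ → Option α) → (Fin n₀ → Option α) → Prop := fun a z y =>
    A' (fun j => some ((z j).getD a)) y
  have hfree : ∀ y, LineFree {z | A' z y} := by
    intro y
    have h2 := hA.comap
      (w := Sum.elim (fun i => ((w i).map some id : Option α ⊕ μ)) (fun j => Sum.inl (y j)))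
      (fun j => by
        obtain ⟨i, hi⟩ := hw j
        exact ⟨Sum.inl i, by simp [hi]⟩)
    have : ∀ z, (Sum.elim (appO w z) y) =
      app (Sum.elim (fun i => ((w i).map some id : Option α ⊕ μ)) (fun j => Sum.inl (y j))) z := by
      intro z
      rw [← app_some]
      funext i
      cases i <;> rfl
    simp only [A', this]
    exact h2
  have hdisj : ∀ z y, (∃ i, z i = none) → ¬ (A' z y ∧ ∀ a, C a z y) := by
    rintro z y ⟨i, hi⟩ ⟨h1, h2⟩
    refine hfree y ⟨fun j => (z j).map some, ⟨i, by simp [hi]⟩, ?_⟩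
    rintro (_ | a)
    · have : fill (fun j => (z j).map some) none = z := by
        funext j
        cases h : z j <;> simp [fill, h]
      rw [this]
      exact h1
    · have : fill (fun j => (z j).map some) (some a) = fun j => some ((z j).getD a) := by
        funext j
        cases h : z j <;> simp [fill, h]
      rw [this]
      exact h2 a
  have hkey : ∀ y, (avg fun z => (ind (A' z y) - (c + s)) * ind (¬ ∀ a, C a z y)) ≤ s := by
    intro y
    have := hM₁ μ ((le_max_left _ _).trans hμ) (fun z => ind (A' z y) - (c + s))
      (fun z => by linarith [ind_le_one (A' z y)]) ?_ (fun a z => C a z y) ?_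
    · simpa using this
    · intro v hv
      rw [avg_sub, avg_const]
      have := hn₁ _ ((hfree y).comap hv)
      simp only [Set.mem_ofPred_eq] at this
      linarith
    · intro a z z' hzz
      simp only [C, hzz]
  have hall : (avg fun z => avg fun y => (ind (A' z y) - (c + s)) * ind (¬ ∀ a, C a z y)) ≤ s := by
    rw [avg_comm]
    exact avg_le_of_le hkey
  have hpt : ∀ z, c * θ - 2 * s - 4 * ind (∀ i, z i ≠ none) ≤
      avg fun y => (ind (A' z y) - (c + s)) * ind (¬ ∀ a, C a z y) := by
    intro z
    by_cases hz : ∀ i, z i ≠ none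
    · rw [ind_true hz]
      have : -2 ≤ avg fun y => (ind (A' z y) - (c + s)) * ind (¬ ∀ a, C a z y) :=
        le_avg_of_le fun y => by
          nlinarith [ind_nonneg (A' z y), ind_nonneg (¬ ∀ a, C a z y),
            ind_le_one (¬ ∀ a, C a z y)]
      nlinarith
    · have hz' : ∃ i, z i = none := by push Not at hz; exact hz
      rw [ind_false hz]
      have h1 : ∀ y, (ind (A' z y) - (c + s)) * ind (¬ ∀ a, C a z y) =
          (ind (A' z y) - (c + s)) + (c + s) * ind (∀ a, C a z y) := by
        intro y
        have h2 : ind (A' z y) * ind (∀ a, C a z y) = 0 := by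
          rw [← ind_and]
          exact ind_false (hdisj z y hz')
        rw [ind_not]
        linear_combination -h2
      rw [avg_congr h1, avg_add, avg_sub, avg_const, avg_mul_left]
      have h3 := hlo (appO w z)
      have h4 : θ ≤ avg fun y => ind (∀ a, C a z y) := hgood z hz'
      have h5 : c - s ≤ avg fun y => ind (A' z y) := h3
      nlinarith
  have hfin := (avg_mono hpt).trans hall
  rw [avg_sub, avg_const, avg_mul_left] at hfin
  have h6 := hM₂ μ ((le_max_right _ _).trans hμ)
  have h7 : 0 < c * θ := by positivity
  linarith

theorem dhj_one : DHJProp (Fin 1) := by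
  intro δ hδ
  refine ⟨1, fun A hA => ⟨fun _ => none, ⟨0, rfl⟩, fun a => ?_⟩⟩
  obtain ⟨x, hx⟩ := exists_le_avg fun x => ind (x ∈ A)
  by_contra h
  have : x = fill (fun _ => none) a := Subsingleton.elim _ _
  rw [ind_false (this ▸ h)] at hx
  linarith

theorem dhj_equiv {α β : Type} [Finite α] [Finite β] (e : α ≃ β) (h : DHJProp α) : DHJProp β := by
  intro δ hδ
  obtain ⟨m, hm⟩ := h δ hδ
  refine ⟨m, fun A hA => ?_⟩
  obtain ⟨t, ⟨i, hi⟩, ht⟩ := hm {x | (fun i => e (x i)) ∈ A} (by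
    rw [← avg_equiv ((Equiv.refl (Fin m)).arrowCongr e)] at hA
    exact hA)
  refine ⟨fun i => (t i).map e, ⟨i, by simp [hi]⟩, fun b => ?_⟩
  have := ht (e.symm b)
  have heq : fill (fun i => (t i).map e) b = fun i => e (fill t (e.symm b) i) := by
    funext i
    cases h : t i <;> simp [fill, h]
  rw [heq]
  exact this

theorem dhj (k : ℕ) : DHJProp (Fin (k + 1)) := by
  induction k with
  | zero => exact dhj_one
  | succ k ih => exact dhj_equiv (finSuccEquiv (k + 1)).symm (dhj_step ih)

end DHJ

namespace DHJ

theorem sum_ind_le (S T : Finset ℚ) (B : Set ℚ) :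
    ∑ x ∈ S, ind (x ∈ B) ≤ ∑ x ∈ T, ind (x ∈ B) + ((S ∆ T).card : ℝ) := by
  have h1 : S ⊆ T ∪ S ∆ T := by
    intro x hx
    by_cases h : x ∈ T
    · exact Finset.mem_union_left _ h
    · exact Finset.mem_union_right _ (Finset.mem_symmDiff.2 (Or.inl ⟨hx, h⟩))
  have h2 : ∑ x ∈ S, ind (x ∈ B) ≤ ∑ x ∈ T ∪ S ∆ T, ind (x ∈ B) :=
    Finset.sum_le_sum_of_subset_of_nonneg h1 fun x _ _ => ind_nonneg _
  have h3 := Finset.sum_union_inter (s₁ := T) (s₂ := S ∆ T) (f := fun x => ind (x ∈ B))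
  have h4 : 0 ≤ ∑ x ∈ T ∩ S ∆ T, ind (x ∈ B) := Finset.sum_nonneg fun x _ => ind_nonneg _
  have h5 : ∑ x ∈ S ∆ T, ind (x ∈ B) ≤ ∑ x ∈ S ∆ T, (1 : ℝ) :=
    Finset.sum_le_sum fun x _ => ind_le_one _
  rw [Finset.sum_const, nsmul_eq_mul, mul_one] at h5
  linarith

/-- Relative density in a finite set. -/
noncomputable def dn (F : Finset ℚ) (B : Set ℚ) : ℝ := (Set.ncard (B ∩ ↑F) : ℝ) / F.card

theorem dn_eq (F : Finset ℚ) (B : Set ℚ) : dn F B = (∑ x ∈ F, ind (x ∈ B)) / F.card := by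
  classical
  unfold dn
  congr 1
  have : B ∩ ↑F = ((F.filter fun x => x ∈ B : Finset ℚ) : Set ℚ) := by
    ext x
    simp [and_comm]
  rw [this, Set.ncard_coe_finset]
  simp only [ind]
  rw [Finset.sum_boole]

theorem dn_avg (F : Finset ℚ) (B : Set ℚ) : dn F B = avg fun x : F => ind ((x : ℚ) ∈ B) := by
  rw [dn_eq, avg_eq, Finset.sum_coe_sort F fun x => ind (x ∈ B), Fintype.card_coe]

theorem dn_nonneg (F : Finset ℚ) (B : Set ℚ) : 0 ≤ dn F B := by
  unfold dn
  positivity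

theorem dn_le_one (F : Finset ℚ) (B : Set ℚ) : dn F B ≤ 1 := by
  rw [dn_eq]
  refine div_le_one_of_le₀ ?_ (by positivity)
  calc ∑ x ∈ F, ind (x ∈ B) ≤ ∑ x ∈ F, (1 : ℝ) := Finset.sum_le_sum fun x _ => ind_le_one _
    _ = F.card := by simp

theorem dn_shift (F : Finset ℚ) (s : ℚ) (B : Set ℚ) :
    |dn F {x | s + x ∈ B} - dn F B| ≤ (((F.image (s + ·)) ∆ F).card : ℝ) / F.card := by
  have h1 : ∑ x ∈ F, ind (x ∈ {x | s + x ∈ B}) = ∑ x ∈ F.image (s + ·), ind (x ∈ B) := by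
    rw [Finset.sum_image fun _ _ _ _ h => add_left_cancel h]
    rfl
  have h2 := sum_ind_le (F.image (s + ·)) F B
  have h3 := sum_ind_le F (F.image (s + ·)) B
  rw [symmDiff_comm] at h3
  rw [dn_eq, dn_eq, h1, ← sub_div, abs_div, abs_of_nonneg (show (0 : ℝ) ≤ F.card by positivity)]
  gcongr
  rw [abs_le]
  constructor <;> linarith

theorem dn_shift_eventually {F : ℕ → Finset ℚ} (hF : IsLeftFolner F) (s : ℚ) (B : Set ℚ) {ε : ℝ}
    (hε : 0 < ε) : ∀ᶠ n in Filter.atTop, |dn (F n) {x | s + x ∈ B} - dn (F n) B| < ε := by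
  filter_upwards [(hF.2 s).eventually (gt_mem_nhds hε)] with n hn
  exact (dn_shift _ _ _).trans_lt hn

theorem main (F : ℕ → Finset ℚ) (hF : IsLeftFolner F) (A : Set ℚ) (d : ℝ) (hd : 0 < d)
    (hA : ∃ᶠ n in Filter.atTop, d < dn (F n) A) (k : ℕ) :
    ∃ q : ℚ, q ≠ 0 ∧ ∃ κ : ℝ, 0 < κ ∧ ∃ᶠ n in Filter.atTop,
      κ ≤ dn (F n) {x | ∀ j : Fin (k + 1), ((j : ℕ) : ℚ) * q + x ∈ A} := by
  classical
  obtain ⟨m, hm⟩ := dhj k (d / 4) (by positivity)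
  let σ : (Fin m → Fin (k + 1)) → ℚ := fun w => ∑ i, ((w i : ℕ) : ℚ)
  have hN : (0 : ℝ) < Nat.card (Fin m → Option (Fin (k + 1))) := by
    exact_mod_cast Nat.card_pos
  set κ : ℝ := (d / 4) / Nat.card (Fin m → Option (Fin (k + 1))) with hκ
  have hκ0 : 0 < κ := by positivity
  have h1 : ∀ᶠ n in Filter.atTop, ∀ w, |dn (F n) {x | σ w + x ∈ A} - dn (F n) A| < d / 2 :=
    Filter.eventually_all.2 fun w => dn_shift_eventually hF _ _ (by positivity)
  have h2 : ∃ᶠ n in Filter.atTop, ∃ t : Fin m → Option (Fin (k + 1)),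
      κ ≤ dn (F n) {x | (∃ i, t i = none) ∧ ∀ a, σ (fill t a) + x ∈ A} := by
    refine (hA.and_eventually h1).mono ?_
    rintro n ⟨hn, hn1⟩
    have : Nonempty (F n) := (hF.1 n).to_subtype
    have h3 : d / 2 ≤ avg fun x : F n => avg fun w => ind (σ w + (x : ℚ) ∈ A) := by
      rw [avg_comm]
      refine le_avg_of_le fun w => ?_
      have h4 := (abs_lt.1 (hn1 w)).1
      rw [dn_avg (F n) {x | σ w + x ∈ A}] at h4
      simp only [Set.mem_ofPred_eq] at h4
      linarith
    have h5 := avg_markov (f := fun x : F n => avg fun w => ind (σ w + (x : ℚ) ∈ A))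
      (fun x => avg_le_of_le fun w => ind_le_one _) (d / 4) (by positivity)
    obtain ⟨t, ht⟩ := avg_pigeon
      (fun x : F n => d / 4 ≤ avg fun w => ind (σ w + (x : ℚ) ∈ A))
      (fun x (t : Fin m → Option (Fin (k + 1))) => (∃ i, t i = none) ∧
        ∀ a, σ (fill t a) + (x : ℚ) ∈ A)
      (fun x hx => hm {w | σ w + (x : ℚ) ∈ A} hx)
    refine ⟨t, ?_⟩
    rw [dn_avg]
    refine le_trans ?_ ht
    rw [hκ]
    gcongr
    linarith
  obtain ⟨t, ht⟩ : ∃ t : Fin m → Option (Fin (k + 1)), ∃ᶠ n in Filter.atTop,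
      κ ≤ dn (F n) {x | (∃ i, t i = none) ∧ ∀ a, σ (fill t a) + x ∈ A} := by
    by_contra! hcon
    refine h2 ?_
    have h3 : ∀ t : Fin m → Option (Fin (k + 1)), ∀ᶠ n in Filter.atTop,
      ¬ κ ≤ dn (F n) {x | (∃ i, t i = none) ∧ ∀ a, σ (fill t a) + x ∈ A} :=
      fun t => Filter.not_frequently.1 (by simpa using hcon t)
    filter_upwards [Filter.eventually_all.2 h3] with n hn
    rintro ⟨t, ht⟩
    exact hn t ht
  have hnone : ∃ i, t i = none := by
    by_contra hno
    obtain ⟨n, hn⟩ := ht.exists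
    have : {x | (∃ i, t i = none) ∧ ∀ a, σ (fill t a) + x ∈ A} = (∅ : Set ℚ) := by
      ext x
      simp [hno]
    rw [this] at hn
    simp only [dn, Set.empty_inter, Set.ncard_empty, Nat.cast_zero, zero_div] at hn
    linarith
  let q : ℚ := ∑ i, if t i = none then 1 else 0
  let s : ℚ := ∑ i, (t i).elim 0 fun a => ((a : ℕ) : ℚ)
  have hσ : ∀ a, σ (fill t a) = ((a : ℕ) : ℚ) * q + s := by
    intro a
    simp only [σ, q, s, Finset.mul_sum, ← Finset.sum_add_distrib]
    refine Finset.sum_congr rfl fun i _ => ?_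
    cases h : t i <;> simp [fill, h]
  have hq : q ≠ 0 := by
    obtain ⟨i, hi⟩ := hnone
    have : 0 < q := Finset.sum_pos' (fun j _ => by split_ifs <;> norm_num)
      ⟨i, Finset.mem_univ i, by simp [hi]⟩
    exact this.ne'
  refine ⟨q, hq, κ / 2, by positivity, ?_⟩
  refine (ht.and_eventually (dn_shift_eventually hF s
    {x | ∀ j : Fin (k + 1), ((j : ℕ) : ℚ) * q + x ∈ A} (half_pos hκ0))).mono ?_
  rintro n ⟨hn, hn1⟩
  have : {x | (∃ i, t i = none) ∧ ∀ a, σ (fill t a) + x ∈ A} =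
      {x | s + x ∈ {x | ∀ j : Fin (k + 1), ((j : ℕ) : ℚ) * q + x ∈ A}} := by
    ext x
    simp only [Set.mem_ofPred_eq, hσ, hnone, true_and, add_assoc]
  rw [this] at hn
  have := (abs_lt.1 hn1).2
  linarith

end DHJ

/-- If `A ⊆ ℚ` has positive upper density along a left Følner sequence, then for each `k`
there is a nonzero rational `q` with `d̄_ℱ(A ∩ (−q+A) ∩ … ∩ (−kq+A)) > 0`. -/
theorem density_multiple_intersection (F : ℕ → Finset ℚ) (hF : IsLeftFolner F)
    (A : Set ℚ) (hA : 0 < upperDensity F A) (k : ℕ) :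
    ∃ q : ℚ, q ≠ 0 ∧
      0 < upperDensity F (⋂ j : Fin (k + 1), {x : ℚ | ((j : ℕ) : ℚ) * q + x ∈ A}) := by
  have hco : Filter.IsCoboundedUnder (· ≤ ·) Filter.atTop
      (fun n => (Set.ncard (A ∩ ↑(F n)) : ℝ) / (F n).card) :=
    Filter.isCoboundedUnder_le_of_le Filter.atTop (x := 0) fun n => DHJ.dn_nonneg (F n) A
  have h1 : ∃ᶠ n in Filter.atTop, upperDensity F A / 2 < DHJ.dn (F n) A :=
    Filter.frequently_lt_of_lt_limsup hco (half_lt_self hA)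
  obtain ⟨q, hq, κ, hκ, h2⟩ := DHJ.main F hF A _ (half_pos hA) h1 k
  refine ⟨q, hq, hκ.trans_le ?_⟩
  have hset : (⋂ j : Fin (k + 1), {x : ℚ | ((j : ℕ) : ℚ) * q + x ∈ A}) =
      {x | ∀ j : Fin (k + 1), ((j : ℕ) : ℚ) * q + x ∈ A} := by
    ext x
    simp
  rw [hset]
  exact Filter.le_limsup_of_frequently_le h2
    (Filter.isBoundedUnder_of ⟨1, fun n => DHJ.dn_le_one (F n) _⟩)
end
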